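/- Let T < ∞, let a ∈ (0,1), and let (f,p) be a solution of problem (P) on (0,T) with initial datum f_I satisfying conditions (i)–(iii). Then the flux λ(t) = −∂_x f(p(t),t) satisfies ∫_0^T λ(t) dt < ∞. -/

import Mathlib

open MeasureTheory

/-- The 1D heat kernel `K(x,t) = (4πt)^{-1/2} exp(-x²/(4t))`. -/
noncomputable def heatK (x t : ℝ) : ℝ :=
  (Real.sqrt (4 * Real.pi * t))⁻¹ * Real.exp (-(x ^ 2) / (4 * t))

/-- The Neumann heat kernel on `[-1,1]`:
`Γ(x,x';t) = Σ_{k∈ℤ} K(x − (2k + (−1)^{|k|} x'), t)`. -/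
noncomputable def heatGamma (x x' t : ℝ) : ℝ :=
  ∑' k : ℤ, heatK (x - (2 * (k : ℝ) + (-1 : ℝ) ^ k.natAbs * x')) t

/-- The flux `λ(s) = −∂ₓ f(p(s), s)` at the free boundary. -/
noncomputable def flux (f : ℝ → ℝ → ℝ) (p : ℝ → ℝ) (s : ℝ) : ℝ :=
  -deriv (fun x => f x s) (p s)

/-- `ā(s) = min {a, 1 − p(s), 1 + p(s)}`. -/
noncomputable def abar (a : ℝ) (p : ℝ → ℝ) (s : ℝ) : ℝ :=
  min a (min (1 - p s) (1 + p s))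

/-- The sup norm `‖h‖_{L^∞(−1,1)}` (for continuous `h`). -/
noncomputable def supNorm (h : ℝ → ℝ) : ℝ := ⨆ x : Set.Icc (-1:ℝ) 1, |h x.1|

/-- Conditions (i)–(iii) on the initial datum `f_I ∈ C²([−1,1])`:
(i) unique zero `p_I ∈ (−1,1)`, positive to the left, negative to the right;
(ii) Neumann conditions `∂ₓf_I(±1) = 0`;
(iii) `λ_I = −∂ₓ f_I(p_I) > 0` and `−∂ₓ f_I > λ_I/2` on `(p_I − a₀, p_I + a₀)`. -/
structure IsInitialDatum (fI : ℝ → ℝ) (pI a₀ lamI : ℝ) : Prop where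
  smooth : ContDiffOn ℝ 2 fI (Set.Icc (-1) 1)
  pI_mem : pI ∈ Set.Ioo (-1 : ℝ) 1
  zero_at : fI pI = 0
  pos_left : ∀ x ∈ Set.Ico (-1 : ℝ) pI, 0 < fI x
  neg_right : ∀ x ∈ Set.Ioc pI 1, fI x < 0
  neumann_left : derivWithin fI (Set.Icc (-1) 1) (-1) = 0
  neumann_right : derivWithin fI (Set.Icc (-1) 1) 1 = 0
  lamI_eq : lamI = -deriv fI pI
  lamI_pos : 0 < lamI
  slope : ∀ x ∈ Set.Ioo (pI - a₀) (pI + a₀), lamI / 2 < -deriv fI x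

/-- A solution `(f, p)` of problem (P) on the time set `J` with parameter `a` and
initial datum `f_I`: `p` is a continuous curve in `(−1,1)`, `p(t)` is the unique zero
of `f(·,t)` (positive to the left, negative to the right), `f(·,t)` is differentiable
at `p(t)`, the flux is locally integrable on `J`, and the Duhamel identity holds. -/
structure IsSolutionP (a : ℝ) (fI : ℝ → ℝ) (J : Set ℝ) (f : ℝ → ℝ → ℝ) (p : ℝ → ℝ) : Prop where
  p_cont : ContinuousOn p J
  p_mem : ∀ t ∈ J, p t ∈ Set.Ioo (-1 : ℝ) 1
  zero_at : ∀ t ∈ J, f (p t) t = 0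
  pos_left : ∀ t ∈ J, ∀ x ∈ Set.Ico (-1 : ℝ) (p t), 0 < f x t
  neg_right : ∀ t ∈ J, ∀ x ∈ Set.Ioc (p t) 1, f x t < 0
  diff_at : ∀ t ∈ J, DifferentiableAt ℝ (fun x => f x t) (p t)
  flux_loc_int : LocallyIntegrableOn (flux f p) J
  duhamel : ∀ t ∈ J, ∀ x ∈ Set.Icc (-1 : ℝ) 1,
      f x t = (∫ x' in (-1 : ℝ)..1, heatGamma x x' t * fI x')
        + ∫ s in (0 : ℝ)..t,
            (heatGamma x (p s - abar a p s) (t - s)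
              - heatGamma x (p s + abar a p s) (t - s)) * flux f p s

/-- The Duhamel iterate with data `(p_n, λ_n)` and initial datum `f_I`. -/
noncomputable def duhamelIterate (a : ℝ) (fI pn lamn : ℝ → ℝ) (x t : ℝ) : ℝ :=
  (∫ x' in (-1 : ℝ)..1, heatGamma x x' t * fI x')
    + ∫ s in (0 : ℝ)..t,
        (heatGamma x (pn s - a) (t - s) - heatGamma x (pn s + a) (t - s)) * lamn s

open MeasureTheory Set Filter Topology

noncomputable def cN (n : ℕ) (x : ℝ) : ℝ := Real.cos (n * (Real.pi * (x + 1) / 2))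
noncomputable def muN (n : ℕ) : ℝ := (n * (Real.pi / 2)) ^ 2
noncomputable def kap (x : ℝ) : ℝ := Real.cos (Real.pi * (x + 1) / 2)

lemma cN_abs_le (n : ℕ) (x : ℝ) : |cN n x| ≤ 1 := Real.abs_cos_le_one _

lemma cN_zero (x : ℝ) : cN 0 x = 1 := by simp [cN]

lemma cN_continuous (n : ℕ) : Continuous (cN n) := by unfold cN; fun_prop

lemma kap_continuous : Continuous kap := by unfold kap; fun_prop

lemma muN_nonneg (n : ℕ) : 0 ≤ muN n := sq_nonneg _

lemma cN_eq_T (n : ℕ) (x : ℝ) : cN n x = (Polynomial.Chebyshev.T ℝ n).eval (kap x) := by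
  unfold cN kap
  rw [Polynomial.Chebyshev.T_real_cos]
  simp

lemma neg_one_pow_natAbs_even (j : ℤ) : (-1 : ℝ) ^ (2 * j).natAbs = 1 := by
  rw [Int.natAbs_mul, pow_mul]; simp

lemma neg_one_pow_natAbs_odd (j : ℤ) : (-1 : ℝ) ^ (2 * j + 1).natAbs = -1 := by
  apply Odd.neg_one_pow
  rw [Int.natAbs_odd]
  exact odd_two_mul_add_one j

lemma heatK_nonneg (x t : ℝ) : 0 ≤ heatK x t := by unfold heatK; positivity

lemma heatGamma_nonneg (x y t : ℝ) : 0 ≤ heatGamma x y t := by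
  unfold heatGamma; exact tsum_nonneg fun k => heatK_nonneg _ _

lemma heatK_hasSum (b : ℝ) {t : ℝ} (ht : 0 < t) :
    HasSum (fun j : ℤ => heatK (b - 4 * j) t)
      ((1/4) * HurwitzZeta.cosKernel ((b / 4 : ℝ) : UnitAddCircle) (Real.pi * t / 4)) := by
  have hT : 0 < 4 / (Real.pi * t) := by positivity
  have h1 := HurwitzZeta.hasSum_int_evenKernel (b / 4) hT
  rw [HurwitzZeta.evenKernel_functional_equation] at h1
  have h2 := ((Equiv.neg ℤ).hasSum_iff).2 h1
  have h3 := h2.mul_left ((Real.sqrt (4 * Real.pi * t))⁻¹)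
  convert! h3 using 1
  · funext j
    simp only [Function.comp, Equiv.neg_apply, heatK]
    congr 2
    push_cast
    have := Real.pi_pos
    field_simp
    ring
  · rw [← Real.sqrt_eq_rpow]
    have e1 : Real.sqrt (4 * Real.pi * t) = 2 * Real.sqrt (Real.pi * t) := by
      rw [mul_assoc, Real.sqrt_mul (by norm_num)]
      congr 1
      rw [show (4:ℝ) = 2^2 by norm_num, Real.sqrt_sq (by norm_num)]
    have e2 : Real.sqrt (4 / (Real.pi * t)) = 2 / Real.sqrt (Real.pi * t) := by
      rw [Real.sqrt_div (by norm_num)]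
      congr 1
      rw [show (4:ℝ) = 2^2 by norm_num, Real.sqrt_sq (by norm_num)]
    have e3 : (1:ℝ) / (4 / (Real.pi * t)) = Real.pi * t / 4 := by
      rw [one_div, inv_div]
    have h0 : 0 < Real.sqrt (Real.pi * t) := Real.sqrt_pos.2 (by positivity)
    rw [e1, e2, e3]
    field_simp
    ring

lemma hasSum_int_even_odd {f : ℤ → ℝ} {m m' : ℝ} (he : HasSum (fun k : ℤ => f (2 * k)) m)
    (ho : HasSum (fun k : ℤ => f (2 * k + 1)) m') : HasSum f (m + m') := by
  have h2 := mul_right_injective₀ (two_ne_zero' ℤ)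
  replace ho := ((add_left_injective (1:ℤ)).comp h2).hasSum_range_iff.2 ho
  refine (h2.hasSum_range_iff.2 he).add_isCompl ?_ ho
  simpa [Function.comp_def] using Int.isCompl_even_odd

lemma gamma_hasSum_aux (x y : ℝ) {t : ℝ} (ht : 0 < t) :
    HasSum (fun k : ℤ => heatK (x - (2 * (k : ℝ) + (-1 : ℝ) ^ k.natAbs * y)) t)
      ((1/4) * HurwitzZeta.cosKernel (((x - y) / 4 : ℝ) : UnitAddCircle) (Real.pi * t / 4)
      + (1/4) * HurwitzZeta.cosKernel (((x - 2 + y) / 4 : ℝ) : UnitAddCircle) (Real.pi * t / 4)) := by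
  have h1 := heatK_hasSum (x - y) ht
  have h2 := heatK_hasSum (x - 2 + y) ht
  refine hasSum_int_even_odd ?_ ?_
  · convert h1 using 2 with j
    rw [neg_one_pow_natAbs_even]; push_cast; ring_nf
  · convert h2 using 2 with j
    rw [neg_one_pow_natAbs_odd]; push_cast; ring_nf

lemma gamma_summable (x y : ℝ) {t : ℝ} (ht : 0 < t) :
    Summable (fun k : ℤ => heatK (x - (2 * (k : ℝ) + (-1 : ℝ) ^ k.natAbs * y)) t) :=
  (gamma_hasSum_aux x y ht).summable

lemma gamma_fourier (x y : ℝ) {t : ℝ} (ht : 0 < t) :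
    HasSum (fun n : ℕ => Real.exp (-muN (n+1) * t) * cN (n+1) x * cN (n+1) y)
      (heatGamma x y t - 1/2) := by
  have hT : 0 < Real.pi * t / 4 := by positivity
  have h1 := HurwitzZeta.hasSum_nat_cosKernel₀ ((x - y) / 4) hT
  have h2 := HurwitzZeta.hasSum_nat_cosKernel₀ ((x - 2 + y) / 4) hT
  have h3 := (h1.add h2).mul_left (1/4)
  convert! h3 using 1
  · funext n
    have e : Real.exp (-muN (n+1) * t) = Real.exp (-Real.pi * (n + 1) ^ 2 * (Real.pi * t / 4)) := by
      congr 1; unfold muN; push_cast; ring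
    rw [e]
    have key : 2 * (cN (n+1) x * cN (n+1) y) = Real.cos (2 * Real.pi * ((x - y) / 4) * (n + 1))
        + Real.cos (2 * Real.pi * ((x - 2 + y) / 4) * (n + 1)) := by
      rw [Real.cos_add_cos]
      have e1 : (2 * Real.pi * ((x - y) / 4) * (n + 1) + 2 * Real.pi * ((x - 2 + y) / 4) * (n + 1)) / 2
        = ((n+1 : ℕ) : ℝ) * (Real.pi * (x + 1) / 2) - ((n + 1 : ℕ) : ℝ) * Real.pi := by push_cast; ring
      have e2 : (2 * Real.pi * ((x - y) / 4) * (n + 1) - 2 * Real.pi * ((x - 2 + y) / 4) * (n + 1)) / 2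
        = -(((n+1 : ℕ) : ℝ) * (Real.pi * (y + 1) / 2) - ((n + 1 : ℕ) : ℝ) * Real.pi) := by push_cast; ring
      rw [e1, e2, Real.cos_neg, Real.cos_sub_nat_mul_pi, Real.cos_sub_nat_mul_pi]
      unfold cN
      have : ((-1:ℝ) ^ (n+1)) * ((-1) ^ (n+1)) = 1 := by rw [← mul_pow]; norm_num
      linear_combination (-2 * (Real.cos (((n+1 : ℕ) : ℝ) * (Real.pi * (x + 1) / 2)) * Real.cos (((n+1 : ℕ) : ℝ) * (Real.pi * (y + 1) / 2)))) * this
    linear_combination (Real.exp (-Real.pi * (n + 1) ^ 2 * (Real.pi * t / 4)) / 2) * key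
  · unfold heatGamma
    rw [(gamma_hasSum_aux x y ht).tsum_eq]
    ring

lemma gamma_symm (x y : ℝ) {t : ℝ} (ht : 0 < t) : heatGamma x y t = heatGamma y x t := by
  have h1 := gamma_fourier x y ht
  have h2 := gamma_fourier y x ht
  have : (fun n : ℕ => Real.exp (-muN (n+1) * t) * cN (n+1) x * cN (n+1) y)
    = fun n : ℕ => Real.exp (-muN (n+1) * t) * cN (n+1) y * cN (n+1) x := by funext n; ring
  rw [this] at h1
  linarith [h1.unique h2]


noncomputable def imgK (k : ℤ) (y : ℝ) : ℝ := 2 * (k : ℝ) + (-1 : ℝ) ^ k.natAbs * y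
noncomputable def heatK1 (z t : ℝ) : ℝ := -(z / (2 * t)) * heatK z t
noncomputable def gamma1 (x y t : ℝ) : ℝ := ∑' k : ℤ, heatK1 (x - imgK k y) t

lemma heatGamma_eq (x y t : ℝ) : heatGamma x y t = ∑' k : ℤ, heatK (x - imgK k y) t := rfl

lemma heatK_bound {c T0 : ℝ} (hc : 0 < c) (hT0 : 0 < T0) :
    ∃ C : ℝ, 0 ≤ C ∧ ∀ z t : ℝ, 0 < t → t ≤ T0 → c ≤ z ^ 2 + t →
      |heatK z t| ≤ C / (1 + z ^ 2) ∧ |heatK1 z t| ≤ C / (1 + z ^ 2) := by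
  set A0 := Real.sqrt (4 * Real.pi * T0) with hA0
  have hA0p : 0 < A0 := Real.sqrt_pos.2 (by positivity)
  set B := 24 * Real.exp 1 * A0 with hB
  have hBp : 0 < B := by positivity
  set m := 1 / c + 1 with hm
  have hmp : 0 < m := by positivity
  refine ⟨B * m + 2 * B * m * m, by positivity, ?_⟩
  intro z t ht htT hz
  set s := 4 * t + z ^ 2 with hs
  have hsp : 0 < s := by positivity
  have hsc : c ≤ s := by nlinarith
  have hms : 1 + z ^ 2 ≤ s * m := by
    have : s * m = s / c + s := by rw [hm]; ring
    rw [this]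
    have : 1 ≤ s / c := by rwa [le_div_iff₀ hc, one_mul]
    nlinarith
  set A := Real.sqrt (4 * Real.pi * t) with hA
  have hAp : 0 < A := Real.sqrt_pos.2 (by positivity)
  have hAA : A * A = 4 * Real.pi * t := Real.mul_self_sqrt (by positivity)
  have hAle : A ≤ A0 := Real.sqrt_le_sqrt (by have := Real.pi_pos; gcongr)
  have hK : heatK z t = A⁻¹ * Real.exp (-(z ^ 2) / (4 * t)) := rfl
  have hexp : Real.exp (-(z ^ 2) / (4 * t)) ≤ 24 * Real.exp 1 * (4 * t) ^ 4 / s ^ 4 := by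
    have h1 := Real.pow_div_factorial_le_exp (x := s / (4 * t)) (by positivity) 4
    have h2 : s / (4 * t) = 1 + z ^ 2 / (4 * t) := by rw [hs]; field_simp
    have h3 : Real.exp (-(z ^ 2) / (4 * t)) = Real.exp 1 / Real.exp (s / (4 * t)) := by
      rw [← Real.exp_sub, h2]; congr 1; ring
    rw [h3, div_le_div_iff₀ (Real.exp_pos _) (by positivity)]
    have h4 : s ^ 4 ≤ 24 * (4 * t) ^ 4 * Real.exp (s / (4 * t)) := by
      have : (s / (4 * t)) ^ 4 / (Nat.factorial 4 : ℝ) = s ^ 4 / (24 * (4 * t) ^ 4) := by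
        rw [show (Nat.factorial 4 : ℝ) = 24 by norm_num [Nat.factorial]]; field_simp
      rw [this, div_le_iff₀ (by positivity)] at h1
      linarith
    have := Real.exp_pos 1
    nlinarith
  have hAinv : A⁻¹ * (4 * t) ≤ A0 := by
    have : A⁻¹ * (4 * t) ≤ A := by
      rw [inv_mul_le_iff₀ hAp, hAA]
      have := Real.two_le_pi
      nlinarith
    linarith
  have hKn : 0 ≤ heatK z t := heatK_nonneg z t
  have hK2 : heatK z t ≤ B * (4 * t) ^ 3 / s ^ 4 := by
    rw [hK]
    calc A⁻¹ * Real.exp (-(z ^ 2) / (4 * t)) ≤ A⁻¹ * (24 * Real.exp 1 * (4 * t) ^ 4 / s ^ 4) := by gcongr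
      _ = (A⁻¹ * (4 * t)) * (24 * Real.exp 1 * (4 * t) ^ 3 / s ^ 4) := by ring
      _ ≤ A0 * (24 * Real.exp 1 * (4 * t) ^ 3 / s ^ 4) := by gcongr
      _ = _ := by rw [hB]; ring
  have h4ts : 4 * t ≤ s := by rw [hs]; nlinarith [sq_nonneg z]
  have hinv : 1 / s ≤ m / (1 + z ^ 2) := by
    rw [div_le_div_iff₀ hsp (by positivity)]; linarith
  constructor
  · rw [abs_of_nonneg hKn]
    calc heatK z t ≤ B * (4 * t) ^ 3 / s ^ 4 := hK2
      _ ≤ B * s ^ 3 / s ^ 4 := by gcongr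
      _ = B * (1 / s) := by field_simp
      _ ≤ B * (m / (1 + z ^ 2)) := by gcongr
      _ = (B * m) / (1 + z ^ 2) := by ring
      _ ≤ _ := by gcongr; nlinarith [mul_pos (mul_pos hBp hmp) hmp]
  · have hz1 : |z| ≤ 1 + z ^ 2 := by
      rcases abs_cases z with ⟨h, _⟩ | ⟨h, _⟩ <;> rw [h] <;> nlinarith [sq_nonneg (z - 1), sq_nonneg (z + 1)]
    have h1 : |heatK1 z t| = |z| / (2 * t) * heatK z t := by
      unfold heatK1
      rw [abs_mul, abs_neg, abs_div, abs_of_nonneg hKn, abs_of_pos (by positivity : 0 < 2 * t)]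
    rw [h1]
    calc |z| / (2 * t) * heatK z t ≤ (s * m) / (2 * t) * (B * (4 * t) ^ 3 / s ^ 4) := by
          gcongr; linarith
      _ = 2 * B * m * ((4 * t) ^ 2 / s ^ 3) := by field_simp; ring
      _ ≤ 2 * B * m * (s ^ 2 / s ^ 3) := by gcongr
      _ = 2 * B * m * (1 / s) := by field_simp
      _ ≤ 2 * B * m * (m / (1 + z ^ 2)) := by gcongr
      _ = (2 * B * m * m) / (1 + z ^ 2) := by ring
      _ ≤ _ := by gcongr; nlinarith [mul_pos hBp hmp]

lemma abs_sub_imgK_ge {x y : ℝ} (hx : x ∈ Icc (-1:ℝ) 1) (hy : y ∈ Icc (-1:ℝ) 1) (k : ℤ) :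
    |x - y| ≤ |x - imgK k y| := by
  obtain ⟨hx1, hx2⟩ := hx
  obtain ⟨hy1, hy2⟩ := hy
  unfold imgK
  rcases Int.even_or_odd' k with ⟨j, rfl | rfl⟩
  · rw [neg_one_pow_natAbs_even]
    rcases eq_or_ne j 0 with rfl | hj
    · simp
    · rcases lt_or_gt_of_ne hj with h | h
      · have h' : (j:ℝ) ≤ -1 := by exact_mod_cast (by omega : j ≤ -1)
        push_cast
        rw [abs_le]; constructor <;> rw [abs_of_nonneg (by linarith)] <;> linarith
      · have h' : (1:ℝ) ≤ j := by exact_mod_cast (by omega : 1 ≤ j)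
        push_cast
        rw [abs_le]; constructor <;> rw [abs_of_nonpos (by linarith)] <;> linarith
  · rw [neg_one_pow_natAbs_odd]
    push_cast
    rcases le_or_gt 0 j with h | h
    · have h' : (0:ℝ) ≤ j := by exact_mod_cast h
      rw [abs_le]; constructor <;> rw [abs_of_nonpos (by linarith)] <;> linarith
    · have h' : (j:ℝ) ≤ -1 := by exact_mod_cast (by omega : j ≤ -1)
      rw [abs_le]; constructor <;> rw [abs_of_nonneg (by linarith)] <;> linarith

lemma imgK_decay {x y : ℝ} (hx : x ∈ Icc (-1:ℝ) 1) (hy : y ∈ Icc (-1:ℝ) 1) (k : ℤ) :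
    1 / (1 + (x - imgK k y) ^ 2) ≤ 2 / (1 + (k:ℝ) ^ 2) := by
  obtain ⟨hx1, hx2⟩ := hx
  obtain ⟨hy1, hy2⟩ := hy
  rw [div_le_div_iff₀ (by positivity) (by positivity)]
  have hs : |(-1 : ℝ) ^ k.natAbs * y| ≤ 1 := by
    rw [abs_mul, abs_pow, abs_neg, abs_one, one_pow, one_mul, abs_le]; exact ⟨hy1, hy2⟩
  obtain ⟨hs1, hs2⟩ := abs_le.1 hs
  unfold imgK
  set e := (-1 : ℝ) ^ k.natAbs * y
  rcases le_or_gt k (-2) with h | h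
  · have h' : (k:ℝ) ≤ -2 := by exact_mod_cast h
    nlinarith
  · rcases le_or_gt 2 k with h2 | h2
    · have h' : (2:ℝ) ≤ k := by exact_mod_cast h2
      nlinarith
    · have h3 : (k:ℝ) ^ 2 ≤ 1 := by
        have a1 : (-1:ℝ) ≤ k := by exact_mod_cast (by omega : -1 ≤ k)
        have a2 : (k:ℝ) ≤ 1 := by exact_mod_cast (by omega : k ≤ 1)
        nlinarith
      nlinarith [sq_nonneg (x - (2 * (k:ℝ) + e))]

lemma summable_inv_one_add_sq (C : ℝ) : Summable (fun k : ℤ => C * (2 / (1 + (k:ℝ) ^ 2))) := by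
  apply Summable.mul_left
  have h : Summable (fun k : ℤ => 2 * (1 / (k:ℝ) ^ 2)) :=
    ((Real.summable_one_div_int_pow (p := 2)).2 (by norm_num)).mul_left 2
  refine Summable.of_norm_bounded_eventually h ?_
  have : ({0} : Set ℤ)ᶜ ∈ cofinite := (Set.finite_singleton (0:ℤ)).compl_mem_cofinite
  filter_upwards [this] with k hk
  have hk' : (k:ℝ) ≠ 0 := by exact_mod_cast hk
  rw [Real.norm_of_nonneg (by positivity), mul_one_div]
  gcongr
  linarith

lemma sq_sub_img {x y : ℝ} (hx : x ∈ Icc (-1:ℝ) 1) (hy : y ∈ Icc (-1:ℝ) 1) (k : ℤ) :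
    (x - y) ^ 2 ≤ (x - imgK k y) ^ 2 := sq_le_sq.2 (abs_sub_imgK_ge hx hy k)

lemma img_bound {c T0 : ℝ} (hc : 0 < c) (hT0 : 0 < T0) :
    ∃ C : ℝ, 0 ≤ C ∧ ∀ x ∈ Icc (-1:ℝ) 1, ∀ y ∈ Icc (-1:ℝ) 1, ∀ t : ℝ, 0 < t → t ≤ T0 →
      c ≤ (x - y) ^ 2 + t → ∀ k : ℤ,
      |heatK (x - imgK k y) t| ≤ C * (2 / (1 + (k:ℝ) ^ 2)) ∧
      |heatK1 (x - imgK k y) t| ≤ C * (2 / (1 + (k:ℝ) ^ 2)) := by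
  obtain ⟨C, hC, h⟩ := heatK_bound hc hT0
  refine ⟨C, hC, fun x hx y hy t ht htT hxy k => ?_⟩
  have h1 := h (x - imgK k y) t ht htT (by linarith [sq_sub_img hx hy k])
  have h2 := imgK_decay hx hy k
  have h3 : C / (1 + (x - imgK k y) ^ 2) ≤ C * (2 / (1 + (k:ℝ) ^ 2)) := by
    rw [div_eq_mul_one_div]; gcongr
  exact ⟨h1.1.trans h3, h1.2.trans h3⟩

lemma gamma_bound {c T0 : ℝ} (hc : 0 < c) (hT0 : 0 < T0) :
    ∃ C : ℝ, 0 ≤ C ∧ ∀ x ∈ Icc (-1:ℝ) 1, ∀ y ∈ Icc (-1:ℝ) 1, ∀ t : ℝ, 0 < t → t ≤ T0 →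
      c ≤ (x - y) ^ 2 + t → |heatGamma x y t| ≤ C ∧ |gamma1 x y t| ≤ C := by
  obtain ⟨C, hC, h⟩ := img_bound hc hT0
  have hs := summable_inv_one_add_sq C
  refine ⟨∑' k : ℤ, C * (2 / (1 + (k:ℝ) ^ 2)), tsum_nonneg fun k => by positivity,
    fun x hx y hy t ht htT hxy => ?_⟩
  constructor
  · rw [heatGamma_eq]
    exact tsum_of_norm_bounded (f := fun k : ℤ => heatK (x - imgK k y) t) hs.hasSum
      fun k => (h x hx y hy t ht htT hxy k).1
  · exact tsum_of_norm_bounded (f := fun k : ℤ => heatK1 (x - imgK k y) t) hs.hasSum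
      fun k => (h x hx y hy t ht htT hxy k).2

lemma heatK_hasDerivAt (z : ℝ) {t : ℝ} (ht : 0 < t) : HasDerivAt (fun z => heatK z t) (heatK1 z t) z := by
  unfold heatK heatK1
  have h : HasDerivAt (fun z : ℝ => -(z ^ 2) / (4 * t)) (-(2 * z) / (4 * t)) z := by
    have := ((hasDerivAt_pow 2 z).neg).div_const (4 * t)
    simpa using this
  have := (h.exp).const_mul ((Real.sqrt (4 * Real.pi * t))⁻¹)
  convert! this using 1
  unfold heatK
  field_simp
  ring

lemma gamma_hasDerivAt {x y : ℝ} (hx : x ∈ Ioo (-1:ℝ) 1) (hy : y ∈ Icc (-1:ℝ) 1) {t : ℝ} (ht : 0 < t) :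
    HasDerivAt (fun x => heatGamma x y t) (gamma1 x y t) x := by
  obtain ⟨C, hC, h⟩ := img_bound ht ht
  have hs := summable_inv_one_add_sq C
  have := hasDerivAt_tsum_of_isPreconnected (g := fun (k : ℤ) (x : ℝ) => heatK (x - imgK k y) t)
    (g' := fun (k : ℤ) (x : ℝ) => heatK1 (x - imgK k y) t) hs isOpen_Ioo isPreconnected_Ioo
    (t := Ioo (-1:ℝ) 1) (y₀ := x) (y := x)
    (fun k z hz => by
      have h1 := (heatK_hasDerivAt (z - imgK k y) ht)
      exact h1.comp_sub_const z (imgK k y))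
    (fun k z hz => (h z (Ioo_subset_Icc_self hz) y hy t ht le_rfl (by nlinarith [sq_nonneg (z - y)]) k).2)
    hx (gamma_summable x y ht) hx
  exact this

lemma heatK_continuousOn : ContinuousOn (fun w : ℝ × ℝ => heatK w.1 w.2) {w | 0 < w.2} := by
  unfold heatK
  intro w hw
  have hw' : (0:ℝ) < w.2 := hw
  have h1 : Real.sqrt (4 * Real.pi * w.2) ≠ 0 := (Real.sqrt_pos.2 (by positivity)).ne'
  have h2 : 4 * w.2 ≠ 0 := by positivity
  apply ContinuousAt.continuousWithinAt
  exact ContinuousAt.mul (ContinuousAt.inv₀ (by fun_prop) h1)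
    (Real.continuous_exp.continuousAt.comp (ContinuousAt.div (by fun_prop) (by fun_prop) h2))

lemma heatK1_continuousOn : ContinuousOn (fun w : ℝ × ℝ => heatK1 w.1 w.2) {w | 0 < w.2} := by
  unfold heatK1
  refine ContinuousOn.mul ?_ heatK_continuousOn
  intro w hw
  have hw' : (0:ℝ) < w.2 := hw
  have h2 : 2 * w.2 ≠ 0 := by positivity
  apply ContinuousAt.continuousWithinAt
  have h3 : ContinuousAt (fun w : ℝ × ℝ => w.1 / (2 * w.2)) w :=
    ContinuousAt.div (by fun_prop) (by fun_prop) h2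
  exact h3.neg

def dom3 : Set (ℝ × ℝ × ℝ) := {w | w.1 ∈ Icc (-1:ℝ) 1 ∧ w.2.1 ∈ Icc (-1:ℝ) 1 ∧ 0 < w.2.2}

lemma imgsum_continuousOn (g : ℝ → ℝ → ℝ) (hg : ContinuousOn (fun w : ℝ × ℝ => g w.1 w.2) {w | 0 < w.2})
    (hb : ∀ α β : ℝ, 0 < α → 0 < β → ∃ C : ℝ, ∀ x ∈ Icc (-1:ℝ) 1, ∀ y ∈ Icc (-1:ℝ) 1, ∀ t : ℝ, α < t → t < β →
      ∀ k : ℤ, |g (x - imgK k y) t| ≤ C * (2 / (1 + (k:ℝ) ^ 2))) :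
    ContinuousOn (fun w : ℝ × ℝ × ℝ => ∑' k : ℤ, g (w.1 - imgK k w.2.1) w.2.2) dom3 := by
  apply continuousOn_of_locally_continuousOn
  rintro w ⟨hw1, hw2, hw3⟩
  refine ⟨{v | w.2.2 / 2 < v.2.2 ∧ v.2.2 < w.2.2 + 1}, ?_, ⟨by linarith, by linarith⟩, ?_⟩
  · have hc : Continuous (fun v : ℝ × ℝ × ℝ => v.2.2) := by fun_prop
    exact (isOpen_lt continuous_const hc).inter (isOpen_lt hc continuous_const)
  obtain ⟨C, hC⟩ := hb (w.2.2 / 2) (w.2.2 + 1) (by linarith) (by linarith)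
  refine continuousOn_tsum (u := fun k : ℤ => C * (2 / (1 + (k:ℝ) ^ 2))) ?_ (summable_inv_one_add_sq C) ?_
  · intro k
    refine hg.comp (f := fun v : ℝ × ℝ × ℝ => (v.1 - imgK k v.2.1, v.2.2)) ?_ ?_
    · unfold imgK; fun_prop
    · rintro v ⟨⟨_, _, hv⟩, _⟩
      exact hv
  · rintro k v ⟨⟨h1, h2, _⟩, h4, h5⟩
    exact hC v.1 h1 v.2.1 h2 v.2.2 h4 h5 k

lemma gamma_continuousOn : ContinuousOn (fun w : ℝ × ℝ × ℝ => heatGamma w.1 w.2.1 w.2.2) dom3 := by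
  refine imgsum_continuousOn heatK heatK_continuousOn ?_
  intro α β hα hβ
  obtain ⟨C, hC, h⟩ := img_bound hα hβ
  exact ⟨C, fun x hx y hy t h1 h2 k => (h x hx y hy t (by linarith) h2.le (by nlinarith [sq_nonneg (x-y)]) k).1⟩

lemma gamma1_continuousOn : ContinuousOn (fun w : ℝ × ℝ × ℝ => gamma1 w.1 w.2.1 w.2.2) dom3 := by
  refine imgsum_continuousOn heatK1 heatK1_continuousOn ?_
  intro α β hα hβ
  obtain ⟨C, hC, h⟩ := img_bound hα hβ
  exact ⟨C, fun x hx y hy t h1 h2 k => (h x hx y hy t (by linarith) h2.le (by nlinarith [sq_nonneg (x-y)]) k).2⟩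


lemma exp_neg_le_rpow {x : ℝ} (hx : 0 < x) : Real.exp (-x) ≤ x ^ (-(3/4) : ℝ) := by
  rw [Real.exp_neg, Real.rpow_neg hx.le]
  apply inv_anti₀ (by positivity)
  rcases le_total x 1 with h | h
  · calc x ^ (3/4 : ℝ) ≤ 1 := Real.rpow_le_one hx.le h (by norm_num)
      _ ≤ Real.exp x := Real.one_le_exp hx.le
  · calc x ^ (3/4 : ℝ) ≤ x ^ (1 : ℝ) := Real.rpow_le_rpow_of_exponent_le h (by norm_num)
      _ = x := Real.rpow_one x
      _ ≤ Real.exp x := by linarith [Real.add_one_le_exp x]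

noncomputable def bN (n : ℕ) : ℝ := ((n : ℝ) + 1) ^ (-(3/2) : ℝ)

lemma bN_nonneg (n : ℕ) : 0 ≤ bN n := by unfold bN; positivity

lemma bN_summable : Summable bN := by
  have h := (Real.summable_nat_rpow (p := (-(3/2) : ℝ))).2 (by norm_num)
  have h2 := (summable_nat_add_iff 1).2 h
  refine h2.congr fun n => ?_
  simp [bN]

lemma muN_ge (n : ℕ) : (n : ℝ) ^ 2 ≤ muN n := by
  unfold muN
  have : (1:ℝ) ≤ Real.pi / 2 := by linarith [Real.two_le_pi]
  apply pow_le_pow_left₀ (by positivity)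
  nlinarith [(Nat.cast_nonneg n : (0:ℝ) ≤ n)]

lemma exp_mu_le (n : ℕ) {t : ℝ} (ht : 0 < t) :
    Real.exp (-muN (n+1) * t) ≤ bN n * t ^ (-(3/4) : ℝ) := by
  have h1 := muN_ge (n+1)
  have h2 : (0:ℝ) < ((n+1 : ℕ) : ℝ) ^ 2 * t := by positivity
  calc Real.exp (-muN (n+1) * t) ≤ Real.exp (-(((n+1 : ℕ) : ℝ) ^ 2 * t)) := by
        apply Real.exp_le_exp.2; nlinarith
    _ ≤ (((n+1 : ℕ) : ℝ) ^ 2 * t) ^ (-(3/4) : ℝ) := exp_neg_le_rpow h2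
    _ = bN n * t ^ (-(3/4) : ℝ) := by
        rw [Real.mul_rpow (by positivity) ht.le]
        congr 1
        unfold bN
        rw [← Real.rpow_natCast, ← Real.rpow_mul (by positivity)]
        push_cast
        norm_num

noncomputable def SB : ℝ := ∑' n, bN n

lemma SB_nonneg : 0 ≤ SB := tsum_nonneg bN_nonneg

lemma gamma_le (x y : ℝ) {t : ℝ} (ht : 0 < t) : heatGamma x y t ≤ 1/2 + SB * t ^ (-(3/4) : ℝ) := by
  have h1 := gamma_fourier x y ht
  have h2 : HasSum (fun n => bN n * t ^ (-(3/4) : ℝ)) (SB * t ^ (-(3/4) : ℝ)) :=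
    bN_summable.hasSum.mul_right _
  have := hasSum_le (fun n => ?_) h1 h2
  · linarith
  · have h3 : cN (n+1) x * cN (n+1) y ≤ 1 := by
      have := abs_le.1 (abs_mul (cN (n+1) x) (cN (n+1) y) ▸ mul_le_one₀ (cN_abs_le _ _) (abs_nonneg _) (cN_abs_le _ _))
      exact this.2
    calc Real.exp (-muN (n+1) * t) * cN (n+1) x * cN (n+1) y
        = Real.exp (-muN (n+1) * t) * (cN (n+1) x * cN (n+1) y) := by ring
      _ ≤ Real.exp (-muN (n+1) * t) * 1 := by gcongr
      _ ≤ _ := by rw [mul_one]; exact exp_mu_le n ht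

lemma integral_cos_int (j : ℤ) (hj : j ≠ 0) :
    ∫ x in (-1:ℝ)..1, Real.cos (j * (Real.pi * (x + 1) / 2)) = 0 := by
  have hj' : (j:ℝ) ≠ 0 := by exact_mod_cast hj
  have hpi := Real.pi_pos.ne'
  have hd : ∀ x ∈ uIcc (-1:ℝ) 1, HasDerivAt (fun x => (2 / (j * Real.pi)) * Real.sin (j * (Real.pi * (x + 1) / 2)))
      (Real.cos (j * (Real.pi * (x + 1) / 2))) x := by
    intro x _
    have h1 : HasDerivAt (fun x : ℝ => (j:ℝ) * (Real.pi * (x + 1) / 2)) (j * (Real.pi / 2)) x := by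
      have := ((((hasDerivAt_id x).add_const 1).const_mul Real.pi).div_const 2).const_mul (j:ℝ)
      simpa using this
    have := h1.sin.const_mul (2 / (j * Real.pi))
    convert! this using 1
    field_simp
  rw [intervalIntegral.integral_eq_sub_of_hasDerivAt hd (by apply Continuous.intervalIntegrable; fun_prop)]
  have e1 : (j:ℝ) * (Real.pi * (1 + 1) / 2) = j * Real.pi := by ring
  have e2 : (j:ℝ) * (Real.pi * (-1 + 1) / 2) = 0 := by ring
  rw [e1, e2, Real.sin_int_mul_pi]
  simp

lemma integral_cN_mul (n m : ℕ) :
    ∫ x in (-1:ℝ)..1, cN n x * cN m x = if n = m then (if n = 0 then 2 else 1) else 0 := by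
  have h : ∀ x : ℝ, cN n x * cN m x = (1/2) * (Real.cos (((n:ℤ) - m : ℤ) * (Real.pi * (x + 1) / 2))
      + Real.cos (((n:ℤ) + m : ℤ) * (Real.pi * (x + 1) / 2))) := by
    intro x
    unfold cN
    push_cast
    rw [sub_mul, add_mul, Real.cos_sub, Real.cos_add]
    ring
  simp_rw [h]
  rw [intervalIntegral.integral_const_mul, intervalIntegral.integral_add
    (by apply Continuous.intervalIntegrable; fun_prop) (by apply Continuous.intervalIntegrable; fun_prop)]
  split_ifs with h1 h2
  · subst h1; subst h2; simp; norm_num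
  · subst h1
    rw [integral_cos_int ((n:ℤ) + n) (by omega)]
    simp; norm_num
  · rw [integral_cos_int ((n:ℤ) - m) (by omega), integral_cos_int ((n:ℤ) + m) (by omega)]
    simp

lemma gamma_continuous_left (y : ℝ) {t : ℝ} (ht : 0 < t) : Continuous (fun x => heatGamma x y t) := by
  have : (fun x => heatGamma x y t) = fun x => 1/2 + ∑' n : ℕ, Real.exp (-muN (n+1) * t) * cN (n+1) x * cN (n+1) y := by
    funext x; rw [(gamma_fourier x y ht).tsum_eq]; ring
  rw [this]
  refine continuous_const.add (continuous_tsum (u := fun n => bN n * t ^ (-(3/4) : ℝ)) ?_ (bN_summable.mul_right _) ?_)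
  · intro n; unfold cN; fun_prop
  · intro n x
    rw [Real.norm_eq_abs, abs_mul, abs_mul, abs_of_pos (Real.exp_pos _)]
    calc _ ≤ Real.exp (-muN (n+1) * t) * 1 * 1 := by
          gcongr
          · exact cN_abs_le _ _
          · exact cN_abs_le _ _
      _ ≤ _ := by rw [mul_one, mul_one]; exact exp_mu_le n ht

/-- Fourier series of `∫ Γ(x,y;t) g(x) dx`. -/
lemma gamma_integral_hasSum {g : ℝ → ℝ} (hg : IntervalIntegrable g volume (-1) 1) (y : ℝ) {t : ℝ} (ht : 0 < t) :
    HasSum (fun n : ℕ => Real.exp (-muN (n+1) * t) * cN (n+1) y * ∫ x in (-1:ℝ)..1, cN (n+1) x * g x)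
      ((∫ x in (-1:ℝ)..1, heatGamma x y t * g x) - (1/2) * ∫ x in (-1:ℝ)..1, g x) := by
  have key : HasSum (fun n : ℕ => ∫ x in (-1:ℝ)..1,
      (Real.exp (-muN (n+1) * t) * cN (n+1) x * cN (n+1) y) * g x)
      (∫ x in (-1:ℝ)..1, (heatGamma x y t - 1/2) * g x) := by
    refine intervalIntegral.hasSum_integral_of_dominated_convergence
      (fun n x => (bN n * t ^ (-(3/4) : ℝ)) * |g x|) ?_ ?_ ?_ ?_ ?_
    · intro n
      exact ((by unfold cN; fun_prop : Continuous fun x => Real.exp (-muN (n+1) * t) * cN (n+1) x * cN (n+1) y).aestronglyMeasurable).mul (intervalIntegrable_iff.1 hg).aestronglyMeasurable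
    · intro n
      refine Eventually.of_forall fun x _ => ?_
      rw [norm_mul, Real.norm_eq_abs, Real.norm_eq_abs]
      gcongr
      rw [abs_mul, abs_mul, abs_of_pos (Real.exp_pos _)]
      calc _ ≤ Real.exp (-muN (n+1) * t) * 1 * 1 := by
            gcongr
            · exact cN_abs_le _ _
            · exact cN_abs_le _ _
        _ ≤ _ := by rw [mul_one, mul_one]; exact exp_mu_le n ht
    · exact Eventually.of_forall fun x _ => (bN_summable.mul_right _).mul_right _
    · simp_rw [tsum_mul_right]
      exact hg.abs.const_mul _
    · exact Eventually.of_forall fun x _ => (gamma_fourier x y ht).mul_right _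
  have hG := gamma_continuous_left y ht
  convert! key using 1
  · funext n
    rw [← intervalIntegral.integral_const_mul]
    congr 1; funext x; ring
  · rw [← intervalIntegral.integral_const_mul, ← intervalIntegral.integral_sub]
    · congr 1; funext x; ring
    · exact hg.continuousOn_mul hG.continuousOn
    · exact hg.const_mul _

lemma gamma_integral_cN (m : ℕ) (y : ℝ) {t : ℝ} (ht : 0 < t) :
    ∫ x in (-1:ℝ)..1, heatGamma x y t * cN m x = Real.exp (-muN m * t) * cN m y := by
  have h := gamma_integral_hasSum ((cN_continuous m).intervalIntegrable (-1) 1) y ht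
  simp_rw [integral_cN_mul] at h
  have hm : ∫ x in (-1:ℝ)..1, cN m x = if m = 0 then 2 else 0 := by
    have := integral_cN_mul 0 m
    simp only [cN_zero, one_mul] at this
    rw [this]
    by_cases hm : m = 0
    · simp [hm]
    · simp [hm, Ne.symm hm]
  rcases Nat.eq_zero_or_pos m with rfl | hpos
  · have h0 : HasSum (fun n : ℕ => Real.exp (-muN (n+1) * t) * cN (n+1) y * (if n + 1 = 0 then (if n + 1 = 0 then (2:ℝ) else 1) else 0)) 0 := by
      convert! hasSum_zero using 2 with n
      simp
    have := h.unique h0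
    rw [hm] at this
    simp only [if_true] at this
    have e : Real.exp (-muN 0 * t) * cN 0 y = 1 := by simp [muN, cN]
    rw [e]; linarith
  · obtain ⟨k, rfl⟩ : ∃ k, m = k + 1 := ⟨m - 1, by omega⟩
    have h0 : HasSum (fun n : ℕ => Real.exp (-muN (n+1) * t) * cN (n+1) y * (if n + 1 = k + 1 then (if n + 1 = 0 then (2:ℝ) else 1) else 0))
        (Real.exp (-muN (k+1) * t) * cN (k+1) y) := by
      convert! hasSum_ite_eq k (Real.exp (-muN (k+1) * t) * cN (k+1) y) using 2 with n
      by_cases hn : n = k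
      · subst hn; simp
      · simp [hn]
    have := h.unique h0
    rw [hm] at this
    simp at this
    rw [neg_mul]; linarith

lemma gamma_integral_one (y : ℝ) {t : ℝ} (ht : 0 < t) : ∫ x in (-1:ℝ)..1, heatGamma x y t = 1 := by
  have := gamma_integral_cN 0 y ht
  simpa [cN_zero, muN] using this

lemma U_bound (n : ℕ) {x : ℝ} (hx : |x| ≤ 1) : |(Polynomial.Chebyshev.U ℝ n).eval x| ≤ n + 1 := by
  induction n with
  | zero => simp
  | succ k ih =>
    have h := Polynomial.Chebyshev.U_eq_X_mul_U_add_T ℝ (k:ℤ)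
    push_cast
    rw [h, Polynomial.eval_add, Polynomial.eval_mul, Polynomial.eval_X]
    have hT := Polynomial.Chebyshev.abs_eval_T_real_le_one ((k:ℤ) + 1) hx
    calc _ ≤ |x * (Polynomial.Chebyshev.U ℝ k).eval x| + |(Polynomial.Chebyshev.T ℝ ((k:ℤ)+1)).eval x| := abs_add_le _ _
      _ ≤ 1 * (k + 1) + 1 := by rw [abs_mul]; gcongr
      _ = _ := by ring

lemma cN_diff (n : ℕ) (p b : ℝ) :
    cN (n+1) (p - b) - cN (n+1) (p + b) = (kap (p - b) - kap (p + b)) *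
      ((Polynomial.Chebyshev.U ℝ n).eval (kap p) * (Polynomial.Chebyshev.U ℝ n).eval (Real.cos (Real.pi * b / 2))) := by
  have h1 := Polynomial.Chebyshev.U_real_cos (Real.pi * (p + 1) / 2) n
  have h2 := Polynomial.Chebyshev.U_real_cos (Real.pi * b / 2) n
  unfold cN kap
  have e1 : ∀ m : ℝ, m * (Real.pi * (p - b + 1) / 2) = m * (Real.pi * (p + 1) / 2) - m * (Real.pi * b / 2) := by intro m; ring
  have e2 : ∀ m : ℝ, m * (Real.pi * (p + b + 1) / 2) = m * (Real.pi * (p + 1) / 2) + m * (Real.pi * b / 2) := by intro m; ring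
  have e3 := e1 1
  have e4 := e2 1
  rw [one_mul, one_mul, one_mul] at e3 e4
  rw [e1, e2, e3, e4, Real.cos_sub, Real.cos_sub, Real.cos_add, Real.cos_add]
  push_cast at h1 h2 ⊢
  linear_combination (-2 * Real.sin (Real.pi * b / 2) * (Polynomial.Chebyshev.U ℝ n).eval (Real.cos (Real.pi * b / 2))) * h1
    + (-2 * Real.sin ((n+1) * (Real.pi * (p + 1) / 2))) * h2


lemma kap_strictAnti : StrictAntiOn kap (Icc (-1) 1) := by
  intro x hx y hy hxy
  unfold kap
  have hpi := Real.pi_pos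
  apply Real.strictAntiOn_cos
  · constructor <;> nlinarith [hx.1, hx.2]
  · constructor <;> nlinarith [hy.1, hy.2]
  · nlinarith

lemma kap_mem (x : ℝ) : kap x ∈ Icc (-1:ℝ) 1 := ⟨Real.neg_one_le_cos _, Real.cos_le_one _⟩
lemma kap_abs (x : ℝ) : |kap x| ≤ 1 := Real.abs_cos_le_one _
lemma kap_one : kap 1 = -1 := by
  unfold kap; rw [show Real.pi * (1+1)/2 = Real.pi by ring, Real.cos_pi]
lemma kap_neg_one : kap (-1) = 1 := by
  unfold kap; rw [show Real.pi * (-1+1)/2 = 0 by ring, Real.cos_zero]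

/-- `ā` as a function of the position. -/
noncomputable def ab (a P : ℝ) : ℝ := min a (min (1 - P) (1 + P))
noncomputable def zl (a P : ℝ) : ℝ := P - ab a P
noncomputable def zr (a P : ℝ) : ℝ := P + ab a P
noncomputable def wP (a P : ℝ) : ℝ := kap (zl a P) - kap (zr a P)

lemma ab_continuous (a : ℝ) : Continuous (ab a) := by unfold ab; fun_prop
lemma zl_continuous (a : ℝ) : Continuous (zl a) := continuous_id.sub (ab_continuous a)
lemma zr_continuous (a : ℝ) : Continuous (zr a) := continuous_id.add (ab_continuous a)
lemma wP_continuous (a : ℝ) : Continuous (wP a) :=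
  (kap_continuous.comp (zl_continuous a)).sub (kap_continuous.comp (zr_continuous a))

lemma ab_nonneg {a P : ℝ} (ha : 0 < a) (hP : P ∈ Icc (-1:ℝ) 1) : 0 ≤ ab a P := by
  unfold ab
  exact le_min ha.le (le_min (by linarith [hP.2]) (by linarith [hP.1]))
lemma ab_pos {a P : ℝ} (ha : 0 < a) (hP : P ∈ Ioo (-1:ℝ) 1) : 0 < ab a P := by
  unfold ab
  exact lt_min ha (lt_min (by linarith [hP.2]) (by linarith [hP.1]))
lemma ab_le_a (a P : ℝ) : ab a P ≤ a := min_le_left _ _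
lemma ab_le_l (a P : ℝ) : ab a P ≤ 1 + P := (min_le_right _ _).trans (min_le_right _ _)
lemma ab_le_r (a P : ℝ) : ab a P ≤ 1 - P := (min_le_right _ _).trans (min_le_left _ _)

lemma zl_mem {a P : ℝ} (ha : 0 < a) (hP : P ∈ Icc (-1:ℝ) 1) : zl a P ∈ Icc (-1:ℝ) 1 := by
  have := ab_nonneg ha hP; have := ab_le_l a P
  unfold zl; constructor <;> linarith [hP.1, hP.2]
lemma zr_mem {a P : ℝ} (ha : 0 < a) (hP : P ∈ Icc (-1:ℝ) 1) : zr a P ∈ Icc (-1:ℝ) 1 := by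
  have := ab_nonneg ha hP; have := ab_le_r a P
  unfold zr; constructor <;> linarith [hP.1, hP.2]

lemma zl_lt {a P : ℝ} (ha : 0 < a) (hP : P ∈ Ioo (-1:ℝ) 1) : zl a P < P := by
  have := ab_pos ha hP; unfold zl; linarith
lemma lt_zr {a P : ℝ} (ha : 0 < a) (hP : P ∈ Ioo (-1:ℝ) 1) : P < zr a P := by
  have := ab_pos ha hP; unfold zr; linarith

lemma wP_pos {a P : ℝ} (ha : 0 < a) (hP : P ∈ Ioo (-1:ℝ) 1) : 0 < wP a P := by
  have h1 := zl_lt ha hP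
  have h2 := lt_zr ha hP
  have := kap_strictAnti (zl_mem ha (Ioo_subset_Icc_self hP)) (zr_mem ha (Ioo_subset_Icc_self hP)) (h1.trans h2)
  unfold wP; linarith

noncomputable def AN (a P : ℝ) (n : ℕ) : ℝ :=
  (Polynomial.Chebyshev.U ℝ n).eval (kap P) * (Polynomial.Chebyshev.U ℝ n).eval (Real.cos (Real.pi * ab a P / 2))

lemma AN_zero (a P : ℝ) : AN a P 0 = 1 := by simp [AN]

lemma AN_abs (a P : ℝ) (n : ℕ) : |AN a P n| ≤ ((n:ℝ) + 1) ^ 2 := by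
  unfold AN
  rw [abs_mul, sq]
  exact mul_le_mul (U_bound n (kap_abs P)) (U_bound n (Real.abs_cos_le_one _)) (abs_nonneg _) (by positivity)

lemma AN_continuous (a : ℝ) (n : ℕ) : Continuous (fun P => AN a P n) := by
  unfold AN
  have h1 := kap_continuous
  have h2 := ab_continuous a
  apply Continuous.mul
  · exact (Polynomial.continuous _).comp h1
  · exact (Polynomial.continuous _).comp (by fun_prop)

lemma cN_diff_eq (a P : ℝ) (n : ℕ) : cN (n+1) (zl a P) - cN (n+1) (zr a P) = wP a P * AN a P n := by
  unfold zl zr wP AN; exact cN_diff n P (ab a P)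

lemma cN_diff_abs {a P : ℝ} (ha : 0 < a) (hP : P ∈ Ioo (-1:ℝ) 1) (n : ℕ) :
    |cN n (zl a P) - cN n (zr a P)| ≤ wP a P * (n:ℝ) ^ 2 := by
  rcases n with _ | n
  · simp [cN_zero]
  · rw [cN_diff_eq, abs_mul, abs_of_pos (wP_pos ha hP)]
    have := AN_abs a P n
    push_cast
    gcongr
    exact (wP_pos ha hP).le

/-- superexponential summability -/
lemma exp_mu_summable {t : ℝ} (ht : 0 < t) (M : ℝ) :
    Summable (fun n : ℕ => Real.exp (-muN (n+1) * t) * ((n:ℝ) + 1) ^ 2 * Real.exp (M * (n + 1))) := by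
  have hs : Summable (fun n : ℕ => Real.exp ((M + 4) ^ 2 / (4 * t)) * Real.exp (-(n:ℝ))) :=
    Real.summable_exp_neg_nat.mul_left _
  refine Summable.of_nonneg_of_le (fun n => by positivity) (fun n => ?_) hs
  have h1 := muN_ge (n+1)
  push_cast at h1
  set m : ℝ := (n:ℝ) + 1 with hm
  have hm0 : 0 < m := by positivity
  have h2 : m ^ 2 ≤ Real.exp (2 * m) := by
    have : m ≤ Real.exp m := by linarith [Real.add_one_le_exp m]
    calc m ^ 2 ≤ (Real.exp m) ^ 2 := by gcongr
      _ = Real.exp (2 * m) := by rw [← Real.exp_nat_mul]; norm_num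
  calc Real.exp (-muN (n+1) * t) * m ^ 2 * Real.exp (M * m)
      ≤ Real.exp (-(m^2) * t) * Real.exp (2 * m) * Real.exp (M * m) := by
        gcongr
    _ = Real.exp (-(m^2) * t + 2 * m + M * m) := by rw [Real.exp_add, Real.exp_add]
    _ ≤ Real.exp ((M + 4) ^ 2 / (4 * t) + -(n:ℝ)) := by
        apply Real.exp_le_exp.2
        have h3 : (M+4) * m - m^2 * t ≤ (M + 4) ^ 2 / (4 * t) := by
          rw [le_div_iff₀ (by positivity)]
          nlinarith [sq_nonneg (2 * t * m - (M+4))]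
        have : (n:ℝ) ≤ m := by rw [hm]; linarith
        nlinarith
    _ = _ := by rw [Real.exp_add]

noncomputable def RR (a x P t : ℝ) : ℝ := ∑' n : ℕ, Real.exp (-muN (n+1) * t) * cN (n+1) x * AN a P n

lemma RR_term (a x P : ℝ) {t t0 : ℝ} (ht0 : t0 ≤ t) (n : ℕ) :
    ‖Real.exp (-muN (n+1) * t) * cN (n+1) x * AN a P n‖ ≤ Real.exp (-muN (n+1) * t0) * ((n:ℝ) + 1) ^ 2 * Real.exp (0 * (n + 1)) := by
  rw [Real.norm_eq_abs, abs_mul, abs_mul, abs_of_pos (Real.exp_pos _), zero_mul, Real.exp_zero, mul_one]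
  have h1 : Real.exp (-muN (n+1) * t) ≤ Real.exp (-muN (n+1) * t0) := by
    apply Real.exp_le_exp.2; nlinarith [muN_nonneg (n+1)]
  calc _ ≤ Real.exp (-muN (n+1) * t0) * 1 * ((n:ℝ) + 1) ^ 2 := by
        gcongr
        · exact cN_abs_le _ _
        · exact AN_abs _ _ _
    _ = _ := by ring

lemma RR_summable (a x P : ℝ) {t : ℝ} (ht : 0 < t) :
    Summable (fun n : ℕ => Real.exp (-muN (n+1) * t) * cN (n+1) x * AN a P n) :=
  Summable.of_norm_bounded (exp_mu_summable ht 0) (RR_term a x P le_rfl)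

lemma RR_bound (a : ℝ) {t0 : ℝ} (ht0 : 0 < t0) : ∃ C, 0 ≤ C ∧ ∀ x P t, t0 ≤ t → |RR a x P t| ≤ C := by
  refine ⟨∑' n : ℕ, Real.exp (-muN (n+1) * t0) * ((n:ℝ) + 1) ^ 2 * Real.exp (0 * (n + 1)), tsum_nonneg fun n => by positivity, ?_⟩
  intro x P t ht
  exact tsum_of_norm_bounded (exp_mu_summable ht0 0).hasSum (RR_term a x P ht)

lemma D_eq (a x P : ℝ) {t : ℝ} (ht : 0 < t) :
    heatGamma x (zl a P) t - heatGamma x (zr a P) t = wP a P * RR a x P t := by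
  have h := (gamma_fourier x (zl a P) ht).sub (gamma_fourier x (zr a P) ht)
  have h2 := (RR_summable a x P ht).hasSum.mul_left (wP a P)
  have := h.unique (by
    convert! h2 using 2 with n
    have := cN_diff_eq a P n
    linear_combination (Real.exp (-muN (n+1) * t) * cN (n+1) x) * this)
  unfold RR
  linarith

lemma RR_continuousOn (a x : ℝ) {t0 : ℝ} (ht0 : 0 < t0) :
    ContinuousOn (fun q : ℝ × ℝ => RR a x q.1 q.2) {q | t0 ≤ q.2} := by
  unfold RR
  refine continuousOn_tsum (fun n => ?_) (exp_mu_summable ht0 0) (fun n q hq => RR_term a x q.1 hq n)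
  have := AN_continuous a n
  apply Continuous.continuousOn
  apply Continuous.mul
  · fun_prop
  · exact this.comp continuous_fst

lemma ccos_norm_le (z : ℂ) : ‖Complex.cos z‖ ≤ Real.exp |z.im| := by
  unfold Complex.cos
  rw [norm_div]
  have h1 : ‖Complex.exp (z * Complex.I)‖ ≤ Real.exp |z.im| := by
    rw [Complex.norm_exp]; apply Real.exp_le_exp.2; simp; exact neg_le_abs _
  have h2 : ‖Complex.exp (-z * Complex.I)‖ ≤ Real.exp |z.im| := by
    rw [Complex.norm_exp]; apply Real.exp_le_exp.2; simp; exact le_abs_self _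
  have := norm_add_le (Complex.exp (z * Complex.I)) (Complex.exp (-z * Complex.I))
  simp only [Complex.norm_ofNat]
  linarith

/-- `R` does not vanish identically on a nonempty open set. -/
lemma RR_ne_zero (a P : ℝ) {t : ℝ} (ht : 0 < t) {V : Set ℝ} (hV : IsOpen V) (hne : V.Nonempty) :
    ∃ x ∈ V, RR a x P t ≠ 0 := by
  by_contra! hcon
  obtain ⟨x0, hx0⟩ := hne
  let F : ℂ → ℂ := fun z => ∑' n : ℕ, ((Real.exp (-muN (n+1) * t) * AN a P n : ℝ) : ℂ) * Complex.cos (((n:ℂ)+1) * (Real.pi * (z + 1) / 2))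
  have hFd : Differentiable ℂ F := by
    intro z0
    set M : ℝ := |z0.im| + 1 with hM
    have hU : IsOpen {z : ℂ | |z.im| < M} := isOpen_lt (by fun_prop) (by fun_prop)
    have hd : DifferentiableOn ℂ F {z : ℂ | |z.im| < M} := by
      refine Complex.differentiableOn_tsum_of_summable_norm (exp_mu_summable ht (2 * M)) (fun n => ?_) hU (fun n z hz => ?_)
      · apply Differentiable.differentiableOn; fun_prop
      · rw [norm_mul, Complex.norm_real, Real.norm_eq_abs, abs_mul, abs_of_pos (Real.exp_pos _)]
        gcongr
        · exact AN_abs _ _ _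
        · refine (ccos_norm_le _).trans (Real.exp_le_exp.2 ?_)
          have e : (((n:ℂ)+1) * (Real.pi * (z + 1) / 2)).im = ((n:ℝ)+1) * (Real.pi / 2) * z.im := by
            have : (((n:ℂ)+1) * (Real.pi * (z + 1) / 2)) = ((((n:ℝ)+1) * (Real.pi / 2) : ℝ) : ℂ) * (z + 1) := by push_cast; ring
            rw [this, Complex.im_ofReal_mul]; simp
          rw [e, abs_mul, abs_of_pos (by positivity)]
          have : Real.pi / 2 ≤ 2 := by linarith [Real.pi_le_four]
          have hz' : |z.im| ≤ M := le_of_lt hz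
          calc ((n:ℝ)+1) * (Real.pi / 2) * |z.im| ≤ ((n:ℝ)+1) * 2 * M := by gcongr
            _ = _ := by ring
    exact hd.differentiableAt (hU.mem_nhds (by simp [hM]))
  have hFR : ∀ x : ℝ, F x = ((RR a x P t : ℝ) : ℂ) := by
    intro x
    unfold RR
    rw [Complex.ofReal_tsum]
    refine tsum_congr fun n => ?_
    unfold cN
    push_cast
    ring
  have hF0 : ∀ z, F z = 0 := by
    have hA : AnalyticOnNhd ℂ F univ := hFd.differentiableOn.analyticOnNhd isOpen_univ
    have := hA.eqOn_zero_of_preconnected_of_frequently_eq_zero isPreconnected_univ (mem_univ (x0 : ℂ)) ?_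
    · intro z; exact this (mem_univ z)
    · have h1 : ∃ᶠ x in 𝓝[≠] x0, RR a x P t = 0 := by
        apply Eventually.frequently
        exact nhdsWithin_le_nhds ((hV.mem_nhds hx0 |> fun h => Filter.mem_of_superset h hcon))
      have h2 : Tendsto (fun x : ℝ => (x : ℂ)) (𝓝[≠] x0) (𝓝[≠] (x0 : ℂ)) := by
        apply tendsto_nhdsWithin_of_tendsto_nhds_of_eventually_within
        · exact (Complex.continuous_ofReal.tendsto x0).mono_left nhdsWithin_le_nhds
        · filter_upwards [self_mem_nhdsWithin] with x hx
          simpa using hx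
      refine h2.frequently (h1.mono fun x hx => ?_)
      rw [hFR, hx]; simp
  have hR0 : ∀ x, RR a x P t = 0 := by
    intro x
    have := hFR x
    rw [hF0] at this
    exact_mod_cast this.symm
  have hsum : HasSum (fun n : ℕ => ∫ x in (-1:ℝ)..1, (Real.exp (-muN (n+1) * t) * cN (n+1) x * AN a P n) * cN 1 x)
      (∫ x in (-1:ℝ)..1, RR a x P t * cN 1 x) := by
    refine intervalIntegral.hasSum_integral_of_dominated_convergence
      (fun n x => Real.exp (-muN (n+1) * t) * ((n:ℝ) + 1) ^ 2 * Real.exp (0 * (n + 1))) ?_ ?_ ?_ ?_ ?_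
    · intro n
      have := cN_continuous
      exact ((((continuous_const.mul (this _)).mul continuous_const).mul (this _)).aestronglyMeasurable)
    · intro n
      refine Eventually.of_forall fun x _ => ?_
      rw [norm_mul]
      have h1 := RR_term a x P (le_refl t) n
      have h2 : ‖cN 1 x‖ ≤ 1 := cN_abs_le _ _
      have h3 := mul_le_mul h1 h2 (norm_nonneg _) (by positivity)
      rwa [mul_one] at h3
    · exact Eventually.of_forall fun x _ => exp_mu_summable ht 0
    · exact intervalIntegrable_const
    · exact Eventually.of_forall fun x _ => (RR_summable a x P ht).hasSum.mul_right _
  have e : (fun n : ℕ => ∫ x in (-1:ℝ)..1, (Real.exp (-muN (n+1) * t) * cN (n+1) x * AN a P n) * cN 1 x)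
      = fun n => if n = 0 then Real.exp (-muN 1 * t) else 0 := by
    funext n
    have : ∀ x, (Real.exp (-muN (n+1) * t) * cN (n+1) x * AN a P n) * cN 1 x
      = (Real.exp (-muN (n+1) * t) * AN a P n) * (cN (n+1) x * cN 1 x) := by intro x; ring
    simp_rw [this]
    rw [intervalIntegral.integral_const_mul, integral_cN_mul]
    by_cases hn : n = 0
    · subst hn; simp [AN_zero]
    · simp [hn]
  rw [e] at hsum
  have h1 := hsum.unique (hasSum_ite_eq 0 _)
  simp only [hR0, zero_mul, intervalIntegral.integral_zero] at h1
  exact absurd h1.symm (Real.exp_pos _).ne'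


noncomputable def Dk (a : ℝ) (p : ℝ → ℝ) (x t s : ℝ) : ℝ :=
  heatGamma x (zl a (p s)) (t - s) - heatGamma x (zr a (p s)) (t - s)

noncomputable def GG (fI : ℝ → ℝ) (x t : ℝ) : ℝ := ∫ x' in (-1 : ℝ)..1, heatGamma x x' t * fI x'

section sol
variable {T a : ℝ} {fI : ℝ → ℝ} {f : ℝ → ℝ → ℝ} {p : ℝ → ℝ}

lemma sol_duhamel (hs : IsSolutionP a fI (Ioo 0 T) f p) {t : ℝ} (ht : t ∈ Ioo 0 T) {x : ℝ} (hx : x ∈ Icc (-1:ℝ) 1) :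
    f x t = GG fI x t + ∫ s in (0:ℝ)..t, Dk a p x t s * flux f p s := hs.duhamel t ht x hx

lemma sol_flux_nonneg (hs : IsSolutionP a fI (Ioo 0 T) f p) {t : ℝ} (ht : t ∈ Ioo 0 T) : 0 ≤ flux f p t := by
  unfold flux
  rw [neg_nonneg]
  by_contra! hpos
  have hd := (hs.diff_at t ht).hasDerivAt
  have h0 := hs.zero_at t ht
  have hp := hs.p_mem t ht
  have h1 := hd.tendsto_slope
  have h2 : ∀ᶠ x in 𝓝[≠] (p t), 0 < slope (fun x => f x t) (p t) x := h1.eventually (lt_mem_nhds hpos)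
  have h3 : ∀ᶠ x in 𝓝[>] (p t), 0 < slope (fun x => f x t) (p t) x :=
    h2.filter_mono (nhdsWithin_mono _ (fun x hx => ne_of_gt hx))
  have h4 : ∀ᶠ x in 𝓝[>] (p t), x ∈ Ioo (p t) 1 := Ioo_mem_nhdsGT hp.2
  obtain ⟨x, hx1, hx2⟩ := (h3.and h4).exists
  have := hs.neg_right t ht x ⟨hx2.1, hx2.2.le⟩
  rw [slope_def_field, h0, sub_zero] at hx1
  have : f x t / (x - p t) < 0 := div_neg_of_neg_of_pos this (by linarith [hx2.1])
  linarith

lemma sol_p_mem (hs : IsSolutionP a fI (Ioo 0 T) f p) {t : ℝ} (ht : t ∈ Ioo 0 T) : p t ∈ Icc (-1:ℝ) 1 :=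
  Ioo_subset_Icc_self (hs.p_mem t ht)

lemma sol_flux_aesm (hs : IsSolutionP a fI (Ioo 0 T) f p) :
    AEStronglyMeasurable (flux f p) (volume.restrict (Ioo 0 T)) :=
  hs.flux_loc_int.aestronglyMeasurable

lemma sol_flux_int (hs : IsSolutionP a fI (Ioo 0 T) f p) {s0 t : ℝ} (h0 : 0 < s0) (ht : t < T) :
    IntegrableOn (flux f p) (Icc s0 t) :=
  hs.flux_loc_int.integrableOn_compact_subset (fun s hs => ⟨by linarith [hs.1], by linarith [hs.2]⟩) isCompact_Icc

lemma Dk_continuousOn (ha : 0 < a) (hs : IsSolutionP a fI (Ioo 0 T) f p) {t : ℝ} (ht : t < T) :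
    ContinuousOn (fun q : ℝ × ℝ => Dk a p q.2 t q.1) (Ioo 0 t ×ˢ Icc (-1:ℝ) 1) := by
  unfold Dk
  have hp : ContinuousOn (fun q : ℝ × ℝ => p q.1) (Ioo 0 t ×ˢ Icc (-1:ℝ) 1) :=
    hs.p_cont.comp continuousOn_fst (fun q hq => ⟨hq.1.1, by linarith [hq.1.2]⟩)
  have hpm : ∀ q ∈ (Ioo 0 t ×ˢ Icc (-1:ℝ) 1), p q.1 ∈ Icc (-1:ℝ) 1 := fun q hq =>
    sol_p_mem hs ⟨hq.1.1, by linarith [hq.1.2]⟩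
  apply ContinuousOn.sub
  · refine gamma_continuousOn.comp (f := fun q : ℝ × ℝ => (q.2, zl a (p q.1), t - q.1)) ?_ ?_
    · exact continuousOn_snd.prodMk (((zl_continuous a).comp_continuousOn hp).prodMk (by fun_prop))
    · intro q hq
      exact ⟨hq.2, zl_mem ha (hpm q hq), by simpa using hq.1.2⟩
  · refine gamma_continuousOn.comp (f := fun q : ℝ × ℝ => (q.2, zr a (p q.1), t - q.1)) ?_ ?_
    · exact continuousOn_snd.prodMk (((zr_continuous a).comp_continuousOn hp).prodMk (by fun_prop))
    · intro q hq
      exact ⟨hq.2, zr_mem ha (hpm q hq), by simpa using hq.1.2⟩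

lemma sol_wflux_aesm (hs : IsSolutionP a fI (Ioo 0 T) f p) :
    AEStronglyMeasurable (fun s => wP a (p s) * flux f p s) (volume.restrict (Ioo 0 T)) := by
  refine AEStronglyMeasurable.mul ?_ (sol_flux_aesm hs)
  exact ((wP_continuous a).comp_continuousOn hs.p_cont).aestronglyMeasurable measurableSet_Ioo

/-- integral of |D| in x bounded by C w -/
lemma Dk_L1 (ha : 0 < a) (hs : IsSolutionP a fI (Ioo 0 T) f p) {t : ℝ} (ht : t ∈ Ioo 0 T) :
    ∃ C, 0 ≤ C ∧ ∀ s ∈ Ioo 0 t, ∫ x in Ioc (-1:ℝ) 1, |Dk a p x t s| ≤ C * wP a (p s) := by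
  obtain ⟨C1, hC1, hb⟩ := RR_bound a (half_pos ht.1)
  have hwc : ContinuousOn (fun s => wP a (p s)) (Icc (t/2) t) :=
    (wP_continuous a).comp_continuousOn (hs.p_cont.mono fun s hs => ⟨by linarith [hs.1, ht.1], by linarith [hs.2, ht.2]⟩)
  obtain ⟨s0, hs0, hmin⟩ := isCompact_Icc.exists_isMinOn ⟨t, by constructor <;> linarith [ht.1]⟩ hwc
  set c := wP a (p s0) with hc
  have hcpos : 0 < c := wP_pos ha (hs.p_mem s0 ⟨by linarith [hs0.1, ht.1], by linarith [hs0.2, ht.2]⟩)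
  refine ⟨2 * C1 + 2 / c, by positivity, fun s hss => ?_⟩
  have hsT : s ∈ Ioo 0 T := ⟨hss.1, by linarith [hss.2, ht.2]⟩
  have hw := wP_pos ha (hs.p_mem s hsT)
  have hcont : ∀ y, Continuous (fun x => heatGamma x y (t - s)) := fun y => gamma_continuous_left y (by linarith [hss.2])
  have hDc : Continuous (fun x => Dk a p x t s) := (hcont _).sub (hcont _)
  have hfin : volume (Ioc (-1:ℝ) 1) ≠ ⊤ := by simp
  have hint : ∀ {g : ℝ → ℝ}, Continuous g → IntegrableOn g (Ioc (-1:ℝ) 1) := fun hg =>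
    (hg.continuousOn.integrableOn_compact isCompact_Icc).mono_set Ioc_subset_Icc_self
  rcases le_total s (t/2) with h | h
  · calc ∫ x in Ioc (-1:ℝ) 1, |Dk a p x t s| ≤ ∫ x in Ioc (-1:ℝ) 1, C1 * wP a (p s) := by
          apply integral_mono (hint hDc.abs) (hint continuous_const)
          intro x
          simp only
          unfold Dk
          rw [D_eq a x (p s) (by linarith [hss.2]), abs_mul, abs_of_pos hw, mul_comm]
          gcongr
          exact hb x (p s) (t - s) (by linarith)
      _ = 2 * C1 * wP a (p s) := by simp; norm_num; ring
      _ ≤ _ := by gcongr; linarith [(by positivity : 0 ≤ 2 / c)]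
  · have h1 : c ≤ wP a (p s) := hmin ⟨h, hss.2.le⟩
    calc ∫ x in Ioc (-1:ℝ) 1, |Dk a p x t s| ≤ ∫ x in Ioc (-1:ℝ) 1, (heatGamma x (zl a (p s)) (t - s) + heatGamma x (zr a (p s)) (t - s)) := by
          apply integral_mono (hint hDc.abs) (hint ((hcont _).add (hcont _)))
          intro x
          simp only [Pi.add_apply]
          unfold Dk
          rw [abs_le]
          constructor <;> linarith [heatGamma_nonneg x (zl a (p s)) (t - s), heatGamma_nonneg x (zr a (p s)) (t - s)]
      _ = 2 := by
          rw [← intervalIntegral.integral_of_le (by norm_num), intervalIntegral.integral_add ((hcont _).intervalIntegrable _ _) ((hcont _).intervalIntegrable _ _),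
            gamma_integral_one _ (by linarith [hss.2]), gamma_integral_one _ (by linarith [hss.2])]
          norm_num
      _ ≤ 2 / c * wP a (p s) := by
          rw [div_mul_eq_mul_div, le_div_iff₀ hcpos]; linarith
      _ ≤ _ := by gcongr; linarith

lemma sol_fubini (ha : 0 < a) (hs : IsSolutionP a fI (Ioo 0 T) f p) {t : ℝ} (ht : t ∈ Ioo 0 T)
    (hw : IntegrableOn (fun s => wP a (p s) * flux f p s) (Ioo 0 t)) :
    Integrable (fun q : ℝ × ℝ => Dk a p q.2 t q.1 * flux f p q.1)
      ((volume.restrict (Ioo 0 t)).prod (volume.restrict (Ioc (-1:ℝ) 1))) := by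
  have hsub : Ioo 0 t ⊆ Ioo 0 T := Ioo_subset_Ioo_right ht.2.le
  have hfm : AEStronglyMeasurable (flux f p) (volume.restrict (Ioo 0 t)) := (sol_flux_aesm hs).mono_set hsub
  have hm : AEStronglyMeasurable (fun q : ℝ × ℝ => Dk a p q.2 t q.1 * flux f p q.1)
      ((volume.restrict (Ioo 0 t)).prod (volume.restrict (Ioc (-1:ℝ) 1))) := by
    refine AEStronglyMeasurable.mul ?_ hfm.comp_fst
    rw [Measure.prod_restrict]
    exact ((Dk_continuousOn ha hs ht.2).mono (prod_mono le_rfl Ioc_subset_Icc_self)).aestronglyMeasurable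
      (measurableSet_Ioo.prod measurableSet_Ioc)
  obtain ⟨C, hC, hb⟩ := Dk_L1 ha hs ht
  rw [integrable_prod_iff hm]
  constructor
  · filter_upwards [ae_restrict_mem measurableSet_Ioo] with s hss
    have hcont : ∀ y, Continuous (fun x => heatGamma x y (t - s)) := fun y => gamma_continuous_left y (by linarith [hss.2])
    have hDc : Continuous (fun x => Dk a p x t s) := (hcont _).sub (hcont _)
    exact ((hDc.continuousOn.integrableOn_compact isCompact_Icc).mono_set Ioc_subset_Icc_self).mul_const _
  · refine Integrable.mono' (hw.const_mul C) hm.norm.integral_prod_right' ?_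
    filter_upwards [ae_restrict_mem measurableSet_Ioo] with s hss
    have hn := sol_flux_nonneg hs (hsub hss)
    rw [Real.norm_eq_abs, abs_of_nonneg (integral_nonneg fun _ => norm_nonneg _)]
    simp_rw [norm_mul, Real.norm_eq_abs]
    rw [integral_mul_const, abs_of_nonneg hn, ← mul_assoc]
    gcongr
    exact hb s hss

lemma gamma_cont2 {t : ℝ} (ht : 0 < t) : ContinuousOn (fun q : ℝ × ℝ => heatGamma q.1 q.2 t) (Icc (-1:ℝ) 1 ×ˢ Icc (-1:ℝ) 1) := by
  refine gamma_continuousOn.comp (f := fun q : ℝ × ℝ => (q.1, q.2, t)) (by fun_prop) ?_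
  intro q hq
  exact ⟨hq.1, hq.2, ht⟩

lemma GG_prod_int (hfI : ContinuousOn fI (Icc (-1) 1)) {t : ℝ} (ht : 0 < t) :
    Integrable (fun q : ℝ × ℝ => heatGamma q.1 q.2 t * fI q.2) ((volume.restrict (Ioc (-1:ℝ) 1)).prod (volume.restrict (Ioc (-1:ℝ) 1))) := by
  rw [Measure.prod_restrict]
  have h1 : ContinuousOn (fun q : ℝ × ℝ => heatGamma q.1 q.2 t * fI q.2) (Icc (-1:ℝ) 1 ×ˢ Icc (-1:ℝ) 1) :=
    (gamma_cont2 ht).mul (hfI.comp continuousOn_snd fun q hq => hq.2)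
  exact (h1.integrableOn_compact (isCompact_Icc.prod isCompact_Icc)).mono_set (prod_mono Ioc_subset_Icc_self Ioc_subset_Icc_self)

lemma GG_integral (hfI : ContinuousOn fI (Icc (-1) 1)) {t : ℝ} (ht : 0 < t) (n : ℕ) :
    ∫ x in Ioc (-1:ℝ) 1, GG fI x t * cN n x = Real.exp (-muN n * t) * ∫ x in Ioc (-1:ℝ) 1, fI x * cN n x := by
  have h1 := GG_prod_int hfI ht
  have h2 : Integrable (fun q : ℝ × ℝ => (heatGamma q.1 q.2 t * fI q.2) * cN n q.1) ((volume.restrict (Ioc (-1:ℝ) 1)).prod (volume.restrict (Ioc (-1:ℝ) 1))) :=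
    h1.mul_bdd (c := 1) (((cN_continuous n).comp continuous_fst).aestronglyMeasurable) (Eventually.of_forall fun q => cN_abs_le _ _)
  unfold GG
  simp_rw [intervalIntegral.integral_of_le (show (-1:ℝ) ≤ 1 by norm_num), ← integral_mul_const]
  rw [integral_integral_swap h2, ← integral_const_mul]
  congr 1; funext y
  have : ∀ x, heatGamma x y t * fI y * cN n x = fI y * (heatGamma x y t * cN n x) := by intro x; ring
  simp_rw [this]
  rw [integral_const_mul, ← intervalIntegral.integral_of_le (by norm_num), gamma_integral_cN n y ht]
  ring

/-- integrability of f and moment formula -/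
lemma sol_moment (ha : 0 < a) (hfI : ContinuousOn fI (Icc (-1) 1)) (hs : IsSolutionP a fI (Ioo 0 T) f p) {t : ℝ} (ht : t ∈ Ioo 0 T)
    (hw : IntegrableOn (fun s => wP a (p s) * flux f p s) (Ioo 0 t)) :
    IntegrableOn (fun x => f x t) (Ioc (-1) 1) ∧ ∀ n : ℕ, ∫ x in Ioc (-1:ℝ) 1, f x t * cN n x =
      Real.exp (-muN n * t) * (∫ x in Ioc (-1:ℝ) 1, fI x * cN n x) +
      ∫ s in Ioo 0 t, Real.exp (-muN n * (t - s)) * (flux f p s * (cN n (zl a (p s)) - cN n (zr a (p s)))) := by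
  have hF := sol_fubini ha hs ht hw
  have hG := GG_prod_int hfI ht.1
  have hI1 : IntegrableOn (fun x => GG fI x t) (Ioc (-1) 1) := by
    have := hG.integral_prod_left
    unfold GG
    simp_rw [intervalIntegral.integral_of_le (show (-1:ℝ) ≤ 1 by norm_num)]
    exact this
  have hI2 : IntegrableOn (fun x => ∫ s in Ioo 0 t, Dk a p x t s * flux f p s) (Ioc (-1) 1) := hF.integral_prod_right
  have hfe : ∀ x ∈ Ioc (-1:ℝ) 1, f x t = GG fI x t + ∫ s in Ioo 0 t, Dk a p x t s * flux f p s := by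
    intro x hx
    rw [sol_duhamel hs ht (Ioc_subset_Icc_self hx), intervalIntegral.integral_of_le ht.1.le, integral_Ioc_eq_integral_Ioo]
  have hb : ∀ n : ℕ, ∀ {g : ℝ → ℝ}, IntegrableOn g (Ioc (-1) 1) → IntegrableOn (fun x => g x * cN n x) (Ioc (-1) 1) := by
    intro n g hg
    exact Integrable.mul_bdd (c := 1) hg (cN_continuous n).aestronglyMeasurable (Eventually.of_forall fun q => cN_abs_le _ _)
  refine ⟨?_, fun n => ?_⟩
  · exact (integrableOn_congr_fun hfe measurableSet_Ioc).2 (hI1.add hI2)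
  · rw [setIntegral_congr_fun measurableSet_Ioc (fun x hx => by simp only [hfe x hx, add_mul] : EqOn (fun x => f x t * cN n x) (fun x => GG fI x t * cN n x + (∫ s in Ioo 0 t, Dk a p x t s * flux f p s) * cN n x) _)]
    rw [integral_add (hb n hI1) (hb n hI2), GG_integral hfI ht.1]
    congr 1
    simp_rw [← integral_mul_const]
    have h2 : Integrable (fun q : ℝ × ℝ => (Dk a p q.2 t q.1 * flux f p q.1) * cN n q.2)
      ((volume.restrict (Ioo 0 t)).prod (volume.restrict (Ioc (-1:ℝ) 1))) :=
      hF.mul_bdd (c := 1) (((cN_continuous n).comp continuous_snd).aestronglyMeasurable) (Eventually.of_forall fun q => cN_abs_le _ _)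
    rw [← integral_integral_swap h2]
    refine setIntegral_congr_fun measurableSet_Ioo fun s hss => ?_
    have hts : 0 < t - s := by linarith [hss.2]
    have : ∀ x, Dk a p x t s * flux f p s * cN n x = flux f p s * (heatGamma x (zl a (p s)) (t - s) * cN n x - heatGamma x (zr a (p s)) (t - s) * cN n x) := by
      intro x; unfold Dk; ring
    simp_rw [this]
    have hcont : ∀ y, Continuous (fun x => heatGamma x y (t - s) * cN n x) := fun y => (gamma_continuous_left y hts).mul (cN_continuous n)
    rw [integral_const_mul, ← intervalIntegral.integral_of_le (by norm_num), intervalIntegral.integral_sub ((hcont _).intervalIntegrable _ _) ((hcont _).intervalIntegrable _ _),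
      gamma_integral_cN n _ hts, gamma_integral_cN n _ hts]
    ring

end sol


section sol2
variable {T a : ℝ} {fI : ℝ → ℝ} {f : ℝ → ℝ → ℝ} {p : ℝ → ℝ}

lemma wflux_int_of_honest (ha : 0 < a) (hs : IsSolutionP a fI (Ioo 0 T) f p) {t : ℝ} (ht : t ∈ Ioo 0 T)
    {V : Set ℝ} (hV : IsOpen V) (hne : V.Nonempty)
    (hh : ∀ x ∈ V, IntervalIntegrable (fun s => Dk a p x t s * flux f p s) volume 0 t) :
    IntegrableOn (fun s => wP a (p s) * flux f p s) (Ioo 0 (t/2)) := by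
  set K : Set (ℝ × ℝ) := Icc (-1) 1 ×ˢ Icc (t/2) t with hK
  have hKc : IsCompact K := isCompact_Icc.prod isCompact_Icc
  have hloc : ∀ k : ℝ × ℝ, ∃ U ∈ 𝓝 k, ∃ x ∈ V, ∃ c > 0, k ∈ K → ∀ k' ∈ U, k' ∈ K → c ≤ |RR a x k'.1 k'.2| := by
    intro k
    by_cases hk : k ∈ K
    · obtain ⟨x, hx, hR⟩ := RR_ne_zero a k.1 (show 0 < k.2 by linarith [hk.2.1, ht.1]) hV hne
      have hc := RR_continuousOn a x (half_pos ht.1) k hk.2.1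
      have h1 : ∀ᶠ k' in 𝓝[{q : ℝ × ℝ | t/2 ≤ q.2}] k, |RR a x k.1 k.2| / 2 < |RR a x k'.1 k'.2| :=
        hc.abs.eventually (lt_mem_nhds (half_lt_self (abs_pos.2 hR)))
      rw [eventually_nhdsWithin_iff] at h1
      refine ⟨_, h1, x, hx, |RR a x k.1 k.2| / 2, half_pos (abs_pos.2 hR), fun _ k' hk' hk'K => ?_⟩
      exact (hk' hk'K.2.1).le
    · obtain ⟨x, hx⟩ := hne
      exact ⟨univ, univ_mem, x, hx, 1, one_pos, fun h => absurd h hk⟩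
  choose U hU xx hxx cc hcc hR using hloc
  obtain ⟨F, hFK, hF⟩ := hKc.elim_nhds_subcover U (fun k _ => hU k)
  have hsub : Ioo 0 (t/2) ⊆ Ioo 0 T := Ioo_subset_Ioo_right (by linarith [ht.1, ht.2])
  have hint : IntegrableOn (fun s => ∑ k ∈ F, (cc k)⁻¹ * |Dk a p (xx k) t s * flux f p s|) (Ioo 0 (t/2)) := by
    apply integrable_finsetSum
    intro k _
    have h1 := (intervalIntegrable_iff_integrableOn_Ioo_of_le ht.1.le).1 (hh (xx k) (hxx k))
    exact ((h1.mono_set (Ioo_subset_Ioo_right (by linarith [ht.1]))).abs).const_mul _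
  refine Integrable.mono' hint ((sol_wflux_aesm hs).mono_set hsub) ?_
  filter_upwards [ae_restrict_mem measurableSet_Ioo] with s hss
  have hts : 0 < t - s := by linarith [hss.2, ht.1]
  have hmem : (p s, t - s) ∈ K := ⟨sol_p_mem hs (hsub hss), by constructor <;> simp <;> linarith [hss.1, hss.2]⟩
  obtain ⟨k, hkF, hk⟩ := mem_iUnion₂.1 (hF hmem)
  have h1 := hR k (hFK k hkF) _ hk hmem
  have hw := wP_pos ha (hs.p_mem s (hsub hss))
  have hl := sol_flux_nonneg hs (hsub hss)
  calc ‖wP a (p s) * flux f p s‖ = wP a (p s) * flux f p s := by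
        rw [Real.norm_eq_abs, abs_of_nonneg (by positivity)]
    _ ≤ (cc k)⁻¹ * |Dk a p (xx k) t s * flux f p s| := by
        unfold Dk
        rw [D_eq a _ _ hts, abs_mul, abs_mul, abs_of_pos hw, abs_of_nonneg hl]
        rw [inv_mul_eq_div, le_div_iff₀ (hcc k)]
        simp only at h1
        calc _ = wP a (p s) * cc k * flux f p s := by ring
          _ ≤ _ := by gcongr
    _ ≤ _ := Finset.single_le_sum (f := fun k => (cc k)⁻¹ * |Dk a p (xx k) t s * flux f p s|)
        (fun k _ => mul_nonneg (inv_nonneg.2 (hcc k).le) (abs_nonneg _)) hkF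

lemma cN_lip (n : ℕ) (x y : ℝ) : |cN n x - cN n y| ≤ n * 2 * |x - y| := by
  unfold cN
  have h : |Real.cos (n * (Real.pi * (x + 1) / 2)) - Real.cos (n * (Real.pi * (y + 1) / 2))| ≤ |n * (Real.pi * (x + 1) / 2) - n * (Real.pi * (y + 1) / 2)| := by
    have := Real.lipschitzWith_cos.dist_le_mul (n * (Real.pi * (x + 1) / 2)) (n * (Real.pi * (y + 1) / 2))
    simpa [Real.dist_eq] using this
  refine h.trans ?_
  rw [show (n:ℝ) * (Real.pi * (x + 1) / 2) - n * (Real.pi * (y + 1) / 2) = n * (Real.pi / 2) * (x - y) by ring, abs_mul,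
    abs_of_nonneg (by positivity)]
  have : Real.pi / 2 ≤ 2 := by linarith [Real.pi_le_four]
  gcongr

lemma coeff_bound (hfI : ContDiffOn ℝ 2 fI (Icc (-1) 1)) :
    ∃ C, 0 ≤ C ∧ ∀ n : ℕ, |∫ x in (-1:ℝ)..1, cN (n+1) x * fI x| ≤ C / (n + 1) := by
  have hc1 : ContinuousOn (derivWithin fI (Icc (-1) 1)) (Icc (-1) 1) :=
    hfI.continuousOn_derivWithin (uniqueDiffOn_Icc (by norm_num)) (by norm_num)
  obtain ⟨C, hC⟩ := isCompact_Icc.exists_bound_of_continuousOn hc1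
  have hC0 : 0 ≤ C := (norm_nonneg _).trans (hC 0 (by norm_num))
  refine ⟨2 * C, by positivity, fun n => ?_⟩
  have hpi := Real.pi_pos
  set k : ℝ := (n:ℝ) + 1 with hk
  have hk0 : 0 < k := by positivity
  let S : ℝ → ℝ := fun x => (2 / (k * Real.pi)) * Real.sin (k * (Real.pi * (x + 1) / 2))
  have hS : ∀ x, HasDerivAt S (cN (n+1) x) x := by
    intro x
    have h1 : HasDerivAt (fun x : ℝ => k * (Real.pi * (x + 1) / 2)) (k * (Real.pi / 2)) x := by
      have := ((((hasDerivAt_id x).add_const 1).const_mul Real.pi).div_const 2).const_mul k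
      simpa using this
    have := h1.sin.const_mul (2 / (k * Real.pi))
    convert! this using 1
    unfold cN
    push_cast
    rw [← hk]
    field_simp
  have hsm : S (-1) = 0 := by simp [S]
  have hsp : S 1 = 0 := by
    have : Real.sin (k * (Real.pi * (1 + 1) / 2)) = 0 := by
      rw [show k * (Real.pi * (1+1)/2) = ((n+1 : ℕ) : ℝ) * Real.pi by rw [hk]; push_cast; ring]
      exact Real.sin_nat_mul_pi _
    simp only [S, this, mul_zero]
  have hIBP := intervalIntegral.integral_mul_deriv_eq_deriv_mul_of_hasDerivAt (a := -1) (b := 1) (u := fI) (v := S)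
    (u' := derivWithin fI (Icc (-1) 1)) (v' := cN (n+1))
    (by rw [uIcc_of_le (by norm_num)]; exact hfI.continuousOn)
    (fun x _ => (hS x).continuousAt.continuousWithinAt)
    (by
      intro x hx
      simp at hx
      have hx' : Icc (-1:ℝ) 1 ∈ 𝓝 x := Icc_mem_nhds hx.1 hx.2
      exact ((hfI.differentiableOn (by norm_num)) x ⟨hx.1.le, hx.2.le⟩).hasDerivWithinAt.hasDerivAt hx')
    (fun x _ => hS x)
    (by apply ContinuousOn.intervalIntegrable; rw [uIcc_of_le (by norm_num)]; exact hc1)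
    ((cN_continuous _).intervalIntegrable _ _)
  have e : ∫ x in (-1:ℝ)..1, cN (n+1) x * fI x = ∫ x in (-1:ℝ)..1, fI x * cN (n+1) x := by
    congr 1; funext x; ring
  rw [e, hIBP, hsm, hsp]
  simp only [mul_zero, sub_zero, zero_sub, abs_neg]
  have := intervalIntegral.norm_integral_le_of_norm_le_const (a := -1) (b := 1) (f := fun x => derivWithin fI (Icc (-1) 1) x * S x) (C := C * (1 / k)) ?_
  · rw [Real.norm_eq_abs] at this
    refine this.trans (le_of_eq ?_)
    norm_num; field_simp
  · intro x hx
    rw [uIoc_of_le (by norm_num)] at hx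
    rw [norm_mul]
    have hb : ‖S x‖ ≤ 1 / k := by
      simp only [S, Real.norm_eq_abs, abs_mul]
      rw [abs_of_pos (by positivity)]
      calc _ ≤ 2 / (k * Real.pi) * 1 := by gcongr; exact Real.abs_sin_le_one _
        _ ≤ 1 / k := by
          rw [mul_one, div_le_div_iff₀ (by positivity) hk0]
          nlinarith [Real.two_le_pi]
    exact mul_le_mul (hC x (Ioc_subset_Icc_self hx)) hb (norm_nonneg _) hC0

lemma GG_lip (hfI : ContDiffOn ℝ 2 fI (Icc (-1) 1)) :
    ∃ C, 0 ≤ C ∧ ∀ t > 0, ∀ x y : ℝ, |GG fI x t - GG fI y t| ≤ C * t ^ (-(3/4) : ℝ) * |x - y| := by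
  obtain ⟨C, hC0, hC⟩ := coeff_bound hfI
  have hii : IntervalIntegrable fI volume (-1) 1 := by
    apply ContinuousOn.intervalIntegrable; rw [uIcc_of_le (by norm_num)]; exact hfI.continuousOn
  refine ⟨2 * C * SB, by have := SB_nonneg; positivity, fun t ht x y => ?_⟩
  have hGx : ∀ x, GG fI x t = ∫ x' in (-1:ℝ)..1, heatGamma x' x t * fI x' := by
    intro x; unfold GG; congr 1; funext x'; rw [gamma_symm _ _ ht]
  have h1 := (gamma_integral_hasSum hii x ht).sub (gamma_integral_hasSum hii y ht)
  rw [← hGx, ← hGx] at h1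
  have h2 : HasSum (fun n => bN n * (t ^ (-(3/4) : ℝ) * (2 * C * |x - y|))) (SB * (t ^ (-(3/4) : ℝ) * (2 * C * |x - y|))) :=
    bN_summable.hasSum.mul_right _
  have h3 : ∀ n : ℕ, ‖Real.exp (-muN (n+1) * t) * cN (n+1) x * (∫ x in (-1:ℝ)..1, cN (n+1) x * fI x)
      - Real.exp (-muN (n+1) * t) * cN (n+1) y * ∫ x in (-1:ℝ)..1, cN (n+1) x * fI x‖ ≤ bN n * (t ^ (-(3/4) : ℝ) * (2 * C * |x - y|)) := by
    intro n
    rw [← sub_mul, ← mul_sub, norm_mul, norm_mul, Real.norm_eq_abs, Real.norm_eq_abs, Real.norm_eq_abs, abs_of_pos (Real.exp_pos _)]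
    have hl := cN_lip (n+1) x y
    push_cast at hl
    calc _ ≤ (bN n * t ^ (-(3/4) : ℝ)) * (((n:ℝ)+1) * 2 * |x - y|) * (C / (n+1)) := by
          gcongr
          · have := bN_nonneg n; positivity
          · have := bN_nonneg n; positivity
          · exact exp_mu_le n ht
          · exact hC n
      _ = _ := by field_simp
  have := tsum_of_norm_bounded h2 h3
  rw [h1.tsum_eq] at this
  rw [Real.norm_eq_abs] at this
  calc _ = _ := by congr 1; ring
    _ ≤ _ := this
    _ = _ := by ring

/-- If junk points are dense, the flux is controlled by G. -/
lemma flux_le_of_dense (hs : IsSolutionP a fI (Ioo 0 T) f p) {t L : ℝ} (ht : t ∈ Ioo 0 T)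
    (hL : ∀ x y : ℝ, |GG fI x t - GG fI y t| ≤ L * |x - y|)
    (hd : ∀ V : Set ℝ, IsOpen V → V.Nonempty → V ⊆ Ioo (-1) 1 → ∃ x ∈ V, f x t = GG fI x t) :
    |flux f p t| ≤ L := by
  have hp := hs.p_mem t ht
  have hD := (hs.diff_at t ht).hasDerivAt
  have hL0 : 0 ≤ L := by
    have := (abs_nonneg _).trans (hL 1 0); simpa using this
  have hfr : ∃ᶠ x in 𝓝[≠] (p t), f x t = GG fI x t := by
    rw [frequently_iff]
    intro U hU
    have hU2 : U ∩ Ioo (p t) 1 ∈ 𝓝[>] (p t) := inter_mem (nhdsWithin_mono _ (fun x hx => ne_of_gt hx) hU) (Ioo_mem_nhdsGT hp.2)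
    obtain ⟨u, hu, hsubu⟩ := (mem_nhdsGT_iff_exists_Ioo_subset).1 hU2
    obtain ⟨x, hx, he⟩ := hd (Ioo (p t) u) isOpen_Ioo (nonempty_Ioo.2 hu) (fun x hx => ⟨by linarith [hp.1, hx.1], (hsubu hx).2.2⟩)
    exact ⟨x, (hsubu hx).1, he⟩
  have hGc : Continuous (fun x => GG fI x t) := by
    have : LipschitzWith ⟨L, hL0⟩ (fun x => GG fI x t) := LipschitzWith.of_dist_le_mul fun x y => by
      rw [Real.dist_eq, Real.dist_eq]; exact hL x y
    exact this.continuous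
  obtain ⟨u, hu, hue⟩ := (frequently_iff_seq_forall (l := 𝓝[≠] (p t)) (p := fun x => f x t = GG fI x t)).1 hfr
  have hu' := hu.mono_right (nhdsWithin_le_nhds (a := p t))
  have hGp : GG fI (p t) t = f (p t) t := by
    have h1 := (hGc.tendsto (p t)).comp hu'
    have h2 := (hD.continuousAt.tendsto).comp hu'
    refine tendsto_nhds_unique h1 (h2.congr fun n => ?_)
    exact hue n
  have hsl := (hD.tendsto_slope).comp hu
  have : |deriv (fun x => f x t) (p t)| ≤ L := by
    refine le_of_tendsto hsl.abs ?_
    have hne : ∀ᶠ n in atTop, u n ≠ p t := hu.eventually self_mem_nhdsWithin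
    filter_upwards [hne] with n hn
    simp only [Function.comp]
    rw [slope_def_field, hue n, ← hGp, abs_div, div_le_iff₀ (abs_pos.2 (sub_ne_zero.2 hn))]
    exact hL _ _
  unfold flux
  rwa [abs_neg]

/-- dichotomy near zero -/
lemma near_zero_dichotomy (ha : 0 < a) (hT : 0 < T) (hfI : ContDiffOn ℝ 2 fI (Icc (-1) 1)) (hs : IsSolutionP a fI (Ioo 0 T) f p) :
    ∃ d ∈ Ioo 0 T, IntegrableOn (fun s => wP a (p s) * flux f p s) (Ioo 0 d) := by
  by_cases h : ∃ t ∈ Ioo 0 T, ∃ V : Set ℝ, IsOpen V ∧ V.Nonempty ∧ V ⊆ Ioo (-1) 1 ∧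
      ∀ x ∈ V, IntervalIntegrable (fun s => Dk a p x t s * flux f p s) volume 0 t
  · obtain ⟨t, ht, V, hV, hne, _, hh⟩ := h
    exact ⟨t/2, ⟨half_pos ht.1, by linarith [ht.1, ht.2]⟩, wflux_int_of_honest ha hs ht hV hne hh⟩
  · push Not at h
    obtain ⟨C, hC0, hC⟩ := GG_lip hfI
    have hb : ∀ t ∈ Ioo 0 T, |flux f p t| ≤ C * t ^ (-(3/4) : ℝ) := by
      intro t ht
      refine flux_le_of_dense hs ht (hC t ht.1) fun V hV hne hVs => ?_
      obtain ⟨x, hx, hj⟩ := h t ht V hV hne hVs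
      refine ⟨x, hx, ?_⟩
      rw [sol_duhamel hs ht (Ioo_subset_Icc_self (hVs hx)), intervalIntegral.integral_undef hj, add_zero]
    have hsub : Ioo 0 (T/2) ⊆ Ioo 0 T := Ioo_subset_Ioo_right (by linarith)
    refine ⟨T/2, ⟨by linarith, by linarith⟩, ?_⟩
    have hi : IntegrableOn (fun t : ℝ => 2 * (C * t ^ (-(3/4) : ℝ))) (Ioo 0 (T/2)) := by
      have := (intervalIntegral.intervalIntegrable_rpow' (a := 0) (b := T/2) (r := -(3/4)) (by norm_num))
      exact (((intervalIntegrable_iff_integrableOn_Ioo_of_le (by linarith)).1 this).const_mul C).const_mul 2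
    refine Integrable.mono' hi ((sol_wflux_aesm hs).mono_set hsub) ?_
    filter_upwards [ae_restrict_mem measurableSet_Ioo] with s hss
    have h1 := hb s (hsub hss)
    have h2 : |wP a (p s)| ≤ 2 := by
      unfold wP; rw [abs_le]; constructor <;> linarith [(kap_mem (zl a (p s))).1, (kap_mem (zl a (p s))).2, (kap_mem (zr a (p s))).1, (kap_mem (zr a (p s))).2]
    rw [norm_mul, Real.norm_eq_abs, Real.norm_eq_abs]
    exact mul_le_mul h2 h1 (abs_nonneg _) (by norm_num)

end sol2


lemma poly_mem_span_T (P : Polynomial ℝ) :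
    P ∈ Submodule.span ℝ (range fun n : ℕ => Polynomial.Chebyshev.T ℝ (n : ℤ)) := by
  set S := Submodule.span ℝ (range fun n : ℕ => Polynomial.Chebyshev.T ℝ (n : ℤ)) with hS
  have hmem : ∀ n : ℕ, Polynomial.Chebyshev.T ℝ (n : ℤ) ∈ S := fun n => Submodule.subset_span ⟨n, rfl⟩
  have hX : ∀ Q ∈ S, Polynomial.X * Q ∈ S := by
    intro Q hQ
    induction hQ using Submodule.span_induction with
    | mem Q h =>
      obtain ⟨n, rfl⟩ := h
      simp only
      rcases n with _ | n
      · have := hmem 1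
        simpa using this
      · have h2 := Polynomial.Chebyshev.T_add_two ℝ (n : ℤ)
        have : Polynomial.X * Polynomial.Chebyshev.T ℝ ((n+1 : ℕ) : ℤ) =
            (1/2 : ℝ) • (Polynomial.Chebyshev.T ℝ ((n+2 : ℕ) : ℤ) + Polynomial.Chebyshev.T ℝ (n : ℤ)) := by
          push_cast
          rw [h2, Polynomial.smul_eq_C_mul]
          have h3 : (Polynomial.C (1/2:ℝ)) * 2 = 1 := by
            rw [show (2 : Polynomial ℝ) = Polynomial.C 2 from rfl, ← Polynomial.C_mul]; norm_num
          linear_combination (-(Polynomial.X * Polynomial.Chebyshev.T ℝ ((n:ℤ)+1))) * h3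
        rw [this]
        exact S.smul_mem _ (S.add_mem (hmem _) (hmem _))
    | zero => simp
    | add x y _ _ hx hy => rw [mul_add]; exact S.add_mem hx hy
    | smul c x _ hx => rw [mul_smul_comm]; exact S.smul_mem _ hx
  have hXn : ∀ n : ℕ, (Polynomial.X : Polynomial ℝ) ^ n ∈ S := by
    intro n
    induction n with
    | zero => simpa using hmem 0
    | succ n ih => rw [pow_succ']; exact hX _ ih
  induction P using Polynomial.induction_on' with
  | add p q hp hq => exact S.add_mem hp hq
  | monomial n c =>
    rw [← Polynomial.C_mul_X_pow_eq_monomial, ← Polynomial.smul_eq_C_mul]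
    exact S.smul_mem _ (hXn n)

/-- A property closed under linear combinations and true for `T_n` is true for polynomials. -/
lemma poly_T_induction {Q : Polynomial ℝ → Prop} (hT : ∀ n : ℕ, Q (Polynomial.Chebyshev.T ℝ (n:ℤ)))
    (h0 : Q 0) (hadd : ∀ P R, Q P → Q R → Q (P + R)) (hsm : ∀ (c : ℝ) P, Q P → Q (c • P)) (P : Polynomial ℝ) : Q P := by
  have := poly_mem_span_T P
  induction this using Submodule.span_induction with
  | mem P h => obtain ⟨n, rfl⟩ := h; exact hT n
  | zero => exact h0
  | add x y _ _ hx hy => exact hadd _ _ hx hy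
  | smul c x _ hx => exact hsm _ _ hx

lemma int_mul_poly {g : ℝ → ℝ} (hg : IntegrableOn g (Ioc (-1:ℝ) 1)) {h : ℝ → ℝ} (hh : ContinuousOn h (Icc (-1) 1)) :
    IntegrableOn (fun x => g x * h x) (Ioc (-1:ℝ) 1) := by
  obtain ⟨C, hC⟩ := isCompact_Icc.exists_bound_of_continuousOn hh
  refine Integrable.mul_bdd (c := C) hg ((hh.mono Ioc_subset_Icc_self).aestronglyMeasurable measurableSet_Ioc) ?_
  filter_upwards [ae_restrict_mem measurableSet_Ioc] with x hx
  exact hC x (Ioc_subset_Icc_self hx)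

lemma pk_cont (P : Polynomial ℝ) : Continuous (fun x => P.eval (kap x)) := P.continuous.comp kap_continuous

section sol3
variable {T a : ℝ} {fI : ℝ → ℝ} {f : ℝ → ℝ → ℝ} {p : ℝ → ℝ}

lemma poly_limit (ha : 0 < a) (hfI : ContinuousOn fI (Icc (-1) 1)) (hs : IsSolutionP a fI (Ioo 0 T) f p) {d : ℝ} (hd : d ∈ Ioo 0 T)
    (hw : IntegrableOn (fun s => wP a (p s) * flux f p s) (Ioo 0 d)) (P : Polynomial ℝ) :
    Tendsto (fun t => ∫ x in Ioc (-1:ℝ) 1, f x t * P.eval (kap x)) (𝓝[>] 0) (𝓝 (∫ x in Ioc (-1:ℝ) 1, fI x * P.eval (kap x))) := by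
  have hwt : ∀ t ∈ Ioo 0 d, IntegrableOn (fun s => wP a (p s) * flux f p s) (Ioo 0 t) := fun t ht => hw.mono_set (Ioo_subset_Ioo_right ht.2.le)
  have hev : ∀ᶠ t in 𝓝[>] (0:ℝ), t ∈ Ioo 0 d := Ioo_mem_nhdsGT hd.1
  have hif : ∀ t ∈ Ioo 0 d, IntegrableOn (fun x => f x t) (Ioc (-1) 1) := fun t ht =>
    (sol_moment ha hfI hs ⟨ht.1, ht.2.trans hd.2⟩ (hwt t ht)).1
  have hiI : IntegrableOn fI (Ioc (-1) 1) := (hfI.integrableOn_compact isCompact_Icc).mono_set Ioc_subset_Icc_self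
  induction P using poly_T_induction with
  | hT n =>
    simp_rw [← cN_eq_T]
    have hW : Tendsto (fun t => ∫ s in Ioo 0 t, wP a (p s) * flux f p s) (𝓝[>] 0) (𝓝 0) := by
      have hint : IntervalIntegrable (fun s => wP a (p s) * flux f p s) volume 0 d := (intervalIntegrable_iff_integrableOn_Ioo_of_le hd.1.le).2 hw
      have h1 := intervalIntegral.continuousOn_primitive_interval' hint (left_mem_uIcc)
      have h2 := h1 0 left_mem_uIcc
      have h3 : Tendsto (fun t => ∫ s in (0:ℝ)..t, wP a (p s) * flux f p s) (𝓝[>] 0) (𝓝 0) := by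
        have h4 := h2.tendsto
        rw [intervalIntegral.integral_same] at h4
        refine h4.mono_left ?_
        refine nhdsWithin_le_of_mem ?_
        filter_upwards [hev] with t ht
        rw [uIcc_of_le hd.1.le]; exact ⟨ht.1.le, ht.2.le⟩
      refine h3.congr' ?_
      filter_upwards [hev] with t ht
      rw [intervalIntegral.integral_of_le ht.1.le, integral_Ioc_eq_integral_Ioo]
    have h1 : Tendsto (fun t => Real.exp (-muN n * t) * (∫ x in Ioc (-1:ℝ) 1, fI x * cN n x)) (𝓝[>] 0) (𝓝 (∫ x in Ioc (-1:ℝ) 1, fI x * cN n x)) := by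
      have hc : Continuous (fun t => Real.exp (-muN n * t) * (∫ x in Ioc (-1:ℝ) 1, fI x * cN n x)) := by fun_prop
      have := (hc.tendsto 0).mono_left (nhdsWithin_le_nhds (s := Ioi 0))
      simpa using this
    have h2 : Tendsto (fun t => ∫ s in Ioo 0 t, Real.exp (-muN n * (t - s)) * (flux f p s * (cN n (zl a (p s)) - cN n (zr a (p s))))) (𝓝[>] 0) (𝓝 0) := by
      refine squeeze_zero_norm' ?_ (by simpa using hW.const_mul ((n:ℝ)^2))
      filter_upwards [hev] with t ht
      rw [← integral_const_mul]
      refine norm_integral_le_of_norm_le ((hwt t ht).const_mul _) ?_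
      filter_upwards [ae_restrict_mem measurableSet_Ioo] with s hss
      have hsT : s ∈ Ioo 0 T := ⟨hss.1, by linarith [hss.2, ht.2, hd.2]⟩
      have hl := sol_flux_nonneg hs hsT
      have h3 := cN_diff_abs ha (hs.p_mem s hsT) n
      have he : Real.exp (-muN n * (t - s)) ≤ 1 := by
        apply Real.exp_le_one_iff.2; nlinarith [muN_nonneg n, hss.2]
      rw [norm_mul, norm_mul, Real.norm_eq_abs, Real.norm_eq_abs, Real.norm_eq_abs, abs_of_pos (Real.exp_pos _), abs_of_nonneg hl]
      calc _ ≤ 1 * (flux f p s * (wP a (p s) * n^2)) := by gcongr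
        _ = _ := by ring
    have := h1.add h2
    rw [add_zero] at this
    refine this.congr' ?_
    filter_upwards [hev] with t ht
    exact ((sol_moment ha hfI hs ⟨ht.1, ht.2.trans hd.2⟩ (hwt t ht)).2 n).symm
  | h0 => simp
  | hadd P R hP hR =>
    simp only [Polynomial.eval_add, mul_add]
    rw [integral_add (int_mul_poly hiI (pk_cont P).continuousOn) (int_mul_poly hiI (pk_cont R).continuousOn)]
    refine (hP.add hR).congr' ?_
    filter_upwards [hev] with t ht
    rw [integral_add (int_mul_poly (hif t ht) (pk_cont P).continuousOn) (int_mul_poly (hif t ht) (pk_cont R).continuousOn)]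
  | hsm c P hP =>
    simp only [Polynomial.eval_smul, smul_eq_mul]
    have e : ∀ g : ℝ → ℝ, ∫ x in Ioc (-1:ℝ) 1, g x * (c * P.eval (kap x)) = c * ∫ x in Ioc (-1:ℝ) 1, g x * P.eval (kap x) := by
      intro g; rw [← integral_const_mul]; congr 1; funext x; ring
    rw [e]
    refine (hP.const_mul c).congr fun t => ?_
    rw [e]

/-- sign property in the limit -/
lemma limit_sign (ha : 0 < a) (hfI : ContinuousOn fI (Icc (-1) 1)) (hs : IsSolutionP a fI (Ioo 0 T) f p) {d : ℝ} (hd : d ∈ Ioo 0 T)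
    (hw : IntegrableOn (fun s => wP a (p s) * flux f p s) (Ioo 0 d)) {F : Filter ℝ} [F.NeBot] (hF : F ≤ 𝓝[>] 0) {P0 : ℝ}
    (hP0 : Tendsto p F (𝓝 P0)) (P : Polynomial ℝ) :
    0 ≤ ∫ x in Ioc (-1:ℝ) 1, fI x * ((kap x - kap P0) * P.eval (kap x) ^ 2) := by
  have h1 := (poly_limit ha hfI hs hd hw (Polynomial.X * P^2)).mono_left hF
  have h2 := (poly_limit ha hfI hs hd hw (P^2)).mono_left hF
  have h3 : Tendsto (fun t => kap (p t)) F (𝓝 (kap P0)) := (kap_continuous.tendsto P0).comp hP0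
  have h4 := h1.sub (h3.mul h2)
  have hiI : IntegrableOn fI (Ioc (-1) 1) := (hfI.integrableOn_compact isCompact_Icc).mono_set Ioc_subset_Icc_self
  have key : ∀ (g : ℝ → ℝ) (c : ℝ), IntegrableOn g (Ioc (-1) 1) →
      (∫ x in Ioc (-1:ℝ) 1, g x * (Polynomial.X * P^2 : Polynomial ℝ).eval (kap x)) - c * (∫ x in Ioc (-1:ℝ) 1, g x * (P^2).eval (kap x))
      = ∫ x in Ioc (-1:ℝ) 1, g x * ((kap x - c) * P.eval (kap x) ^ 2) := by
    intro g c hg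
    rw [← integral_const_mul, ← integral_sub (int_mul_poly hg (pk_cont _).continuousOn) ((int_mul_poly hg (pk_cont _).continuousOn).const_mul _)]
    congr 1; funext x
    simp only [Polynomial.eval_mul, Polynomial.eval_X, Polynomial.eval_pow]
    ring
  rw [key fI _ hiI] at h4
  refine ge_of_tendsto h4 ?_
  have hev : ∀ᶠ t in F, t ∈ Ioo 0 d := hF (Ioo_mem_nhdsGT hd.1)
  filter_upwards [hev] with t ht
  have htT : t ∈ Ioo 0 T := ⟨ht.1, ht.2.trans hd.2⟩
  rw [key (fun x => f x t) _ (sol_moment ha hfI hs htT (hw.mono_set (Ioo_subset_Ioo_right ht.2.le))).1]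
  refine setIntegral_nonneg measurableSet_Ioc fun x hx => ?_
  have hx' : x ∈ Icc (-1:ℝ) 1 := Ioc_subset_Icc_self hx
  rw [← mul_assoc]
  refine mul_nonneg ?_ (sq_nonneg _)
  rcases lt_trichotomy x (p t) with h | h | h
  · have := kap_strictAnti hx' (sol_p_mem hs htT) h
    exact mul_nonneg (hs.pos_left t htT x ⟨hx'.1, h⟩).le (by linarith)
  · rw [h]; simp
  · have := kap_strictAnti (sol_p_mem hs htT) hx' h
    exact mul_nonneg_of_nonpos_of_nonpos (hs.neg_right t htT x ⟨h, hx'.2⟩).le (by linarith)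

lemma weier_sign (hfI : ContinuousOn fI (Icc (-1) 1)) {k : ℝ}
    (hP : ∀ P : Polynomial ℝ, 0 ≤ ∫ x in Ioc (-1:ℝ) 1, fI x * ((kap x - k) * P.eval (kap x) ^ 2)) {h : ℝ → ℝ} (hh : Continuous h) :
    0 ≤ ∫ x in Ioc (-1:ℝ) 1, fI x * ((kap x - k) * h (kap x) ^ 2) := by
  have hex : ∀ n : ℕ, ∃ P : Polynomial ℝ, ∀ x ∈ Icc (-1:ℝ) 1, |P.eval x - h x| < 1 / ((n:ℝ)+1) := fun n =>
    exists_polynomial_near_of_continuousOn (-1) 1 h hh.continuousOn _ (by positivity)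
  choose Q hQ using hex
  obtain ⟨M, hM⟩ := isCompact_Icc.exists_bound_of_continuousOn (hh.continuousOn (s := Icc (-1:ℝ) 1))
  have hiI : IntegrableOn fI (Ioc (-1) 1) := (hfI.integrableOn_compact isCompact_Icc).mono_set Ioc_subset_Icc_self
  have hM0 : 0 ≤ M := (norm_nonneg _).trans (hM 0 (by norm_num))
  have hlim : Tendsto (fun n : ℕ => ∫ x in Ioc (-1:ℝ) 1, fI x * ((kap x - k) * (Q n).eval (kap x) ^ 2)) atTop
      (𝓝 (∫ x in Ioc (-1:ℝ) 1, fI x * ((kap x - k) * h (kap x) ^ 2))) := by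
    refine tendsto_integral_of_dominated_convergence (fun x => |fI x| * ((1 + |k|) * (M + 1) ^ 2)) ?_ ?_ ?_ ?_
    · intro n
      have hc : Continuous (fun x => (kap x - k) * (Q n).eval (kap x) ^ 2) := (kap_continuous.sub continuous_const).mul ((pk_cont _).pow 2)
      exact (int_mul_poly hiI hc.continuousOn).aestronglyMeasurable
    · exact hiI.abs.mul_const _
    · intro n
      refine Eventually.of_forall fun x => ?_
      rw [norm_mul, norm_mul, norm_pow, Real.norm_eq_abs]
      gcongr
      · calc ‖kap x - k‖ ≤ ‖kap x‖ + ‖k‖ := norm_sub_le _ _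
          _ ≤ _ := by
            have := kap_abs x
            simp only [Real.norm_eq_abs]; linarith
      · have h1 := hQ n (kap x) (kap_mem x)
        have h2 := hM (kap x) (kap_mem x)
        have h3 : 1 / ((n:ℝ)+1) ≤ 1 := by rw [div_le_one (by positivity)]; linarith [(Nat.cast_nonneg n : (0:ℝ) ≤ n)]
        have h4 := norm_add_le ((Q n).eval (kap x) - h (kap x)) (h (kap x))
        rw [sub_add_cancel] at h4
        simp only [Real.norm_eq_abs] at h2 h4 ⊢
        linarith
    · refine Eventually.of_forall fun x => ?_
      refine Tendsto.const_mul _ (Tendsto.const_mul _ (Tendsto.pow ?_ 2))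
      rw [tendsto_iff_norm_sub_tendsto_zero]
      refine squeeze_zero (fun _ => norm_nonneg _) (fun n => (hQ n (kap x) (kap_mem x)).le) tendsto_one_div_add_atTop_nhds_zero_nat
  exact ge_of_tendsto' hlim fun n => hP (Q n)

end sol3


section sol4
variable {T a : ℝ} {fI : ℝ → ℝ} {f : ℝ → ℝ → ℝ} {p : ℝ → ℝ} {pI a₀ lamI : ℝ}

lemma sign_contra (hI : IsInitialDatum fI pI a₀ lamI) {k : ℝ} (hk : k = 1 ∨ k = -1)
    (hP : ∀ P : Polynomial ℝ, 0 ≤ ∫ x in Ioc (-1:ℝ) 1, fI x * ((kap x - k) * P.eval (kap x) ^ 2)) : False := by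
  have hfI := hI.smooth.continuousOn
  have hpI := hI.pI_mem
  have hpI' : pI ∈ Icc (-1:ℝ) 1 := Ioo_subset_Icc_self hpI
  have main : ∀ h : ℝ → ℝ, Continuous h → (∀ x ∈ Icc (-1:ℝ) 1, fI x * ((kap x - k) * h (kap x) ^ 2) ≤ 0) →
      (∃ x ∈ Icc (-1:ℝ) 1, fI x * ((kap x - k) * h (kap x) ^ 2) < 0) → False := by
    intro h hh hle hlt
    have h0 := weier_sign hfI hP hh
    have hc : ContinuousOn (fun x => fI x * ((kap x - k) * h (kap x) ^ 2)) (Icc (-1) 1) :=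
      hfI.mul (((kap_continuous.sub continuous_const).mul ((hh.comp kap_continuous).pow 2)).continuousOn)
    have := intervalIntegral.integral_pos (a := -1) (b := 1) (by norm_num) hc.neg
      (fun x hx => by simpa using hle x (Ioc_subset_Icc_self hx))
      (by obtain ⟨x, hx, h⟩ := hlt; exact ⟨x, hx, by simpa using h⟩)
    simp only [Pi.neg_apply, intervalIntegral.integral_neg] at this
    rw [intervalIntegral.integral_of_le (by norm_num)] at this
    linarith
  rcases hk with rfl | rfl
  · refine main (fun X => max 0 (X - kap pI)) (by fun_prop) ?_ ?_
    · intro x hx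
      have h1 : kap x - 1 ≤ 0 := by linarith [(kap_mem x).2]
      rcases le_or_gt pI x with h | h
      · have : kap x ≤ kap pI := kap_strictAnti.antitoneOn hpI' hx h
        simp only [max_eq_left (sub_nonpos.2 this)]; simp
      · have := hI.pos_left x ⟨hx.1, h⟩
        exact mul_nonpos_of_nonneg_of_nonpos this.le (mul_nonpos_of_nonpos_of_nonneg h1 (sq_nonneg _))
    · have hx1 : (pI - 1) / 2 ∈ Icc (-1:ℝ) 1 := ⟨by linarith [hpI.1], by linarith [hpI.2]⟩
      have hlt : (pI - 1)/2 < pI := by linarith [hpI.1]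
      refine ⟨_, hx1, ?_⟩
      have h1 := hI.pos_left _ ⟨hx1.1, hlt⟩
      have h2 := kap_strictAnti hx1 hpI' hlt
      have h3 := kap_strictAnti (by norm_num : (-1:ℝ) ∈ Icc (-1:ℝ) 1) hx1 (by linarith [hpI.1])
      rw [kap_neg_one] at h3
      simp only [max_eq_right (sub_nonneg.2 h2.le)]
      exact mul_neg_of_pos_of_neg h1 (mul_neg_of_neg_of_pos (by linarith) (pow_pos (by linarith) 2))
  · refine main (fun X => max 0 (kap pI - X)) (by fun_prop) ?_ ?_
    · intro x hx
      have h1 : 0 ≤ kap x - -1 := by linarith [(kap_mem x).1]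
      rcases le_or_gt x pI with h | h
      · have : kap pI ≤ kap x := kap_strictAnti.antitoneOn hx hpI' h
        simp only [max_eq_left (sub_nonpos.2 this)]; simp
      · have := hI.neg_right x ⟨h, hx.2⟩
        exact mul_nonpos_of_nonpos_of_nonneg this.le (mul_nonneg h1 (sq_nonneg _))
    · have hx1 : (pI + 1) / 2 ∈ Icc (-1:ℝ) 1 := ⟨by linarith [hpI.1], by linarith [hpI.2]⟩
      have hlt : pI < (pI + 1)/2 := by linarith [hpI.2]
      refine ⟨_, hx1, ?_⟩
      have h1 := hI.neg_right _ ⟨hlt, hx1.2⟩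
      have h2 := kap_strictAnti hpI' hx1 hlt
      have h3 := kap_strictAnti hx1 (by norm_num : (1:ℝ) ∈ Icc (-1:ℝ) 1) (by linarith [hpI.2])
      rw [kap_one] at h3
      simp only [max_eq_right (sub_nonneg.2 h2.le)]
      exact mul_neg_of_neg_of_pos h1 (mul_pos (by linarith) (pow_pos (by linarith) 2))

lemma near_zero_flux (ha : 0 < a) (hT : 0 < T) (hI : IsInitialDatum fI pI a₀ lamI) (hs : IsSolutionP a fI (Ioo 0 T) f p) :
    ∃ d ∈ Ioo 0 T, IntegrableOn (flux f p) (Ioo 0 d) := by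
  obtain ⟨d, hd, hw⟩ := near_zero_dichotomy ha hT hI.smooth hs
  have hcl : ∃ c > 0, ∀ᶠ t in 𝓝[>] (0:ℝ), c ≤ wP a (p t) := by
    by_contra! hcon
    have hm : MapClusterPt (0:ℝ) (𝓝[>] (0:ℝ)) (fun t => wP a (p t)) := by
      rw [mapClusterPt_iff_frequently]
      intro S hS
      obtain ⟨e, he, hball⟩ := Metric.mem_nhds_iff.1 hS
      have h1 : ∃ᶠ t in 𝓝[>] (0:ℝ), wP a (p t) < e := by
        have := hcon e he; simpa [not_eventually, not_le] using this
      have hev : ∀ᶠ t in 𝓝[>] (0:ℝ), t ∈ Ioo 0 T := Ioo_mem_nhdsGT hT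
      refine (h1.and_eventually hev).mono fun t ht => hball ?_
      rw [Metric.mem_ball, Real.dist_eq, sub_zero, abs_of_pos (wP_pos ha (hs.p_mem t ht.2))]
      exact ht.1
    obtain ⟨U, hU, hUt⟩ := mapClusterPt_iff_ultrafilter.1 hm
    have hUp : ∀ᶠ t in (U : Filter ℝ), p t ∈ Icc (-1:ℝ) 1 := by
      filter_upwards [hU (Ioo_mem_nhdsGT hT)] with t ht using sol_p_mem hs ht
    obtain ⟨P0, hP0, hlim⟩ := (isCompact_Icc (a := (-1:ℝ)) (b := 1)).ultrafilter_le_nhds (U.map p) (le_principal_iff.2 hUp)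
    have hlim' : Tendsto p U (𝓝 P0) := hlim
    have hw0 : wP a P0 = 0 := tendsto_nhds_unique (((wP_continuous a).tendsto P0).comp hlim') hUt
    have hk : kap P0 = 1 ∨ kap P0 = -1 := by
      by_cases h1 : P0 = -1
      · left; rw [h1, kap_neg_one]
      · by_cases h2 : P0 = 1
        · right; rw [h2, kap_one]
        · exact absurd hw0 (wP_pos ha ⟨lt_of_le_of_ne hP0.1 (Ne.symm h1), lt_of_le_of_ne hP0.2 h2⟩).ne'
    exact sign_contra hI hk fun P => limit_sign ha hI.smooth.continuousOn hs hd hw hU hlim' P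
  obtain ⟨c, hc, hev⟩ := hcl
  have hev2 := hev.and (Ioo_mem_nhdsGT hd.1)
  obtain ⟨e, he, hsub⟩ := mem_nhdsGT_iff_exists_Ioo_subset.1 hev2
  have he' : (0:ℝ) < e := he
  have hm0 : 0 < min e d := lt_min he' hd.1
  have hsT : Ioo 0 (min e d) ⊆ Ioo 0 T := Ioo_subset_Ioo_right ((min_le_right _ _).trans hd.2.le)
  refine ⟨min e d, ⟨hm0, (min_le_right _ _).trans_lt hd.2⟩, ?_⟩
  refine Integrable.mono' ((hw.mono_set (Ioo_subset_Ioo_right (min_le_right e d))).const_mul c⁻¹) ((sol_flux_aesm hs).mono_set hsT) ?_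
  filter_upwards [ae_restrict_mem measurableSet_Ioo] with s hss
  have h1 := (hsub ⟨hss.1, hss.2.trans_le (min_le_left _ _)⟩).1
  have hl := sol_flux_nonneg hs (hsT hss)
  rw [Real.norm_eq_abs, abs_of_nonneg hl, inv_mul_eq_div, le_div_iff₀ hc]
  nlinarith

lemma flux_int0 (ha : 0 < a) (hT : 0 < T) (hI : IsInitialDatum fI pI a₀ lamI) (hs : IsSolutionP a fI (Ioo 0 T) f p)
    {t : ℝ} (ht : t < T) : IntegrableOn (flux f p) (Ioo 0 t) := by
  obtain ⟨d, hd, h1⟩ := near_zero_flux ha hT hI hs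
  have h2 := sol_flux_int hs (half_pos hd.1) ht
  refine (h1.union h2).mono_set fun s hss => ?_
  rcases lt_or_ge s d with h | h
  · left; exact ⟨hss.1, h⟩
  · right; exact ⟨by linarith [hd.1], hss.2.le⟩

end sol4


lemma dom3_measurable : MeasurableSet dom3 := by
  unfold dom3
  exact ((measurable_fst measurableSet_Icc).inter (((measurable_fst.comp measurable_snd) measurableSet_Icc).inter
    ((measurable_snd.comp measurable_snd) measurableSet_Ioi)))

lemma ind_measurable {k : ℝ × ℝ × ℝ → ℝ} (hk : ContinuousOn k dom3) : Measurable (dom3.indicator k) := by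
  classical
  rw [← piecewise_eq_indicator]
  exact hk.measurable_piecewise continuousOn_const dom3_measurable

/-- abstract data for kernel integrals -/
structure KData (μ : Measure ℝ) (Y r g : ℝ → ℝ) (x₀ t₀ c δ : ℝ) : Prop where
  Ym : AEMeasurable Y μ
  rm : AEMeasurable r μ
  gi : Integrable g μ
  Yi : ∀ᵐ w ∂μ, Y w ∈ Icc (-1:ℝ) 1
  r0 : ∀ᵐ w ∂μ, 0 ≤ r w
  rne : ∀ᵐ w ∂μ, r w ≠ t₀
  t0 : 0 < t₀
  c0 : 0 < c
  d0 : 0 < δ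
  dsub : Ioo (x₀ - δ) (x₀ + δ) ⊆ Ioo (-1) 1
  gap : ∀ᵐ w ∂μ, ∀ x ∈ Ioo (x₀ - δ) (x₀ + δ), ∀ t ∈ Ioo (t₀ - δ) (t₀ + δ), r w < t → c ≤ (x - Y w) ^ 2 + (t - r w)

noncomputable def KI (k : ℝ × ℝ × ℝ → ℝ) (μ : Measure ℝ) (Y r g : ℝ → ℝ) (x t : ℝ) : ℝ :=
  ∫ w, dom3.indicator k (x, Y w, t - r w) * g w ∂μ

noncomputable def gam0 : ℝ × ℝ × ℝ → ℝ := fun w => heatGamma w.1 w.2.1 w.2.2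
noncomputable def gam1 : ℝ × ℝ × ℝ → ℝ := fun w => gamma1 w.1 w.2.1 w.2.2

section kd
variable {μ : Measure ℝ} {Y r g : ℝ → ℝ} {x₀ t₀ c δ : ℝ}

lemma KData.meas (h : KData μ Y r g x₀ t₀ c δ) {k : ℝ × ℝ × ℝ → ℝ} (hk : ContinuousOn k dom3) (x t : ℝ) :
    AEStronglyMeasurable (fun w => dom3.indicator k (x, Y w, t - r w) * g w) μ := by
  refine AEStronglyMeasurable.mul ?_ h.gi.aestronglyMeasurable
  exact ((ind_measurable hk).comp_aemeasurable (aemeasurable_const.prodMk (h.Ym.prodMk (aemeasurable_const.sub h.rm)))).aestronglyMeasurable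

lemma KData.bound (h : KData μ Y r g x₀ t₀ c δ) : ∃ C, 0 ≤ C ∧
    ∀ᵐ w ∂μ, ∀ x ∈ Ioo (x₀ - δ) (x₀ + δ), ∀ t ∈ Ioo (t₀ - δ) (t₀ + δ),
      ‖dom3.indicator gam0 (x, Y w, t - r w) * g w‖ ≤ C * |g w| ∧ ‖dom3.indicator gam1 (x, Y w, t - r w) * g w‖ ≤ C * |g w| := by
  have h1 := h.t0
  have h2 := h.d0
  obtain ⟨C, hC0, hC⟩ := gamma_bound h.c0 (show 0 < t₀ + δ by linarith)
  refine ⟨C, hC0, ?_⟩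
  filter_upwards [h.Yi, h.r0, h.gap] with w hY hr hg x hx t ht
  rw [norm_mul, norm_mul, Real.norm_eq_abs, Real.norm_eq_abs, Real.norm_eq_abs]
  by_cases hd : (x, Y w, t - r w) ∈ dom3
  · rw [indicator_of_mem hd, indicator_of_mem hd]
    have h3 : 0 < t - r w := hd.2.2
    have := hC x hd.1 (Y w) hd.2.1 (t - r w) h3 (by linarith [ht.2]) (hg x hx t ht (by linarith))
    exact ⟨by gcongr; exact this.1, by gcongr; exact this.2⟩
  · rw [indicator_of_notMem hd, indicator_of_notMem hd]
    simp only [abs_zero, zero_mul, and_self]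
    positivity

lemma KData.contAt_ind (h : KData μ Y r g x₀ t₀ c δ) {k : ℝ × ℝ × ℝ → ℝ} (hk : ContinuousOn k dom3) :
    ∀ᵐ w ∂μ, ContinuousAt (fun q : ℝ × ℝ => dom3.indicator k (q.1, Y w, q.2 - r w) * g w) (x₀, t₀) := by
  have hx0 : x₀ ∈ Ioo (-1:ℝ) 1 := h.dsub ⟨by linarith [h.d0], by linarith [h.d0]⟩
  filter_upwards [h.Yi, h.rne] with w hY hr
  refine ContinuousAt.mul ?_ continuousAt_const
  have hmap : Continuous (fun q : ℝ × ℝ => (q.1, Y w, q.2 - r w)) := by fun_prop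
  rcases lt_or_gt_of_ne hr with hlt | hgt
  · have hev : ∀ᶠ q : ℝ × ℝ in 𝓝 (x₀, t₀), (q.1, Y w, q.2 - r w) ∈ dom3 := by
      have e1 : ∀ᶠ q : ℝ × ℝ in 𝓝 (x₀, t₀), q.1 ∈ Ioo (-1:ℝ) 1 :=
        (continuous_fst.tendsto (x₀, t₀)).eventually (isOpen_Ioo.mem_nhds hx0)
      have e2 : ∀ᶠ q : ℝ × ℝ in 𝓝 (x₀, t₀), r w < q.2 :=
        (continuous_snd.tendsto (x₀, t₀)).eventually (lt_mem_nhds hlt)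
      filter_upwards [e1, e2] with q h1 h2
      exact ⟨Ioo_subset_Icc_self h1, hY, by simpa using h2⟩
    have h1 : ContinuousWithinAt k dom3 (x₀, Y w, t₀ - r w) := hk _ hev.self_of_nhds
    have h2 : Tendsto (fun q : ℝ × ℝ => (q.1, Y w, q.2 - r w)) (𝓝 (x₀, t₀)) (𝓝[dom3] (x₀, Y w, t₀ - r w)) :=
      tendsto_nhdsWithin_of_tendsto_nhds_of_eventually_within _ (hmap.tendsto (x₀, t₀)) hev
    have h3 := h1.tendsto.comp h2
    have : ContinuousAt (fun q : ℝ × ℝ => k (q.1, Y w, q.2 - r w)) (x₀, t₀) := h3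
    refine this.congr ?_
    filter_upwards [hev] with q hq
    rw [indicator_of_mem hq]
  · have e2 : ∀ᶠ q : ℝ × ℝ in 𝓝 (x₀, t₀), q.2 < r w :=
        (continuous_snd.tendsto (x₀, t₀)).eventually (gt_mem_nhds hgt)
    have : ContinuousAt (fun q : ℝ × ℝ => (0:ℝ)) (x₀, t₀) := continuousAt_const
    refine this.congr ?_
    filter_upwards [e2] with q hq
    rw [indicator_of_notMem]
    intro hd
    have : 0 < q.2 - r w := hd.2.2
    linarith

lemma KData.nbhd (h : KData μ Y r g x₀ t₀ c δ) : ∀ᶠ q : ℝ × ℝ in 𝓝 (x₀, t₀), q.1 ∈ Ioo (x₀ - δ) (x₀ + δ) ∧ q.2 ∈ Ioo (t₀ - δ) (t₀ + δ) := by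
  have hd := h.d0
  have e1 : ∀ᶠ q : ℝ × ℝ in 𝓝 (x₀, t₀), q.1 ∈ Ioo (x₀ - δ) (x₀ + δ) :=
    (continuous_fst.tendsto (x₀, t₀)).eventually (Ioo_mem_nhds (by simp; linarith) (by simp; linarith))
  have e2 : ∀ᶠ q : ℝ × ℝ in 𝓝 (x₀, t₀), q.2 ∈ Ioo (t₀ - δ) (t₀ + δ) :=
    (continuous_snd.tendsto (x₀, t₀)).eventually (Ioo_mem_nhds (by simp; linarith) (by simp; linarith))
  exact e1.and e2

lemma KData.cont (h : KData μ Y r g x₀ t₀ c δ) :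
    ContinuousAt (fun q : ℝ × ℝ => KI gam0 μ Y r g q.1 q.2) (x₀, t₀) ∧ ContinuousAt (fun q : ℝ × ℝ => KI gam1 μ Y r g q.1 q.2) (x₀, t₀) := by
  obtain ⟨C, hC0, hC⟩ := h.bound
  constructor
  · refine continuousAt_of_dominated (bound := fun w => C * |g w|) (Eventually.of_forall fun q => h.meas gamma_continuousOn q.1 q.2) ?_ (h.gi.abs.const_mul C) (h.contAt_ind gamma_continuousOn)
    filter_upwards [h.nbhd] with q hq
    filter_upwards [hC] with w hw using (hw q.1 hq.1 q.2 hq.2).1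
  · refine continuousAt_of_dominated (bound := fun w => C * |g w|) (Eventually.of_forall fun q => h.meas gamma1_continuousOn q.1 q.2) ?_ (h.gi.abs.const_mul C) (h.contAt_ind gamma1_continuousOn)
    filter_upwards [h.nbhd] with q hq
    filter_upwards [hC] with w hw using (hw q.1 hq.1 q.2 hq.2).2

lemma KData.integrable (h : KData μ Y r g x₀ t₀ c δ) {x t : ℝ} (hx : x ∈ Ioo (x₀ - δ) (x₀ + δ)) (ht : t ∈ Ioo (t₀ - δ) (t₀ + δ)) :
    Integrable (fun w => dom3.indicator gam0 (x, Y w, t - r w) * g w) μ := by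
  obtain ⟨C, hC0, hC⟩ := h.bound
  refine Integrable.mono' (h.gi.abs.const_mul C) (h.meas gamma_continuousOn x t) ?_
  filter_upwards [hC] with w hw using (hw x hx t ht).1

lemma KData.deriv (h : KData μ Y r g x₀ t₀ c δ) {x t : ℝ} (hx : x ∈ Ioo (x₀ - δ) (x₀ + δ)) (ht : t ∈ Ioo (t₀ - δ) (t₀ + δ)) :
    HasDerivAt (fun x => KI gam0 μ Y r g x t) (KI gam1 μ Y r g x t) x := by
  obtain ⟨C, hC0, hC⟩ := h.bound
  refine (hasDerivAt_integral_of_dominated_loc_of_deriv_le (bound := fun w => C * |g w|) (isOpen_Ioo.mem_nhds hx)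
    (Eventually.of_forall fun q => h.meas gamma_continuousOn q t) (h.integrable hx ht) (F' := fun x w => dom3.indicator gam1 (x, Y w, t - r w) * g w)
    (h.meas gamma1_continuousOn x t) ?_ (h.gi.abs.const_mul C) ?_).2
  · filter_upwards [hC] with w hw y hy using (hw y hy t ht).2
  · filter_upwards [h.Yi] with w hY y hy
    refine HasDerivAt.mul_const ?_ (g w)
    have hy1 := h.dsub hy
    by_cases hr : 0 < t - r w
    · have e : ∀ᶠ z in 𝓝 y, (z, Y w, t - r w) ∈ dom3 := by
        filter_upwards [isOpen_Ioo.mem_nhds hy1] with z hz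
        exact ⟨Ioo_subset_Icc_self hz, hY, hr⟩
      rw [indicator_of_mem e.self_of_nhds]
      refine (gamma_hasDerivAt hy1 hY hr).congr_of_eventuallyEq ?_
      filter_upwards [e] with z hz
      rw [indicator_of_mem hz]
    · have e : ∀ z, (z, Y w, t - r w) ∉ dom3 := fun z hz => hr hz.2.2
      simp only [indicator_of_notMem (e _)]
      exact hasDerivAt_const _ _

end kd


section reg
variable {T a : ℝ} {fI : ℝ → ℝ} {f : ℝ → ℝ → ℝ} {p : ℝ → ℝ} {pI a₀ lamI : ℝ}

lemma kdata_G (hfI : ContinuousOn fI (Icc (-1) 1)) {x₀ t₀ : ℝ} (hx : x₀ ∈ Ioo (-1:ℝ) 1) (ht : 0 < t₀) :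
    ∃ δ₀ > 0, ∀ δ, 0 < δ → δ ≤ δ₀ → KData (volume.restrict (Ioc (-1) 1)) id (fun _ => 0) fI x₀ t₀ (t₀ / 2) δ := by
  refine ⟨min (t₀ / 2) (min (x₀ + 1) (1 - x₀)), by have := hx.1; have := hx.2; simp; exact ⟨ht, by linarith, by linarith⟩, fun δ hδ hδ0 => ?_⟩
  simp only [le_min_iff] at hδ0
  refine ⟨aemeasurable_id, aemeasurable_const, ?_, ?_, ?_, ?_, ht, half_pos ht, hδ, ?_, ?_⟩
  · exact (hfI.integrableOn_Icc).mono_set Ioc_subset_Icc_self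
  · filter_upwards [ae_restrict_mem measurableSet_Ioc] with w hw using Ioc_subset_Icc_self hw
  · exact Eventually.of_forall fun _ => le_rfl
  · exact Eventually.of_forall fun _ => ht.ne
  · exact Ioo_subset_Ioo (by linarith) (by linarith)
  · refine Eventually.of_forall fun w x hx t ht h => ?_
    have := sq_nonneg (x - id w)
    have := ht.1
    linarith

lemma kdata_Y (Y : ℝ → ℝ) {g : ℝ → ℝ} {x₀ t₀ t1 : ℝ} (hx : x₀ ∈ Ioo (-1:ℝ) 1) (ht : 0 < t₀) (ht1 : t₀ < t1)
    (hYc : ContinuousOn Y (Ioo 0 t1)) (hYi : ∀ s ∈ Ioo 0 t1, Y s ∈ Icc (-1:ℝ) 1) (hne : Y t₀ ≠ x₀) (hg : IntegrableOn g (Ioo 0 t1)) :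
    ∃ c > 0, ∃ δ₀ > 0, ∀ δ, 0 < δ → δ ≤ δ₀ → KData (volume.restrict (Ioo 0 t1)) Y id g x₀ t₀ c δ := by
  set d := |Y t₀ - x₀| with hd
  have hd0 : 0 < d := abs_pos.2 (sub_ne_zero.2 hne)
  have hca : ContinuousAt Y t₀ := hYc.continuousAt (Ioo_mem_nhds ht ht1)
  obtain ⟨e, he, hY⟩ := Metric.continuousAt_iff.1 hca (d/4) (by positivity)
  refine ⟨min ((d/2)^2) (e/2), by positivity, min (min (e/2) (d/4)) (min (x₀ + 1) (1 - x₀)), by have := hx.1; have := hx.2; simp; exact ⟨⟨he, hd0⟩, by linarith, by linarith⟩, fun δ hδ hδ0 => ?_⟩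
  simp only [le_min_iff] at hδ0
  refine ⟨hYc.aemeasurable measurableSet_Ioo, aemeasurable_id, hg, ?_, ?_, ?_, ht, by positivity, hδ, ?_, ?_⟩
  · filter_upwards [ae_restrict_mem measurableSet_Ioo] with w hw using hYi w hw
  · filter_upwards [ae_restrict_mem measurableSet_Ioo] with w hw using hw.1.le
  · have : ∀ᵐ w : ℝ, w ≠ t₀ := by simp [ae_iff]
    exact ae_restrict_of_ae this
  · exact Ioo_subset_Ioo (by linarith) (by linarith)
  · filter_upwards [ae_restrict_mem measurableSet_Ioo] with w hw x hx t ht h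
    simp only [id] at h ⊢
    by_cases hwe : |w - t₀| < e
    · have h1 := hY (x := w) (by rwa [Real.dist_eq])
      rw [Real.dist_eq] at h1
      have h2 : |x - x₀| < d / 4 := by rw [abs_lt]; constructor <;> linarith [hx.1, hx.2]
      have h3 : d / 2 ≤ |x - Y w| := by
        have : Y t₀ - x₀ = (x - x₀) - (Y w - Y t₀) - (x - Y w) := by ring
        have h4 : d ≤ |x - x₀| + |Y w - Y t₀| + |x - Y w| := by
          rw [hd, this]
          exact (abs_sub _ _).trans (add_le_add_left (abs_sub _ _) _)
        linarith
      have h5 : (d/2)^2 ≤ (x - Y w)^2 := by rw [← sq_abs (x - Y w)]; gcongr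
      exact (min_le_left _ _).trans (by linarith)
    · push Not at hwe
      have := sq_nonneg (x - Y w)
      refine (min_le_right _ _).trans ?_
      rcases le_abs'.1 hwe with h6 | h6
      · linarith [ht.1]
      · linarith [ht.2]

lemma sol_reg (ha : 0 < a) (hI : IsInitialDatum fI pI a₀ lamI) (hs : IsSolutionP a fI (Ioo 0 T) f p) {t₀ : ℝ} (ht : t₀ ∈ Ioo 0 T) :
    ∃ fx : ℝ → ℝ → ℝ, ContinuousAt (fun q : ℝ × ℝ => fx q.1 q.2) (p t₀, t₀) ∧ ContinuousAt (fun q : ℝ × ℝ => f q.1 q.2) (p t₀, t₀) ∧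
    ∃ δ > 0, ∀ x ∈ Ioo (p t₀ - δ) (p t₀ + δ), ∀ t ∈ Ioo (t₀ - δ) (t₀ + δ), x ∈ Icc (-1:ℝ) 1 ∧ t ∈ Ioo 0 T ∧ HasDerivAt (fun x => f x t) (fx x t) x := by
  have hT : 0 < T := ht.1.trans ht.2
  have hp := hs.p_mem t₀ ht
  obtain ⟨t1, ht1, ht1T⟩ := exists_between ht.2
  have hsub : Ioo 0 t1 ⊆ Ioo 0 T := Ioo_subset_Ioo_right ht1T.le
  have hg := flux_int0 ha hT hI hs ht1T
  obtain ⟨δ0, hδ0, hG⟩ := kdata_G hI.smooth.continuousOn hp ht.1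
  obtain ⟨c1, hc1, δ1, hδ1, hL⟩ := kdata_Y (fun s => zl a (p s)) hp ht.1 ht1 (((zl_continuous a).comp_continuousOn hs.p_cont).mono hsub)
    (fun s hss => zl_mem ha (sol_p_mem hs (hsub hss))) (zl_lt ha hp).ne hg
  obtain ⟨c2, hc2, δ2, hδ2, hR⟩ := kdata_Y (fun s => zr a (p s)) hp ht.1 ht1 (((zr_continuous a).comp_continuousOn hs.p_cont).mono hsub)
    (fun s hss => zr_mem ha (sol_p_mem hs (hsub hss))) (lt_zr ha hp).ne' hg
  set δ := min (min δ0 (min δ1 δ2)) (min t₀ (t1 - t₀)) with hδd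
  have hδ : 0 < δ := by simp [hδd, hδ0, hδ1, hδ2, ht.1, ht1]
  have hδs : δ ≤ min (min δ0 (min δ1 δ2)) (min t₀ (t1 - t₀)) := le_rfl
  simp only [le_min_iff] at hδs
  replace hG := hG δ hδ hδs.1.1
  replace hL := hL δ hδ hδs.1.2.1
  replace hR := hR δ hδ hδs.1.2.2
  have htt : ∀ t ∈ Ioo (t₀ - δ) (t₀ + δ), t ∈ Ioo 0 t1 := fun t h => ⟨by linarith [h.1], by linarith [h.2]⟩
  have key : ∀ x ∈ Ioo (p t₀ - δ) (p t₀ + δ), ∀ t ∈ Ioo (t₀ - δ) (t₀ + δ), f x t =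
      KI gam0 (volume.restrict (Ioc (-1) 1)) id (fun _ => 0) fI x t + (KI gam0 (volume.restrict (Ioo 0 t1)) (fun s => zl a (p s)) id (flux f p) x t
        - KI gam0 (volume.restrict (Ioo 0 t1)) (fun s => zr a (p s)) id (flux f p) x t) := by
    intro x hx t htm
    have hx1 := Ioo_subset_Icc_self (hG.dsub hx)
    have ht' := htt t htm
    rw [sol_duhamel hs (hsub ht') hx1]
    congr 1
    · unfold GG KI
      rw [intervalIntegral.integral_of_le (by norm_num)]
      refine setIntegral_congr_fun measurableSet_Ioc fun w hw => ?_
      simp only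
      rw [indicator_of_mem (show (x, id w, t - 0) ∈ dom3 from ⟨hx1, Ioc_subset_Icc_self hw, by simpa using ht'.1⟩)]
      simp [gam0]
    · unfold KI
      rw [← integral_sub (hL.integrable hx htm) (hR.integrable hx htm), intervalIntegral.integral_of_le ht'.1.le, ← integral_Ioc_eq_integral_Ioo,
        ← integral_indicator measurableSet_Ioc, ← integral_indicator measurableSet_Ioc]
      refine integral_congr_ae ?_
      have hne : ∀ᵐ w : ℝ, w ≠ t := by simp [ae_iff]
      have hne1 : ∀ᵐ w : ℝ, w ≠ t1 := by simp [ae_iff]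
      filter_upwards [hne, hne1] with w hw hw1
      by_cases h1 : w ∈ Ioc 0 t1
      · have hm := sol_p_mem hs (hsub ⟨h1.1, lt_of_le_of_ne h1.2 hw1⟩)
        rw [indicator_of_mem h1]
        by_cases h2 : w < t
        · rw [indicator_of_mem (show w ∈ Ioc 0 t from ⟨h1.1, h2.le⟩), indicator_of_mem (show (x, zl a (p w), t - id w) ∈ dom3 from ⟨hx1, zl_mem ha hm, by simpa using h2⟩),
            indicator_of_mem (show (x, zr a (p w), t - id w) ∈ dom3 from ⟨hx1, zr_mem ha hm, by simpa using h2⟩)]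
          simp only [gam0, Dk, id]
          ring
        · rw [indicator_of_notMem (fun h => hw (le_antisymm h.2 (not_lt.1 h2))), indicator_of_notMem, indicator_of_notMem]
          · simp
          · intro h; have := h.2.2; simp at this; exact h2 this
          · intro h; have := h.2.2; simp at this; exact h2 this
      · rw [indicator_of_notMem h1, indicator_of_notMem]
        exact fun h => h1 ⟨h.1, h.2.trans ht'.2.le⟩
  refine ⟨fun x t => KI gam1 (volume.restrict (Ioc (-1) 1)) id (fun _ => 0) fI x t + (KI gam1 (volume.restrict (Ioo 0 t1)) (fun s => zl a (p s)) id (flux f p) x t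
        - KI gam1 (volume.restrict (Ioo 0 t1)) (fun s => zr a (p s)) id (flux f p) x t), hG.cont.2.add (hL.cont.2.sub hR.cont.2), ?_, δ, hδ, ?_⟩
  · refine (hG.cont.1.add (hL.cont.1.sub hR.cont.1)).congr ?_
    filter_upwards [hG.nbhd] with q hq
    exact (key q.1 hq.1 q.2 hq.2).symm
  · intro x hx t htm
    refine ⟨Ioo_subset_Icc_self (hG.dsub hx), hsub (htt t htm), ?_⟩
    refine ((hG.deriv hx htm).add ((hL.deriv hx htm).sub (hR.deriv hx htm))).congr_of_eventuallyEq ?_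
    filter_upwards [isOpen_Ioo.mem_nhds hx] with y hy
    exact key y hy t htm

lemma sol_flux_contAt (ha : 0 < a) (hI : IsInitialDatum fI pI a₀ lamI) (hs : IsSolutionP a fI (Ioo 0 T) f p) {t₀ : ℝ} (ht : t₀ ∈ Ioo 0 T) :
    ContinuousAt (flux f p) t₀ := by
  obtain ⟨fx, h1, h2, δ, hδ, h3⟩ := sol_reg ha hI hs ht
  have hpc : ContinuousAt p t₀ := hs.p_cont.continuousAt (Ioo_mem_nhds ht.1 ht.2)
  have h4 : ContinuousAt (fun s => -fx (p s) s) t₀ :=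
    (ContinuousAt.comp (f := fun s => (p s, s)) (x := t₀) h1 (hpc.prodMk continuousAt_id)).neg
  refine h4.congr ?_
  have e1 : ∀ᶠ s in 𝓝 t₀, p s ∈ Ioo (p t₀ - δ) (p t₀ + δ) := hpc.eventually (Ioo_mem_nhds (by linarith) (by linarith))
  have e2 : ∀ᶠ s in 𝓝 t₀, s ∈ Ioo (t₀ - δ) (t₀ + δ) := Ioo_mem_nhds (by linarith) (by linarith)
  filter_upwards [e1, e2] with s q1 q2
  rw [flux, (h3 _ q1 _ q2).2.2.deriv]

end reg


noncomputable def Aff (f : ℝ → ℝ → ℝ) (Ψ : ℝ → ℝ) (s : ℝ) : ℝ := ∫ x in Ioc (-1:ℝ) 1, f x s * Ψ (kap x)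

noncomputable def LL (Ψ1 Ψ2 : ℝ → ℝ) (X : ℝ) : ℝ := Real.pi ^ 2 / 4 * ((1 - X ^ 2) * Ψ2 X - X * Ψ1 X)

structure T2 (Ψ Ψ1 Ψ2 : ℝ → ℝ) : Prop where
  d1 : ∀ x, HasDerivAt Ψ (Ψ1 x) x
  d2 : ∀ x, HasDerivAt Ψ1 (Ψ2 x) x
  c : Continuous Ψ2

lemma T2.c0 {Ψ Ψ1 Ψ2 : ℝ → ℝ} (h : T2 Ψ Ψ1 Ψ2) : Continuous Ψ := continuous_iff_continuousAt.2 fun x => (h.d1 x).continuousAt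
lemma T2.c1 {Ψ Ψ1 Ψ2 : ℝ → ℝ} (h : T2 Ψ Ψ1 Ψ2) : Continuous Ψ1 := continuous_iff_continuousAt.2 fun x => (h.d2 x).continuousAt
lemma LL_cont {Ψ1 Ψ2 : ℝ → ℝ} (h1 : Continuous Ψ1) (h2 : Continuous Ψ2) : Continuous (LL Ψ1 Ψ2) := by
  unfold LL; fun_prop

lemma poly_antideriv (Q : Polynomial ℝ) : ∃ P : Polynomial ℝ, Polynomial.derivative P = Q := by
  induction Q using Polynomial.induction_on' with
  | add p q hp hq =>
    obtain ⟨P, rfl⟩ := hp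
    obtain ⟨R, rfl⟩ := hq
    exact ⟨P + R, by simp⟩
  | monomial n c =>
    refine ⟨Polynomial.monomial (n+1) (c / (n+1)), ?_⟩
    rw [Polynomial.derivative_monomial]
    congr 1
    push_cast
    field_simp

lemma near_of_deriv {g h g' h' : ℝ → ℝ} {ε : ℝ} (hg : ∀ x, HasDerivAt g (g' x) x) (hh : ∀ x, HasDerivAt h (h' x) x)
    (h0 : g 0 = h 0) (hb : ∀ x ∈ Icc (-1:ℝ) 1, |g' x - h' x| ≤ ε) : ∀ x ∈ Icc (-1:ℝ) 1, |g x - h x| ≤ ε := by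
  intro x hx
  have hε : 0 ≤ ε := (abs_nonneg _).trans (hb x hx)
  have := (convex_Icc (-1:ℝ) 1).norm_image_sub_le_of_norm_hasDerivWithin_le (f := fun x => g x - h x) (f' := fun x => g' x - h' x) (C := ε)
    (fun y _ => ((hg y).sub (hh y)).hasDerivWithinAt) hb (show (0:ℝ) ∈ Icc (-1:ℝ) 1 by norm_num) hx
  simp only [h0, sub_self, sub_zero, Real.norm_eq_abs] at this
  have hx1 : |x| ≤ 1 := abs_le.2 hx
  nlinarith

lemma T2_approx {Ψ Ψ1 Ψ2 : ℝ → ℝ} (h : T2 Ψ Ψ1 Ψ2) {ε : ℝ} (hε : 0 < ε) : ∃ P : Polynomial ℝ, ∀ x ∈ Icc (-1:ℝ) 1,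
    |P.eval x - Ψ x| ≤ ε ∧ |(Polynomial.derivative P).eval x - Ψ1 x| ≤ ε ∧ |(Polynomial.derivative (Polynomial.derivative P)).eval x - Ψ2 x| ≤ ε := by
  obtain ⟨Q, hQ⟩ := exists_polynomial_near_of_continuousOn (-1) 1 Ψ2 h.c.continuousOn ε hε
  obtain ⟨R, rfl⟩ := poly_antideriv Q
  set R' := R + Polynomial.C (Ψ1 0 - R.eval 0) with hR'
  have hdR : Polynomial.derivative R' = Polynomial.derivative R := by simp [hR']
  obtain ⟨S, hS⟩ := poly_antideriv R'
  set S' := S + Polynomial.C (Ψ 0 - S.eval 0) with hS'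
  have hdS : Polynomial.derivative S' = R' := by simp [hS', hS]
  have h2 : ∀ x ∈ Icc (-1:ℝ) 1, |(Polynomial.derivative R').eval x - Ψ2 x| ≤ ε := by
    rw [hdR]; exact fun x hx => (hQ x hx).le
  have h1 : ∀ x ∈ Icc (-1:ℝ) 1, |R'.eval x - Ψ1 x| ≤ ε :=
    near_of_deriv (fun x => R'.hasDerivAt x) h.d2 (by simp [hR']) h2
  have h0 : ∀ x ∈ Icc (-1:ℝ) 1, |S'.eval x - Ψ x| ≤ ε :=
    near_of_deriv (fun x => S'.hasDerivAt x) h.d1 (by simp [hS']) (by rw [hdS]; exact h1)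
  exact ⟨S', fun x hx => ⟨h0 x hx, by rw [hdS]; exact h1 x hx, by rw [hdS]; exact h2 x hx⟩⟩

lemma LL_near {Ψ1 Ψ2 Φ1 Φ2 : ℝ → ℝ} {X ε : ℝ} (hX : X ∈ Icc (-1:ℝ) 1) (h1 : |Φ1 X - Ψ1 X| ≤ ε) (h2 : |Φ2 X - Ψ2 X| ≤ ε) :
    |LL Φ1 Φ2 X - LL Ψ1 Ψ2 X| ≤ Real.pi ^ 2 / 2 * ε := by
  have e : LL Φ1 Φ2 X - LL Ψ1 Ψ2 X = Real.pi ^ 2 / 4 * ((1 - X^2) * (Φ2 X - Ψ2 X) - X * (Φ1 X - Ψ1 X)) := by unfold LL; ring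
  rw [e, abs_mul, abs_of_nonneg (by positivity)]
  have h3 : |X| ≤ 1 := abs_le.2 hX
  have h4 : |1 - X^2| ≤ 1 := by rw [abs_le]; constructor <;> nlinarith [hX.1, hX.2]
  have h5 : |(1 - X^2) * (Φ2 X - Ψ2 X) - X * (Φ1 X - Ψ1 X)| ≤ 1 * ε + 1 * ε := by
    refine (abs_sub _ _).trans ?_
    rw [abs_mul, abs_mul]
    gcongr
  calc _ ≤ Real.pi ^ 2 / 4 * (1 * ε + 1 * ε) := by gcongr
    _ = _ := by ring

section s1
variable {T a : ℝ} {fI : ℝ → ℝ} {f : ℝ → ℝ → ℝ} {p : ℝ → ℝ} {pI a₀ lamI : ℝ}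

lemma wflux_int (ha : 0 < a) (hI : IsInitialDatum fI pI a₀ lamI) (hs : IsSolutionP a fI (Ioo 0 T) f p) {t : ℝ} (ht : t ∈ Ioo 0 T) :
    IntegrableOn (fun s => wP a (p s) * flux f p s) (Ioo 0 t) := by
  have h1 := flux_int0 ha (ht.1.trans ht.2) hI hs ht.2
  have hsub : Ioo 0 t ⊆ Ioo 0 T := Ioo_subset_Ioo_right ht.2.le
  refine Integrable.bdd_mul (c := 2) h1 (((wP_continuous a).comp_continuousOn (hs.p_cont.mono hsub)).aestronglyMeasurable measurableSet_Ioo) (Eventually.of_forall fun s => ?_)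
  have h2 := kap_abs (zl a (p s))
  have h3 := kap_abs (zr a (p s))
  rw [Real.norm_eq_abs]
  exact (abs_sub _ _).trans (by linarith)

lemma sol_f_int (ha : 0 < a) (hI : IsInitialDatum fI pI a₀ lamI) (hs : IsSolutionP a fI (Ioo 0 T) f p) {t : ℝ} (ht : t ∈ Ioo 0 T) :
    IntegrableOn (fun x => f x t) (Ioc (-1) 1) := (sol_moment ha hI.smooth.continuousOn hs ht (wflux_int ha hI hs ht)).1

lemma sol_L1 (ha : 0 < a) (hI : IsInitialDatum fI pI a₀ lamI) (hs : IsSolutionP a fI (Ioo 0 T) f p) {t1 : ℝ} (ht1 : t1 < T) :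
    ∃ C, 0 ≤ C ∧ ∀ t ∈ Ioo 0 t1, ∫ x in Ioc (-1:ℝ) 1, |f x t| ≤ C := by
  rcases le_or_gt T 0 with hT | hT
  · exact ⟨0, le_rfl, fun t ht => absurd (ht.1.trans (ht.2.trans ht1)) (not_lt.2 hT)⟩
  have hl := flux_int0 ha hT hI hs ht1
  have hfI := hI.smooth.continuousOn
  refine ⟨(∫ x in Ioc (-1:ℝ) 1, |fI x|) + ∫ s in Ioo 0 t1, 2 * |flux f p s|, by positivity, fun t ht => ?_⟩
  have htT : t ∈ Ioo 0 T := ⟨ht.1, ht.2.trans ht1⟩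
  have hsub : Ioo 0 t ⊆ Ioo 0 T := Ioo_subset_Ioo_right htT.2.le
  have hF := sol_fubini ha hs htT (wflux_int ha hI hs htT)
  have hG := GG_prod_int hfI htT.1
  have hc : ∀ y {τ : ℝ}, 0 < τ → IntegrableOn (fun x => heatGamma x y τ) (Ioc (-1) 1) := fun y τ hτ =>
    ((gamma_continuous_left y hτ).continuousOn.integrableOn_compact isCompact_Icc).mono_set Ioc_subset_Icc_self
  have h1 : ∀ y {τ : ℝ}, 0 < τ → ∫ x in Ioc (-1:ℝ) 1, heatGamma x y τ = 1 := by
    intro y τ hτ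
    rw [← intervalIntegral.integral_of_le (by norm_num), gamma_integral_one y hτ]
  have hle : ∀ x ∈ Ioc (-1:ℝ) 1, |f x t| ≤ (∫ y in Ioc (-1:ℝ) 1, ‖heatGamma x y t * fI y‖) + ∫ s in Ioo 0 t, ‖Dk a p x t s * flux f p s‖ := by
    intro x hx
    rw [sol_duhamel hs htT (Ioc_subset_Icc_self hx), intervalIntegral.integral_of_le ht.1.le, integral_Ioc_eq_integral_Ioo]
    refine (abs_add_le _ _).trans (add_le_add ?_ (by rw [← Real.norm_eq_abs]; exact norm_integral_le_integral_norm _))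
    rw [← Real.norm_eq_abs]
    unfold GG
    rw [intervalIntegral.integral_of_le (by norm_num)]
    exact norm_integral_le_integral_norm _
  have hA := hG.norm.integral_prod_left
  have hB := hF.norm.integral_prod_right
  refine (setIntegral_mono_on (sol_f_int ha hI hs htT).abs (hA.add hB) measurableSet_Ioc hle).trans ?_
  simp only [Pi.add_apply]
  rw [integral_add hA hB]
  refine add_le_add (le_of_eq ?_) ?_
  · rw [integral_integral_swap (f := fun x y => ‖heatGamma x y t * fI y‖) hG.norm]
    congr 1; funext y
    simp_rw [norm_mul, Real.norm_eq_abs, abs_of_nonneg (heatGamma_nonneg _ _ _)]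
    rw [integral_mul_const, h1 y ht.1, one_mul]
  · rw [← integral_integral_swap (f := fun s x => ‖Dk a p x t s * flux f p s‖) hF.norm]
    have hI2 : IntegrableOn (fun s => 2 * |flux f p s|) (Ioo 0 t1) := hl.abs.const_mul 2
    refine le_trans (setIntegral_mono_on (g := fun s => 2 * |flux f p s|) hF.norm.integral_prod_left (hI2.mono_set (Ioo_subset_Ioo_right ht.2.le)) measurableSet_Ioo ?_) (setIntegral_mono_set hI2 (Eventually.of_forall fun s => by positivity) (Eventually.of_forall (Ioo_subset_Ioo_right ht.2.le)))
    intro s hss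
    have hts : 0 < t - s := by linarith [hss.2]
    simp_rw [norm_mul, Real.norm_eq_abs]
    rw [integral_mul_const]
    gcongr
    have : ∀ x, |Dk a p x t s| ≤ heatGamma x (zl a (p s)) (t - s) + heatGamma x (zr a (p s)) (t - s) := by
      intro x
      refine (abs_sub _ _).trans ?_
      rw [abs_of_nonneg (heatGamma_nonneg _ _ _), abs_of_nonneg (heatGamma_nonneg _ _ _)]
    have hDi : IntegrableOn (fun x => Dk a p x t s) (Ioc (-1) 1) := (hc _ hts).sub (hc _ hts)
    calc ∫ x in Ioc (-1:ℝ) 1, |Dk a p x t s| ≤ ∫ x in Ioc (-1:ℝ) 1, (heatGamma x (zl a (p s)) (t - s) + heatGamma x (zr a (p s)) (t - s)) :=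
          integral_mono hDi.abs ((hc _ hts).add (hc _ hts)) this
      _ = 2 := by rw [integral_add (hc _ hts) (hc _ hts), h1 _ hts, h1 _ hts]; norm_num

lemma Aff_int {s : ℝ} {Ψ : ℝ → ℝ} (hf : IntegrableOn (fun x => f x s) (Ioc (-1) 1)) (hΨ : Continuous Ψ) :
    IntegrableOn (fun x => f x s * Ψ (kap x)) (Ioc (-1) 1) :=
  int_mul_poly hf (hΨ.comp kap_continuous).continuousOn

lemma Aff_near {s ε : ℝ} {Ψ Φ : ℝ → ℝ} (hf : IntegrableOn (fun x => f x s) (Ioc (-1) 1)) (hΨ : Continuous Ψ) (hΦ : Continuous Φ)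
    (h : ∀ X ∈ Icc (-1:ℝ) 1, |Φ X - Ψ X| ≤ ε) : |Aff f Φ s - Aff f Ψ s| ≤ ε * ∫ x in Ioc (-1:ℝ) 1, |f x s| := by
  unfold Aff
  rw [← integral_sub (Aff_int hf hΦ) (Aff_int hf hΨ), ← integral_const_mul]
  rw [← Real.norm_eq_abs]
  refine (norm_integral_le_integral_norm _).trans ?_
  refine integral_mono ((Aff_int hf hΦ).sub (Aff_int hf hΨ)).norm (hf.abs.const_mul ε) fun x => ?_
  simp only [Real.norm_eq_abs]
  rw [← mul_sub, abs_mul, mul_comm]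
  gcongr
  exact h _ (abs_le.1 (kap_abs x))

lemma Aff_poly (ha : 0 < a) (hI : IsInitialDatum fI pI a₀ lamI) (hs : IsSolutionP a fI (Ioo 0 T) f p) (P : Polynomial ℝ) {t : ℝ} (ht : t ∈ Ioo 0 T) :
    HasDerivAt (Aff f (fun X => P.eval X)) (Aff f (LL (fun X => (Polynomial.derivative P).eval X) (fun X => (Polynomial.derivative (Polynomial.derivative P)).eval X)) t
      + flux f p t * (P.eval (kap (zl a (p t))) - P.eval (kap (zr a (p t))))) t := by
  have hfi := sol_f_int ha hI hs ht
  induction P using poly_T_induction with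
  | h0 => exact ((hasDerivAt_const t (0:ℝ)).congr_of_eventuallyEq (Eventually.of_forall fun s => by simp [Aff])).congr_deriv (by simp [Aff, LL])
  | hadd P R hP hR =>
    have hev : ∀ᶠ s in 𝓝 t, s ∈ Ioo 0 T := Ioo_mem_nhds ht.1 ht.2
    refine ((hP.add hR).congr_of_eventuallyEq ?_).congr_deriv ?_
    · filter_upwards [hev] with s hs'
      have hfs := sol_f_int ha hI hs hs'
      simp only [Aff, Pi.add_apply]
      rw [← integral_add (Aff_int hfs P.continuous) (Aff_int hfs R.continuous)]
      congr 1; funext x; simp only [Polynomial.eval_add]; ring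
    · have : Aff f (LL (fun X => (Polynomial.derivative (P + R)).eval X) (fun X => (Polynomial.derivative (Polynomial.derivative (P+R))).eval X)) t
        = Aff f (LL (fun X => (Polynomial.derivative P).eval X) (fun X => (Polynomial.derivative (Polynomial.derivative P)).eval X)) t
         + Aff f (LL (fun X => (Polynomial.derivative R).eval X) (fun X => (Polynomial.derivative (Polynomial.derivative R)).eval X)) t := by
        simp only [Aff]
        rw [← integral_add (Aff_int hfi (LL_cont (Polynomial.continuous _) (Polynomial.continuous _))) (Aff_int hfi (LL_cont (Polynomial.continuous _) (Polynomial.continuous _)))]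
        congr 1; funext x; simp only [LL, Polynomial.derivative_add, Polynomial.eval_add]; ring
      rw [this]
      simp only [Polynomial.eval_add]
      ring
  | hsm c P hP =>
    refine ((hP.const_mul c).congr_of_eventuallyEq (Eventually.of_forall fun s => ?_)).congr_deriv ?_
    · simp only [Aff]
      rw [← integral_const_mul]
      congr 1; funext x; simp only [Polynomial.eval_smul, smul_eq_mul]; ring
    · have : Aff f (LL (fun X => (Polynomial.derivative (c • P)).eval X) (fun X => (Polynomial.derivative (Polynomial.derivative (c • P))).eval X)) t
        = c * Aff f (LL (fun X => (Polynomial.derivative P).eval X) (fun X => (Polynomial.derivative (Polynomial.derivative P)).eval X)) t := by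
        simp only [Aff]
        rw [← integral_const_mul]
        congr 1; funext x; simp only [LL, Polynomial.derivative_smul, Polynomial.eval_smul, smul_eq_mul]; ring
      rw [this]
      simp only [Polynomial.eval_smul, smul_eq_mul]
      ring
  | hT n =>
    set h : ℝ → ℝ := fun s => Real.exp (muN n * s) * (flux f p s * (cN n (zl a (p s)) - cN n (zr a (p s)))) with hh
    have hform : ∀ s ∈ Ioo 0 T, Aff f (fun X => (Polynomial.Chebyshev.T ℝ (n:ℤ)).eval X) s =
        Real.exp (-muN n * s) * ((∫ x in Ioc (-1:ℝ) 1, fI x * cN n x) + ∫ r in (0:ℝ)..s, h r) := by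
      intro s hss
      have := (sol_moment ha hI.smooth.continuousOn hs hss (wflux_int ha hI hs hss)).2 n
      unfold Aff
      simp_rw [← cN_eq_T]
      rw [this, mul_add]
      congr 1
      rw [intervalIntegral.integral_of_le hss.1.le, integral_Ioc_eq_integral_Ioo, ← integral_const_mul]
      congr 1; funext r
      rw [hh]
      simp only
      rw [← mul_assoc (Real.exp (-muN n * s)), ← Real.exp_add]
      congr 2; ring
    have hpc : ContinuousAt p t := hs.p_cont.continuousAt (Ioo_mem_nhds ht.1 ht.2)
    have hdc : ∀ {s}, ContinuousAt p s → ContinuousAt (fun s => cN n (zl a (p s)) - cN n (zr a (p s))) s := fun hp =>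
      ((((cN_continuous n).comp (zl_continuous a)).continuousAt).comp hp).sub ((((cN_continuous n).comp (zr_continuous a)).continuousAt).comp hp)
    have hcat : ∀ s ∈ Ioo 0 T, ContinuousAt h s := fun s hss =>
      ContinuousAt.mul (by fun_prop) ((sol_flux_contAt ha hI hs hss).mul (hdc (hs.p_cont.continuousAt (Ioo_mem_nhds hss.1 hss.2))))
    have hint : IntervalIntegrable h volume 0 t := by
      rw [intervalIntegrable_iff_integrableOn_Ioo_of_le ht.1.le]
      have h1 := flux_int0 ha (ht.1.trans ht.2) hI hs ht.2
      have hco : ContinuousOn h (Ioo 0 t) := fun s hss => (hcat s ⟨hss.1, hss.2.trans ht.2⟩).continuousWithinAt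
      refine Integrable.mono' (h1.abs.const_mul (Real.exp (muN n * t) * 2)) (hco.aestronglyMeasurable measurableSet_Ioo) ?_
      filter_upwards [ae_restrict_mem measurableSet_Ioo] with s hss
      rw [hh, Real.norm_eq_abs, abs_mul, abs_mul, abs_of_pos (Real.exp_pos _), mul_assoc, mul_comm 2]
      have hm := muN_nonneg n
      have q1 := cN_abs_le n (zl a (p s))
      have q2 := cN_abs_le n (zr a (p s))
      gcongr
      · exact hss.2.le
      · exact (abs_sub _ _).trans (by linarith)
    have hsm : StronglyMeasurableAtFilter h (𝓝 t) := by
      refine ⟨Ioo 0 T, Ioo_mem_nhds ht.1 ht.2, ?_⟩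
      exact ContinuousOn.aestronglyMeasurable (fun s hss => (hcat s hss).continuousWithinAt) measurableSet_Ioo
    have hd1 := intervalIntegral.integral_hasDerivAt_right hint hsm (hcat t ht)
    have hd2 : HasDerivAt (fun s => Real.exp (-muN n * s)) (Real.exp (-muN n * t) * (-muN n)) t := by
      have := ((hasDerivAt_id t).const_mul (-muN n)).exp
      simpa using this
    have hd := hd2.mul (hd1.const_add (∫ x in Ioc (-1:ℝ) 1, fI x * cN n x))
    have hev : ∀ᶠ s in 𝓝 t, s ∈ Ioo 0 T := Ioo_mem_nhds ht.1 ht.2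
    refine (hd.congr_of_eventuallyEq ?_).congr_deriv ?_
    · filter_upwards [hev] with s hss
      rw [hform s hss]; rfl
    · have hLT : Aff f (LL (fun X => (Polynomial.derivative (Polynomial.Chebyshev.T ℝ (n:ℤ))).eval X) (fun X => (Polynomial.derivative (Polynomial.derivative (Polynomial.Chebyshev.T ℝ (n:ℤ)))).eval X)) t
          = -muN n * Aff f (fun X => (Polynomial.Chebyshev.T ℝ (n:ℤ)).eval X) t := by
        unfold Aff
        rw [← integral_const_mul]
        congr 1; funext x
        have := Polynomial.Chebyshev.one_sub_X_sq_mul_iterate_derivative_T_eval (R := ℝ) (n:ℤ) 0 (kap x)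
        simp only [Function.iterate_succ, Function.iterate_zero, Function.comp_apply, id, zero_add] at this
        unfold LL
        rw [this]
        unfold muN
        push_cast
        ring
      rw [hLT, hform t ht, ← cN_eq_T, ← cN_eq_T, hh]
      simp only
      have : Real.exp (-muN n * t) * Real.exp (muN n * t) = 1 := by rw [← Real.exp_add]; simp
      linear_combination (flux f p t * (cN n (zl a (p t)) - cN n (zr a (p t)))) * this

lemma S1 (ha : 0 < a) (hI : IsInitialDatum fI pI a₀ lamI) (hs : IsSolutionP a fI (Ioo 0 T) f p) {Ψ Ψ1 Ψ2 : ℝ → ℝ} (h : T2 Ψ Ψ1 Ψ2) {t : ℝ} (ht : t ∈ Ioo 0 T) :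
    HasDerivAt (Aff f Ψ) (Aff f (LL Ψ1 Ψ2) t + flux f p t * (Ψ (kap (zl a (p t))) - Ψ (kap (zr a (p t))))) t := by
  obtain ⟨t1, ht1, ht1T⟩ := exists_between ht.2
  obtain ⟨C, hC0, hC⟩ := sol_L1 ha hI hs ht1T
  have hev : ∀ᶠ s in 𝓝 t, flux f p s < flux f p t + 1 ∧ s ∈ Ioo 0 t1 :=
    ((sol_flux_contAt ha hI hs ht).eventually (gt_mem_nhds (by linarith))).and (Ioo_mem_nhds ht.1 ht1)
  obtain ⟨U, hU, hUo, htU⟩ := eventually_nhds_iff.1 hev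
  choose P hP using fun k : ℕ => T2_approx h (ε := 1 / ((k:ℝ)+1)) (by positivity)
  have hsub : ∀ s ∈ U, s ∈ Ioo 0 T := fun s hsU => ⟨(hU s hsU).2.1, (hU s hsU).2.2.trans ht1T⟩
  refine hasDerivAt_of_tendstoUniformlyOn (l := atTop) (f := fun k => Aff f (fun X => (P k).eval X)) (g := Aff f Ψ)
    (f' := fun k s => (Aff f (LL (fun X => (Polynomial.derivative (P k)).eval X) (fun X => (Polynomial.derivative (Polynomial.derivative (P k))).eval X)) s
      + flux f p s * ((P k).eval (kap (zl a (p s))) - (P k).eval (kap (zr a (p s))))))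
    (g' := fun s => Aff f (LL Ψ1 Ψ2) s + flux f p s * (Ψ (kap (zl a (p s))) - Ψ (kap (zr a (p s))))) hUo ?_ ?_ ?_ htU
  · rw [Metric.tendstoUniformlyOn_iff]
    intro ε hε
    set K := Real.pi ^ 2 / 2 * C + (flux f p t + 1) * 2 with hK
    have hlim : Tendsto (fun k : ℕ => K * (1 / ((k:ℝ)+1))) atTop (𝓝 (K * 0)) := tendsto_one_div_add_atTop_nhds_zero_nat.const_mul K
    rw [mul_zero] at hlim
    filter_upwards [hlim.eventually (gt_mem_nhds hε)] with k hk s hsU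
    refine lt_of_le_of_lt ?_ hk
    have hss := hsub s hsU
    have hn := sol_flux_nonneg hs hss
    have hk0 : 0 < 1 / ((k:ℝ)+1) := by positivity
    have e1 := Aff_near (ε := Real.pi ^ 2 / 2 * (1 / ((k:ℝ)+1))) (sol_f_int ha hI hs hss) (LL_cont h.c1 h.c) (LL_cont (Polynomial.continuous (Polynomial.derivative (P k))) (Polynomial.continuous (Polynomial.derivative (Polynomial.derivative (P k)))))
      (fun X hX => LL_near hX (hP k X hX).2.1 (hP k X hX).2.2)
    have e2 := (hP k _ (abs_le.1 (kap_abs (zl a (p s))))).1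
    have e3 := (hP k _ (abs_le.1 (kap_abs (zr a (p s))))).1
    have e4 := hC s (hU s hsU).2
    have e5 := (hU s hsU).1.le
    rw [Real.dist_eq, abs_sub_comm]
    rw [abs_le] at e1 e2 e3
    have e6 : Real.pi ^ 2 / 2 * (1 / ((k:ℝ)+1)) * (∫ x in Ioc (-1:ℝ) 1, |f x s|) ≤ Real.pi ^ 2 / 2 * (1 / ((k:ℝ)+1)) * C := by gcongr
    have e7 : |flux f p s * (((P k).eval (kap (zl a (p s))) - (P k).eval (kap (zr a (p s)))) - (Ψ (kap (zl a (p s))) - Ψ (kap (zr a (p s)))))| ≤ (flux f p t + 1) * (2 * (1 / ((k:ℝ)+1))) := by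
      rw [abs_mul, abs_of_nonneg hn]
      refine mul_le_mul e5 ?_ (abs_nonneg _) (by linarith)
      rw [abs_le]; constructor <;> linarith [e2.1, e2.2, e3.1, e3.2]
    rw [abs_le] at e7 ⊢
    rw [mul_sub] at e7
    constructor <;> rw [hK] <;> linarith [e1.1, e1.2, e7.1, e7.2]
  · exact Eventually.of_forall fun k s hsU => Aff_poly ha hI hs (P k) (hsub s hsU)
  · intro s hsU
    have hss := hsub s hsU
    have hlim : Tendsto (fun k : ℕ => (1 / ((k:ℝ)+1)) * (∫ x in Ioc (-1:ℝ) 1, |f x s|)) atTop (𝓝 0) := by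
      simpa using tendsto_one_div_add_atTop_nhds_zero_nat.mul_const (∫ x in Ioc (-1:ℝ) 1, |f x s|)
    rw [tendsto_iff_norm_sub_tendsto_zero]
    refine squeeze_zero (fun k => norm_nonneg _) (fun k => ?_) hlim
    exact Aff_near (sol_f_int ha hI hs hss) h.c0 (Polynomial.continuous (P k)) (fun X hX => (hP k X hX).1)

end s1


noncomputable def kap1 (x : ℝ) : ℝ := -(Real.pi / 2) * Real.sin (Real.pi * (x + 1) / 2)

lemma kap_hasDeriv (x : ℝ) : HasDerivAt kap (kap1 x) x := by
  have h : HasDerivAt (fun x : ℝ => Real.pi * (x + 1) / 2) (Real.pi / 2) x := by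
    have := ((((hasDerivAt_id x).add_const 1).const_mul Real.pi).div_const 2)
    simpa using this
  refine h.cos.congr_deriv ?_
  unfold kap1; ring

lemma kap1_hasDeriv (x : ℝ) : HasDerivAt kap1 (-(Real.pi ^ 2 / 4) * kap x) x := by
  have h : HasDerivAt (fun x : ℝ => Real.pi * (x + 1) / 2) (Real.pi / 2) x := by
    have := ((((hasDerivAt_id x).add_const 1).const_mul Real.pi).div_const 2)
    simpa using this
  refine (h.sin.const_mul (-(Real.pi / 2))).congr_deriv ?_
  unfold kap; ring

lemma kap1_continuous : Continuous kap1 := by unfold kap1; fun_prop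

lemma kap1_sq (x : ℝ) : kap1 x ^ 2 = Real.pi ^ 2 / 4 * (1 - kap x ^ 2) := by
  unfold kap1 kap
  have := Real.sin_sq_add_cos_sq (Real.pi * (x + 1) / 2)
  linear_combination (Real.pi ^ 2 / 4) * this

lemma kap1_nonpos {x : ℝ} (hx : x ∈ Icc (-1:ℝ) 1) : kap1 x ≤ 0 := by
  unfold kap1
  have : 0 ≤ Real.sin (Real.pi * (x + 1) / 2) := by
    apply Real.sin_nonneg_of_nonneg_of_le_pi
    · have := hx.1; have := Real.pi_pos; apply div_nonneg (mul_nonneg _ _) <;> linarith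
    · have := hx.2; have := Real.pi_pos; nlinarith
  have := Real.pi_pos
  nlinarith

lemma deriv_zero_left {g : ℝ → ℝ} {g' k b x : ℝ} (h : ∀ y ≤ b, g y = k) (hx : x ≤ b) (hd : HasDerivAt g g' x) : g' = 0 := by
  have h1 : HasDerivWithinAt g 0 (Iic x) x :=
    (hasDerivWithinAt_const x (Iic x) k).congr (fun y hy => h y (le_trans hy hx)) (h x hx)
  exact (uniqueDiffWithinAt_Iic x).eq_deriv _ hd.hasDerivWithinAt h1

lemma deriv_zero_right {g : ℝ → ℝ} {g' k b x : ℝ} (h : ∀ y, b ≤ y → g y = k) (hx : b ≤ x) (hd : HasDerivAt g g' x) : g' = 0 := by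
  have h1 : HasDerivWithinAt g 0 (Ici x) x :=
    (hasDerivWithinAt_const x (Ici x) k).congr (fun y hy => h y (le_trans hx hy)) (h x hx)
  exact (uniqueDiffWithinAt_Ici x).eq_deriv _ hd.hasDerivWithinAt h1

structure Cut (A B : ℝ) (χ χ1 χ2 : ℝ → ℝ) : Prop where
  t2 : T2 χ χ1 χ2
  nn : ∀ X, 0 ≤ χ X
  le1 : ∀ X, χ X ≤ 1
  mono : ∀ X, 0 ≤ χ1 X
  lo : ∀ X ≤ A, χ X = 0 ∧ χ1 X = 0 ∧ χ2 X = 0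
  hi : ∀ X, B ≤ X → χ X = 1 ∧ χ1 X = 0 ∧ χ2 X = 0

lemma exists_cut {A B : ℝ} (h : A < B) : ∃ χ χ1 χ2, Cut A B χ χ1 χ2 := by
  have hBA : 0 < B - A := sub_pos.2 h
  set χ : ℝ → ℝ := fun X => Real.smoothTransition ((X - A) / (B - A)) with hχ
  have hc : ContDiff ℝ 2 χ := by
    have : ContDiff ℝ 2 Real.smoothTransition := Real.smoothTransition.contDiff (n := 2)
    exact this.comp (by fun_prop)
  have hd1 : ∀ x, HasDerivAt χ (deriv χ x) x := fun x => (hc.differentiable (by norm_num) x).hasDerivAt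
  have hc1 : ContDiff ℝ 1 (deriv χ) := by
    have : ContDiff ℝ (1 + 1) χ := by norm_num; exact hc
    exact (contDiff_succ_iff_deriv.1 this).2.2
  have hd2 : ∀ x, HasDerivAt (deriv χ) (deriv (deriv χ) x) x := fun x => (hc1.differentiable (by norm_num) x).hasDerivAt
  have hc2 : Continuous (deriv (deriv χ)) := hc1.continuous_deriv (by norm_num)
  have l0 : ∀ X ≤ A, χ X = 0 := fun X hX => Real.smoothTransition.zero_of_nonpos (div_nonpos_of_nonpos_of_nonneg (by linarith) hBA.le)
  have r0 : ∀ X, B ≤ X → χ X = 1 := fun X hX => Real.smoothTransition.one_of_one_le (by rw [le_div_iff₀ hBA]; linarith)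
  have l1 : ∀ X ≤ A, deriv χ X = 0 := fun X hX => deriv_zero_left l0 hX (hd1 X)
  have r1 : ∀ X, B ≤ X → deriv χ X = 0 := fun X hX => deriv_zero_right r0 hX (hd1 X)
  have hm : Monotone χ := fun x y hxy => Real.smoothTransition.monotone (by gcongr)
  exact ⟨χ, deriv χ, deriv (deriv χ), ⟨hd1, hd2, hc2⟩, fun X => Real.smoothTransition.nonneg _, fun X => Real.smoothTransition.le_one _,
    fun X => hm.deriv_nonneg, fun X hX => ⟨l0 X hX, l1 X hX, deriv_zero_left l1 hX (hd2 X)⟩, fun X hX => ⟨r0 X hX, r1 X hX, deriv_zero_right r1 hX (hd2 X)⟩⟩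

lemma T2.mul {Ψ Ψ1 Ψ2 χ χ1 χ2 : ℝ → ℝ} (h : T2 Ψ Ψ1 Ψ2) (g : T2 χ χ1 χ2) :
    T2 (fun X => Ψ X * χ X) (fun X => Ψ1 X * χ X + Ψ X * χ1 X) (fun X => Ψ2 X * χ X + 2 * (Ψ1 X * χ1 X) + Ψ X * χ2 X) := by
  refine ⟨fun x => (h.d1 x).mul (g.d1 x), fun x => (((h.d2 x).mul (g.d1 x)).add ((h.d1 x).mul (g.d2 x))).congr_deriv (by ring), ?_⟩
  have := h.c; have := h.c0; have := h.c1; have := g.c; have := g.c0; have := g.c1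
  fun_prop

noncomputable def EE (Ψ Ψ1 χ1 χ2 : ℝ → ℝ) (X : ℝ) : ℝ := Real.pi ^ 2 / 4 * ((1 - X ^ 2) * (2 * (Ψ1 X * χ1 X) + Ψ X * χ2 X) - X * (Ψ X * χ1 X))

lemma LL_mul {Ψ Ψ1 Ψ2 χ χ1 χ2 : ℝ → ℝ} (X : ℝ) :
    LL (fun X => Ψ1 X * χ X + Ψ X * χ1 X) (fun X => Ψ2 X * χ X + 2 * (Ψ1 X * χ1 X) + Ψ X * χ2 X) X = LL Ψ1 Ψ2 X * χ X + EE Ψ Ψ1 χ1 χ2 X := by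
  unfold LL EE; ring

lemma window {F F' Ψ Ψ1 Ψ2 χ χ1 χ2 : ℝ → ℝ} {c d η L K : ℝ} (hdc : d < c) (hd : -1 < d) (hc : c < 1)
    (hF : ∀ x ∈ Icc d c, HasDerivAt F (F' x) x) (hK : ∀ x ∈ Icc d c, |F' x| ≤ K)
    (hb : ∀ x ∈ Icc d c, |F x * (Ψ1 (kap x) * kap1 x) - F' x * Ψ (kap x) - L| ≤ η)
    (hΨ : T2 Ψ Ψ1 Ψ2) (hχ : Cut (kap c) (kap d) χ χ1 χ2) :
    |(∫ x in Ioc (-1:ℝ) 1, F x * EE Ψ Ψ1 χ1 χ2 (kap x)) + L| ≤ η := by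
  have hdm : d ∈ Icc (-1:ℝ) 1 := ⟨hd.le, by linarith⟩
  have hcm : c ∈ Icc (-1:ℝ) 1 := ⟨by linarith, hc.le⟩
  have hFc : ContinuousOn F (Icc d c) := fun x hx => (hF x hx).continuousAt.continuousWithinAt
  have kc := kap_continuous
  have k1c := kap1_continuous
  have p0 := hΨ.c0; have p1 := hΨ.c1; have p2 := hΨ.c
  have c0 := hχ.t2.c0; have c1 := hχ.t2.c1; have c2 := hχ.t2.c
  set ξ1 : ℝ → ℝ := fun x => χ1 (kap x) * kap1 x with hξ1
  have hξ1c : Continuous ξ1 := by rw [hξ1]; fun_prop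
  set ξ2 : ℝ → ℝ := fun x => χ2 (kap x) * kap1 x ^ 2 - χ1 (kap x) * (Real.pi ^ 2 / 4 * kap x) with hξ2
  have hξd : ∀ x, HasDerivAt (fun x => χ (kap x)) (ξ1 x) x := fun x => (hχ.t2.d1 (kap x)).comp x (kap_hasDeriv x)
  have hξ1d : ∀ x, HasDerivAt ξ1 (ξ2 x) x := fun x =>
    ((((hχ.t2.d2 (kap x)).comp x (kap_hasDeriv x)).mul (kap1_hasDeriv x))).congr_deriv (by simp only [hξ2, Function.comp]; ring)
  have hφd : ∀ x, HasDerivAt (fun x => Ψ (kap x)) (Ψ1 (kap x) * kap1 x) x := fun x => (hΨ.d1 (kap x)).comp x (kap_hasDeriv x)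
  have hsup : ∀ x ∈ Ioc (-1:ℝ) 1 \ Ioc d c, F x * EE Ψ Ψ1 χ1 χ2 (kap x) = 0 := by
    intro x hx
    have hz : χ1 (kap x) = 0 ∧ χ2 (kap x) = 0 := by
      by_cases h1 : x ≤ d
      · exact (hχ.hi _ ((kap_strictAnti.le_iff_ge hdm (Ioc_subset_Icc_self hx.1)).2 h1)).2
      · have h2 : c ≤ x := by
          by_contra h3
          exact hx.2 ⟨not_le.1 h1, (not_le.1 h3).le⟩
        exact (hχ.lo _ ((kap_strictAnti.le_iff_ge (Ioc_subset_Icc_self hx.1) hcm).2 h2)).2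
    simp [EE, hz.1, hz.2]
  have e1 : ∫ x in Ioc (-1:ℝ) 1, F x * EE Ψ Ψ1 χ1 χ2 (kap x) = ∫ x in d..c, F x * EE Ψ Ψ1 χ1 χ2 (kap x) := by
    rw [intervalIntegral.integral_of_le hdc.le]
    exact setIntegral_eq_of_subset_of_forall_sdiff_eq_zero measurableSet_Ioc (Ioc_subset_Ioc hd.le hc.le) hsup
  have hF'i : IntervalIntegrable F' volume d c := by
    rw [intervalIntegrable_iff_integrableOn_Icc_of_le hdc.le]
    refine Integrable.of_bound (C := K) ?_ ?_
    · refine ((measurable_deriv F).aestronglyMeasurable (μ := volume.restrict (Icc d c))).congr ?_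
      filter_upwards [ae_restrict_mem measurableSet_Icc] with x hx using (hF x hx).deriv
    · filter_upwards [ae_restrict_mem measurableSet_Icc] with x hx using hK x hx
  have huI : uIcc d c = Icc d c := uIcc_of_le hdc.le
  have hFi : ∀ {g : ℝ → ℝ}, Continuous g → IntervalIntegrable (fun x => F x * g x) volume d c := fun hg =>
    ContinuousOn.intervalIntegrable (by rw [huI]; exact hFc.mul hg.continuousOn)
  have hF'gi : ∀ {g : ℝ → ℝ}, Continuous g → IntervalIntegrable (fun x => F' x * g x) volume d c := fun hg =>
    hF'i.mul_continuousOn hg.continuousOn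
  have hξ2c : Continuous ξ2 := by rw [hξ2]; fun_prop
  have i1 : IntervalIntegrable (fun x => F' x * (Ψ (kap x) * ξ1 x)) volume d c := hF'gi (by fun_prop)
  have i2 : IntervalIntegrable (fun x => F x * (Ψ1 (kap x) * kap1 x * ξ1 x + Ψ (kap x) * ξ2 x)) volume d c := hFi (by fun_prop)
  have e2 : ∫ x in d..c, (F' x * (Ψ (kap x) * ξ1 x) + F x * (Ψ1 (kap x) * kap1 x * ξ1 x + Ψ (kap x) * ξ2 x)) = 0 := by
    rw [intervalIntegral.integral_eq_sub_of_hasDerivAt (f := fun x => F x * (Ψ (kap x) * ξ1 x)) (fun x hx => ?_) (i1.add i2)]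
    · have q1 : ξ1 c = 0 := by simp [hξ1, (hχ.lo _ le_rfl).2.1]
      have q2 : ξ1 d = 0 := by simp [hξ1, (hχ.hi _ le_rfl).2.1]
      simp [q1, q2]
    · rw [huI] at hx
      exact (hF x hx).mul ((hφd x).mul (hξ1d x))
  have e3 : ∫ x in d..c, ξ1 x = -1 := by
    rw [intervalIntegral.integral_eq_sub_of_hasDerivAt (fun x _ => hξd x) (hξ1c.intervalIntegrable _ _),
      (hχ.lo _ le_rfl).1, (hχ.hi _ le_rfl).1]
    norm_num
  have e4 : (∫ x in Ioc (-1:ℝ) 1, F x * EE Ψ Ψ1 χ1 χ2 (kap x)) + L = ∫ x in d..c, ξ1 x * (F x * (Ψ1 (kap x) * kap1 x) - F' x * Ψ (kap x) - L) := by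
    have i3 : IntervalIntegrable (fun x => F x * EE Ψ Ψ1 χ1 χ2 (kap x)) volume d c := hFi (by unfold EE; fun_prop)
    have i4 : IntervalIntegrable (fun x => ξ1 x * L) volume d c := (hξ1c.intervalIntegrable _ _).mul_const L
    have : L = -∫ x in d..c, ξ1 x * L := by rw [intervalIntegral.integral_mul_const, e3]; ring
    conv_lhs => rw [e1, this, ← sub_eq_add_neg, ← sub_zero (∫ x in d..c, F x * EE Ψ Ψ1 χ1 χ2 (kap x)), ← e2]
    rw [← intervalIntegral.integral_sub i3 (i1.add i2), ← intervalIntegral.integral_sub (i3.sub (i1.add i2)) i4]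
    congr 1; funext x
    have hE : EE Ψ Ψ1 χ1 χ2 (kap x) = 2 * (Ψ1 (kap x) * kap1 x * ξ1 x) + Ψ (kap x) * ξ2 x := by
      have := kap1_sq x
      simp only [EE, hξ1, hξ2]
      linear_combination (-2 * Ψ1 (kap x) * χ1 (kap x) - Ψ (kap x) * χ2 (kap x)) * this
    rw [hE]; ring
  rw [e4]
  have e5 := intervalIntegral.norm_integral_le_of_norm_le (f := fun x => ξ1 x * (F x * (Ψ1 (kap x) * kap1 x) - F' x * Ψ (kap x) - L)) (g := fun x => -ξ1 x * η) (μ := volume) hdc.le ?_ ((hξ1c.neg.mul continuous_const).intervalIntegrable _ _)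
  · rw [intervalIntegral.integral_mul_const, intervalIntegral.integral_neg, e3] at e5
    simpa using e5
  · refine Eventually.of_forall fun x hx => ?_
    have hx' := Ioc_subset_Icc_self hx
    have hneg : ξ1 x ≤ 0 := mul_nonpos_of_nonneg_of_nonpos (hχ.mono _) (kap1_nonpos ⟨by linarith [hx'.1], by linarith [hx'.2]⟩)
    rw [Real.norm_eq_abs, abs_mul, abs_of_nonpos hneg]
    exact mul_le_mul_of_nonneg_left (hb x hx') (by linarith)

/-- replacing the positive part by a cut-off -/
lemma cut_err {g θ Φ : ℝ → ℝ} {d c P η K : ℝ} (hg : IntegrableOn g (Ioc (-1:ℝ) 1)) (hθc : Continuous θ) (hΦ : Continuous Φ)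
    (hdc : d ≤ c) (hdP : d ≤ P) (hPc : P ≤ c) (hpos : ∀ x ∈ Ioc (-1:ℝ) 1, x ≤ P → 0 ≤ g x) (hneg : ∀ x ∈ Ioc (-1:ℝ) 1, P ≤ x → g x ≤ 0)
    (hη : 0 ≤ η) (hw : ∀ x ∈ Icc d c, |g x| ≤ η) (hθ0 : ∀ x, 0 ≤ θ x) (hθ1 : ∀ x, θ x ≤ 1) (hl : ∀ x ∈ Ioc (-1:ℝ) 1, x ≤ d → θ x = 1) (hr : ∀ x ∈ Ioc (-1:ℝ) 1, c ≤ x → θ x = 0)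
    (hK : ∀ X ∈ Icc (-1:ℝ) 1, |Φ X| ≤ K) :
    |(∫ x in Ioc (-1:ℝ) 1, max (g x) 0 * Φ (kap x)) - ∫ x in Ioc (-1:ℝ) 1, g x * (Φ (kap x) * θ x)| ≤ η * K * (c - d) := by
  have hK0 : 0 ≤ K := (abs_nonneg _).trans (hK 0 (by norm_num))
  have kc := kap_continuous
  have i1 : IntegrableOn (fun x => max (g x) 0 * Φ (kap x)) (Ioc (-1:ℝ) 1) := int_mul_poly (Integrable.pos_part hg) (by fun_prop)
  have i2 : IntegrableOn (fun x => g x * (Φ (kap x) * θ x)) (Ioc (-1:ℝ) 1) := int_mul_poly hg (by fun_prop)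
  rw [← integral_sub i1 i2, ← Real.norm_eq_abs]
  refine (norm_integral_le_integral_norm _).trans ?_
  have hi : IntegrableOn ((Icc d c).indicator fun _ => η * K) univ := by
    rw [integrableOn_univ, integrable_indicator_iff measurableSet_Icc]
    exact integrableOn_const (by simp)
  have hle : ∀ x ∈ Ioc (-1:ℝ) 1, ‖max (g x) 0 * Φ (kap x) - g x * (Φ (kap x) * θ x)‖ ≤ (Icc d c).indicator (fun _ => η * K) x := by
    intro x hx
    have e : max (g x) 0 * Φ (kap x) - g x * (Φ (kap x) * θ x) = (max (g x) 0 - g x * θ x) * Φ (kap x) := by ring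
    rw [e, Real.norm_eq_abs, abs_mul]
    by_cases hm : x ∈ Icc d c
    · rw [indicator_of_mem hm]
      refine mul_le_mul (le_trans ?_ (hw x hm)) (hK _ (abs_le.1 (kap_abs x))) (abs_nonneg _) hη
      rcases le_total 0 (g x) with h | h
      · rw [max_eq_left h, abs_of_nonneg h, abs_le]
        constructor <;> nlinarith [hθ0 x, hθ1 x]
      · rw [max_eq_right h, abs_of_nonpos h, abs_le]
        constructor <;> nlinarith [hθ0 x, hθ1 x]
    · rw [indicator_of_notMem hm]
      have : max (g x) 0 - g x * θ x = 0 := by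
        by_cases h1 : x ≤ d
        · rw [hl x hx h1, max_eq_left (hpos x hx (h1.trans hdP))]; ring
        · have h2 : c ≤ x := by
            by_contra h3
            exact hm ⟨(not_le.1 h1).le, (not_le.1 h3).le⟩
          rw [hr x hx h2, max_eq_right (hneg x hx (hPc.trans h2))]; ring
      simp [this]
  refine (setIntegral_mono_on (i1.sub i2).norm (hi.mono_set (subset_univ _)) measurableSet_Ioc hle).trans ?_
  refine (setIntegral_mono_set hi (Eventually.of_forall fun x => indicator_nonneg (fun _ _ => by positivity) x) (Eventually.of_forall (subset_univ _))).trans ?_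
  rw [Measure.restrict_univ, integral_indicator measurableSet_Icc, setIntegral_const]
  simp [hdc, mul_comm]


section
variable {T a : ℝ} {fI : ℝ → ℝ} {f : ℝ → ℝ → ℝ} {p : ℝ → ℝ} {pI a₀ lamI : ℝ}

lemma Aff_cont (ha : 0 < a) (hI : IsInitialDatum fI pI a₀ lamI) (hs : IsSolutionP a fI (Ioo 0 T) f p) {Φ : ℝ → ℝ} (h : Continuous Φ) {t : ℝ} (ht : t ∈ Ioo 0 T) :
    ContinuousAt (Aff f Φ) t := by
  obtain ⟨t1, ht1, ht1T⟩ := exists_between ht.2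
  obtain ⟨C, hC0, hC⟩ := sol_L1 ha hI hs ht1T
  rw [Metric.continuousAt_iff']
  intro ε hε
  set η := ε / (3 * (C + 1)) with hη
  have hη0 : 0 < η := by positivity
  have hηC : η * C < ε / 3 := by
    rw [hη, div_mul_eq_mul_div, div_lt_div_iff₀ (by positivity) (by positivity)]; nlinarith
  obtain ⟨P, hP⟩ := exists_polynomial_near_of_continuousOn (-1) 1 Φ h.continuousOn η hη0
  have hc := (Aff_poly ha hI hs P ht).continuousAt
  rw [Metric.continuousAt_iff'] at hc
  have key : ∀ s ∈ Ioo 0 t1, |Aff f (fun X => P.eval X) s - Aff f Φ s| < ε / 3 := fun s hss => by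
    have hsT : s ∈ Ioo 0 T := ⟨hss.1, hss.2.trans ht1T⟩
    refine lt_of_le_of_lt (Aff_near (sol_f_int ha hI hs hsT) h P.continuous (fun X hX => (hP X hX).le)) ?_
    refine lt_of_le_of_lt ?_ hηC
    gcongr; exact hC s hss
  filter_upwards [hc (ε / 3) (by positivity), Ioo_mem_nhds ht.1 ht1] with s h1 h2
  have k1 := key s h2
  have k2 := key t ⟨ht.1, ht1⟩
  rw [Real.dist_eq, abs_lt] at *
  constructor <;> linarith [k1.1, k1.2, k2.1, k2.2, h1.1, h1.2]

lemma loc_data (ha : 0 < a) (hI : IsInitialDatum fI pI a₀ lamI) (hs : IsSolutionP a fI (Ioo 0 T) f p) {Ψ Ψ1 Ψ2 : ℝ → ℝ} (h : T2 Ψ Ψ1 Ψ2)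
    {t : ℝ} (ht : t ∈ Ioo 0 T) {η : ℝ} (hη : 0 < η) :
    ∃ fx : ℝ → ℝ → ℝ, ∃ K, ∃ δ > 0, -1 < p t - δ ∧ p t + δ < 1 ∧ δ ≤ 1 ∧
     (∀ s ∈ Ioo (t - δ) (t + δ), s ∈ Ioo 0 T ∧ zl a (p s) ≤ p t - δ ∧ p t + δ ≤ zr a (p s) ∧
        |flux f p s * Ψ (kap (zl a (p s))) - flux f p t * Ψ (kap (zl a (p t)))| ≤ η ∧
      ∀ x ∈ Icc (p t - δ) (p t + δ), HasDerivAt (fun x => f x s) (fx x s) x ∧ |f x s| ≤ η ∧ |fx x s| ≤ K ∧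
        |f x s * (Ψ1 (kap x) * kap1 x) - fx x s * Ψ (kap x) - flux f p t * Ψ (kap (p t))| ≤ η) := by
  obtain ⟨fx, h1, h2, δ, hδ, h3⟩ := sol_reg ha hI hs ht
  have hpc : ContinuousAt p t := hs.p_cont.continuousAt (Ioo_mem_nhds ht.1 ht.2)
  have hp := hs.p_mem t ht
  have hfl := sol_flux_contAt ha hI hs ht
  have kc := kap_continuous
  have k1c := kap1_continuous
  have c0 := h.c0
  have c1 := h.c1
  have hfx : flux f p t = -fx (p t) t := by
    unfold flux
    rw [(h3 (p t) ⟨by linarith, by linarith⟩ t ⟨by linarith, by linarith⟩).2.2.deriv]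
  have hf0 := hs.zero_at t ht
  have hA : ∀ᶠ s in 𝓝 t, |flux f p s * Ψ (kap (zl a (p s))) - flux f p t * Ψ (kap (zl a (p t)))| < η := by
    have : ContinuousAt (fun s => flux f p s * Ψ (kap (zl a (p s)))) t :=
      hfl.mul ((c0.comp (kc.comp (zl_continuous a))).continuousAt.comp hpc)
    exact Metric.continuousAt_iff'.1 this η hη
  have hzl : ∀ᶠ s in 𝓝 t, zl a (p s) < (zl a (p t) + p t) / 2 :=
    ((zl_continuous a).continuousAt.comp hpc).eventually (gt_mem_nhds (by have := zl_lt ha hp; show zl a (p t) < _; linarith))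
  have hzr : ∀ᶠ s in 𝓝 t, (zr a (p t) + p t) / 2 < zr a (p s) :=
    ((zr_continuous a).continuousAt.comp hpc).eventually (lt_mem_nhds (by have := lt_zr ha hp; show _ < zr a (p t); linarith))
  have hB : ∀ᶠ q : ℝ × ℝ in 𝓝 (p t, t), |f q.1 q.2| < η := by
    have := Metric.continuousAt_iff'.1 h2 η hη
    simpa [hf0, Real.dist_eq] using this
  have hC : ∀ᶠ q : ℝ × ℝ in 𝓝 (p t, t), |fx q.1 q.2| < |fx (p t) t| + 1 :=
    h1.abs.eventually (gt_mem_nhds (by simp))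
  have hD : ∀ᶠ q : ℝ × ℝ in 𝓝 (p t, t), |f q.1 q.2 * (Ψ1 (kap q.1) * kap1 q.1) - fx q.1 q.2 * Ψ (kap q.1) - flux f p t * Ψ (kap (p t))| < η := by
    have : ContinuousAt (fun q : ℝ × ℝ => f q.1 q.2 * (Ψ1 (kap q.1) * kap1 q.1) - fx q.1 q.2 * Ψ (kap q.1)) (p t, t) :=
      (h2.mul (by fun_prop)).sub (h1.mul (by fun_prop))
    have := Metric.continuousAt_iff'.1 this η hη
    refine this.mono fun q hq => ?_
    rw [Real.dist_eq] at hq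
    simp only [hf0, zero_mul, zero_sub] at hq
    rw [hfx, neg_mul]; exact hq
  obtain ⟨δ1, hδ1, g1⟩ := Metric.eventually_nhds_iff.1 (hA.and (hzl.and hzr))
  obtain ⟨δ2, hδ2, g2⟩ := Metric.eventually_nhds_iff.1 (hB.and (hC.and hD))
  have q1 := zl_lt ha hp
  have q2 := lt_zr ha hp
  have q3 := hp.1
  have q4 := hp.2
  set m := min (min (min δ1 δ2) (min δ 1)) (min (min ((p t - zl a (p t)) / 2) ((zr a (p t) - p t) / 2)) (min (p t + 1) (1 - p t))) with hm
  have hm0 : 0 < m := by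
    simp only [hm, lt_min_iff]
    refine ⟨⟨⟨hδ1, hδ2⟩, hδ, one_pos⟩, ⟨by linarith, by linarith⟩, by linarith, by linarith⟩
  have hmm : m ≤ m := le_rfl
  conv_rhs at hmm => rw [hm]
  simp only [le_min_iff] at hmm
  obtain ⟨⟨⟨m1, m2⟩, m3, m4⟩, ⟨m5, m6⟩, m7, m8⟩ := hmm
  refine ⟨fx, |fx (p t) t| + 1, m / 2, by positivity, by linarith, by linarith, by linarith, fun s hss => ?_⟩
  have d1 : dist s t < m := by rw [Real.dist_eq, abs_lt]; constructor <;> linarith [hss.1, hss.2]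
  obtain ⟨e1, e2, e3⟩ := g1 (d1.trans_le m1)
  refine ⟨(h3 (p t) ⟨by linarith, by linarith⟩ s ⟨by linarith [hss.1], by linarith [hss.2]⟩).2.1, by linarith, by linarith, e1.le, fun x hx => ?_⟩
  have d2 : dist (x, s) (p t, t) < δ2 := by
    rw [Prod.dist_eq, max_lt_iff]
    refine ⟨?_, d1.trans_le m2⟩
    show dist x (p t) < δ2
    rw [Real.dist_eq, abs_lt]; constructor <;> linarith [hx.1, hx.2]
  obtain ⟨e4, e5, e6⟩ := g2 d2
  exact ⟨(h3 x ⟨by linarith [hx.1], by linarith [hx.2]⟩ s ⟨by linarith [hss.1], by linarith [hss.2]⟩).2.2, e4.le, e5.le, e6.le⟩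

lemma bdd_Icc {Φ : ℝ → ℝ} (h : Continuous Φ) : ∃ K, 0 ≤ K ∧ ∀ X ∈ Icc (-1:ℝ) 1, |Φ X| ≤ K := by
  obtain ⟨K, hK⟩ := isCompact_Icc.exists_bound_of_continuousOn (s := Icc (-1:ℝ) 1) h.continuousOn
  exact ⟨K, (norm_nonneg _).trans (hK 0 (by norm_num)), hK⟩

lemma Mp_core (ha : 0 < a) (hI : IsInitialDatum fI pI a₀ lamI) (hs : IsSolutionP a fI (Ioo 0 T) f p) {Ψ Ψ1 Ψ2 : ℝ → ℝ} (h : T2 Ψ Ψ1 Ψ2)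
    (hpos : ∀ X ∈ Icc (-1:ℝ) 1, 0 ≤ Ψ X) {t : ℝ} (ht : t ∈ Ioo 0 T) :
    ∃ C, 0 < C ∧ ∀ η > 0, ∃ δ > 0, ∀ t1 ∈ Ioo (t - δ) (t + δ), ∀ t2 ∈ Ioo (t - δ) (t + δ), t1 < t2 →
      |Aff (fun x s => max (f x s) 0) Ψ t2 - Aff (fun x s => max (f x s) 0) Ψ t1 - (Aff (fun x s => max (f x s) 0) (LL Ψ1 Ψ2) t + flux f p t * (Ψ (kap (zl a (p t))) - Ψ (kap (p t)))) * (t2 - t1)| ≤ C * η * (t2 - t1) := by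
  obtain ⟨K0, hK0, hK0'⟩ := bdd_Icc h.c0
  have hLc := LL_cont h.c1 h.c
  obtain ⟨K1, hK1, hK1'⟩ := bdd_Icc hLc
  set R := Aff (fun x s => max (f x s) 0) (LL Ψ1 Ψ2) t + flux f p t * (Ψ (kap (zl a (p t))) - Ψ (kap (p t))) with hR
  have kc := kap_continuous
  refine ⟨3 + 6 * K1 + K0, by positivity, fun η hη => ?_⟩
  obtain ⟨fx, K, δ0, hδ0, l1, l2, l3, hloc⟩ := loc_data ha hI hs h ht hη
  have memI : ∀ x ∈ Icc (p t - δ0) (p t + δ0), x ∈ Icc (-1:ℝ) 1 := fun x hx => ⟨by linarith [hx.1], by linarith [hx.2]⟩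
  have hpc : ContinuousAt p t := hs.p_cont.continuousAt (Ioo_mem_nhds ht.1 ht.2)
  -- wide window comparison
  have wide : ∀ s ∈ Ioo (t - δ0) (t + δ0), p s ∈ Icc (p t - δ0) (p t + δ0) → ∀ c d χ χ1 χ2, d ∈ Icc (p t - δ0) (p t + δ0) → c ∈ Icc (p t - δ0) (p t + δ0) → Cut (kap c) (kap d) χ χ1 χ2 →
      |Aff (fun x s => max (f x s) 0) (LL Ψ1 Ψ2) s - Aff f (fun X => LL Ψ1 Ψ2 X * χ X) s| ≤ η * K1 * 2 := by
    intro s hss hps c d χ χ1 χ2 hd hc hχ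
    have hsT := (hloc s hss).1
    have := cut_err (g := fun x => f x s) (θ := fun x => χ (kap x)) (Φ := LL Ψ1 Ψ2) (d := p t - δ0) (c := p t + δ0) (P := p s) (η := η) (K := K1)
      (sol_f_int ha hI hs hsT) (hχ.t2.c0.comp kc) hLc (by linarith) hps.1 hps.2
      (fun x hx hxp => by
        rcases hxp.eq_or_lt with rfl | hlt
        · exact (hs.zero_at s hsT).ge
        · exact (hs.pos_left s hsT x ⟨hx.1.le, hlt⟩).le)
      (fun x hx hxp => by
        rcases hxp.eq_or_lt with rfl | hlt
        · exact (hs.zero_at s hsT).le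
        · exact (hs.neg_right s hsT x ⟨hlt, hx.2⟩).le)
      hη.le (fun x hx => ((hloc s hss).2.2.2.2 x hx).2.1) (fun x => hχ.nn _) (fun x => hχ.le1 _)
      (fun x hx hxd => (hχ.hi _ ((kap_strictAnti.le_iff_ge (memI d hd) (Ioc_subset_Icc_self hx)).2 (hxd.trans hd.1))).1)
      (fun x hx hxc => (hχ.lo _ ((kap_strictAnti.le_iff_ge (Ioc_subset_Icc_self hx) (memI c hc)).2 (hc.2.trans hxc))).1) hK1'
    refine this.trans ?_
    have : 0 ≤ η * K1 := by positivity
    nlinarith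
  have htm : t ∈ Ioo (t - δ0) (t + δ0) := ⟨by linarith, by linarith⟩
  have hlm : p t - δ0 ∈ Icc (p t - δ0) (p t + δ0) := ⟨le_rfl, by linarith⟩
  have hrm : p t + δ0 ∈ Icc (p t - δ0) (p t + δ0) := ⟨by linarith, le_rfl⟩
  obtain ⟨χ0, χ01, χ02, hχ0⟩ := exists_cut (kap_strictAnti (memI _ hlm) (memI _ hrm) (by linarith))
  have hAc := Metric.continuousAt_iff'.1 (Aff_cont ha hI hs (hLc.mul hχ0.t2.c0) ht) η hη
  have hpe := Metric.continuousAt_iff'.1 hpc (δ0 / 2) (by positivity)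
  obtain ⟨δ1, hδ1, g1⟩ := Metric.eventually_nhds_iff.1 (hAc.and hpe)
  set δ := min δ1 (δ0 / 4) with hδ
  have hδ0' : 0 < δ := lt_min hδ1 (by positivity)
  have hδa : δ ≤ δ1 := min_le_left _ _
  have hδb : δ ≤ δ0 / 4 := min_le_right _ _
  have hclose : ∀ s ∈ Ioo (t - δ) (t + δ), s ∈ Ioo (t - δ0) (t + δ0) ∧ p s ∈ Ioo (p t - δ0 / 2) (p t + δ0 / 2) ∧ |Aff f (fun X => LL Ψ1 Ψ2 X * χ0 X) s - Aff f (fun X => LL Ψ1 Ψ2 X * χ0 X) t| < η := by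
    intro s hss
    obtain ⟨e1, e2⟩ := g1 (y := s) (by rw [Real.dist_eq, abs_lt]; constructor <;> linarith [hss.1, hss.2])
    rw [Real.dist_eq, abs_lt] at e2
    exact ⟨⟨by linarith [hss.1], by linarith [hss.2]⟩, ⟨by linarith, by linarith⟩, e1⟩
  -- derivative of the cut-off moment
  have Bder : ∀ s ∈ Ioo (t - δ) (t + δ), ∀ c d χ χ1 χ2, d < c → d ∈ Icc (p t - δ0) (p t + δ0) → c ∈ Icc (p t - δ0) (p t + δ0) → Cut (kap c) (kap d) χ χ1 χ2 →
      ∃ B', HasDerivAt (Aff f (fun X => Ψ X * χ X)) B' s ∧ |B' - R| ≤ (3 + 6 * K1) * η := by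
    intro s hss c d χ χ1 χ2 hdc hd hc hχ
    obtain ⟨s1, s2, s3⟩ := hclose s hss
    obtain ⟨b1, b2, b3, b4, b5⟩ := hloc s s1
    have hps : p s ∈ Icc (p t - δ0) (p t + δ0) := ⟨by linarith [s2.1], by linarith [s2.2]⟩
    refine ⟨_, S1 ha hI hs (h.mul hχ.t2) b1, ?_⟩
    have hpI := sol_p_mem hs b1
    have z1 : χ (kap (zl a (p s))) = 1 := (hχ.hi _ ((kap_strictAnti.le_iff_ge (memI d hd) (zl_mem ha hpI)).2 (b2.trans hd.1))).1
    have z2 : χ (kap (zr a (p s))) = 0 := (hχ.lo _ ((kap_strictAnti.le_iff_ge (zr_mem ha hpI) (memI c hc)).2 (hc.2.trans b3))).1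
    have hfi := sol_f_int ha hI hs b1
    have eA : Aff f (LL (fun X => Ψ1 X * χ X + Ψ X * χ1 X) (fun X => Ψ2 X * χ X + 2 * (Ψ1 X * χ1 X) + Ψ X * χ2 X)) s
        = Aff f (fun X => LL Ψ1 Ψ2 X * χ X) s + ∫ x in Ioc (-1:ℝ) 1, f x s * EE Ψ Ψ1 χ1 χ2 (kap x) := by
      have hE : Continuous (EE Ψ Ψ1 χ1 χ2) := by
        have := h.c0; have := h.c1; have := hχ.t2.c1; have := hχ.t2.c
        unfold EE; fun_prop
      unfold Aff
      rw [← integral_add (Aff_int (Ψ := fun X => LL Ψ1 Ψ2 X * χ X) hfi (hLc.mul hχ.t2.c0)) (Aff_int hfi hE)]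
      congr 1; funext x
      rw [LL_mul]; ring
    have sub : ∀ x ∈ Icc d c, x ∈ Icc (p t - δ0) (p t + δ0) := fun x hx => ⟨hd.1.trans hx.1, hx.2.trans hc.2⟩
    have eW := window (F := fun x => f x s) (F' := fun x => fx x s) (L := flux f p t * Ψ (kap (p t))) (η := η) (K := K) hdc (by linarith [hd.1]) (by linarith [hc.2])
      (fun x hx => (b5 x (sub x hx)).1) (fun x hx => (b5 x (sub x hx)).2.2.1) (fun x hx => (b5 x (sub x hx)).2.2.2) h hχ
    have w1 := wide s s1 hps c d χ χ1 χ2 hd hc hχ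
    have w2 := wide s s1 hps _ _ χ0 χ01 χ02 hlm hrm hχ0
    have w3 := wide t htm ⟨by linarith, by linarith⟩ _ _ χ0 χ01 χ02 hlm hrm hχ0
    rw [eA, z1, z2, hR]
    rw [abs_le] at *
    rw [abs_lt] at s3
    constructor <;> linarith [eW.1, eW.2, w1.1, w1.2, w2.1, w2.2, w3.1, w3.2, s3.1, s3.2, b4.1, b4.2]
  have Binc : ∀ t1 ∈ Ioo (t - δ) (t + δ), ∀ t2 ∈ Ioo (t - δ) (t + δ), t1 < t2 → ∀ c d χ χ1 χ2, d < c → d ∈ Icc (p t - δ0) (p t + δ0) → c ∈ Icc (p t - δ0) (p t + δ0) → Cut (kap c) (kap d) χ χ1 χ2 →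
      |Aff f (fun X => Ψ X * χ X) t2 - Aff f (fun X => Ψ X * χ X) t1 - R * (t2 - t1)| ≤ (3 + 6 * K1) * η * (t2 - t1) := by
    intro t1 h1 t2 h2 h12 c d χ χ1 χ2 hdc hd hc hχ
    have hsub : Icc t1 t2 ⊆ Ioo (t - δ) (t + δ) := fun s hss => ⟨h1.1.trans_le hss.1, hss.2.trans_lt h2.2⟩
    choose! B' hB' hBR using fun s (hss : s ∈ Ioo (t - δ) (t + δ)) => Bder s hss c d χ χ1 χ2 hdc hd hc hχ
    have := Convex.norm_image_sub_le_of_norm_hasDerivWithin_le (f := fun s => Aff f (fun X => Ψ X * χ X) s - R * s) (f' := fun s => B' s - R) (s := Icc t1 t2) (C := (3 + 6 * K1) * η)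
      (fun s hss => ((hB' s (hsub hss)).sub (((hasDerivAt_id s).const_mul R).congr_deriv (mul_one R))).hasDerivWithinAt) (fun s hss => hBR s (hsub hss)) (convex_Icc _ _) (left_mem_Icc.2 h12.le) (right_mem_Icc.2 h12.le)
    rw [Real.norm_eq_abs, Real.norm_eq_abs, abs_of_pos (sub_pos.2 h12)] at this
    convert! this using 2
    ring
  refine ⟨δ, hδ0', fun t1 h1 t2 h2 h12 => ?_⟩
  have hh : t2 - t1 < δ0 / 2 := by linarith [h1.1, h2.2]
  have hMf : ∀ s ∈ Ioo (t - δ) (t + δ), ∀ χ χ1 χ2 A B, Cut A B χ χ1 χ2 → Aff f (fun X => Ψ X * χ X) s ≤ Aff (fun x s => max (f x s) 0) Ψ s := by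
    intro s hss χ χ1 χ2 A B hχ
    have hfi := sol_f_int ha hI hs (hloc s (hclose s hss).1).1
    refine integral_mono (Aff_int hfi (h.c0.mul hχ.t2.c0)) (int_mul_poly (Integrable.pos_part hfi) (h.c0.comp kc).continuousOn) fun x => ?_
    show f x s * (Ψ (kap x) * χ (kap x)) ≤ max (f x s) 0 * Ψ (kap x)
    have u1 := hpos _ (kap_mem x)
    have u2 := hχ.nn (kap x)
    have u3 := hχ.le1 (kap x)
    rcases le_total 0 (f x s) with hf | hf
    · rw [max_eq_left hf]; exact mul_le_mul_of_nonneg_left (by nlinarith) hf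
    · rw [max_eq_right hf, zero_mul]; exact mul_nonpos_of_nonpos_of_nonneg hf (by positivity)
  have narrow : ∀ s ∈ Ioo (t - δ) (t + δ), ∀ χ χ1 χ2, Cut (kap (p s)) (kap (p s - (t2 - t1))) χ χ1 χ2 →
      |Aff (fun x s => max (f x s) 0) Ψ s - Aff f (fun X => Ψ X * χ X) s| ≤ η * K0 * (t2 - t1) := by
    intro s hss χ χ1 χ2 hχ
    obtain ⟨s1, s2, s3⟩ := hclose s hss
    have hsT := (hloc s s1).1
    have dm : p s - (t2 - t1) ∈ Icc (p t - δ0) (p t + δ0) := ⟨by linarith [s2.1], by linarith [s2.2]⟩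
    have cm : p s ∈ Icc (p t - δ0) (p t + δ0) := ⟨by linarith [s2.1], by linarith [s2.2]⟩
    have := cut_err (g := fun x => f x s) (θ := fun x => χ (kap x)) (Φ := Ψ) (d := p s - (t2 - t1)) (c := p s) (P := p s) (η := η) (K := K0)
      (sol_f_int ha hI hs hsT) (hχ.t2.c0.comp kc) h.c0 (by linarith) (by linarith) le_rfl
      (fun x hx hxp => by
        rcases hxp.eq_or_lt with rfl | hlt
        · exact (hs.zero_at s hsT).ge
        · exact (hs.pos_left s hsT x ⟨hx.1.le, hlt⟩).le)
      (fun x hx hxp => by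
        rcases hxp.eq_or_lt with rfl | hlt
        · exact (hs.zero_at s hsT).le
        · exact (hs.neg_right s hsT x ⟨hlt, hx.2⟩).le)
      hη.le (fun x hx => ((hloc s s1).2.2.2.2 x ⟨dm.1.trans hx.1, hx.2.trans cm.2⟩).2.1) (fun x => hχ.nn _) (fun x => hχ.le1 _)
      (fun x hx hxd => (hχ.hi _ ((kap_strictAnti.le_iff_ge (memI _ dm) (Ioc_subset_Icc_self hx)).2 hxd)).1)
      (fun x hx hxc => (hχ.lo _ ((kap_strictAnti.le_iff_ge (Ioc_subset_Icc_self hx) (memI _ cm)).2 hxc)).1) hK0'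
    refine this.trans (le_of_eq ?_)
    ring
  have cutAt : ∀ s ∈ Ioo (t - δ) (t + δ), ∃ χ χ1 χ2, Cut (kap (p s)) (kap (p s - (t2 - t1))) χ χ1 χ2 ∧
      |Aff f (fun X => Ψ X * χ X) t2 - Aff f (fun X => Ψ X * χ X) t1 - R * (t2 - t1)| ≤ (3 + 6 * K1) * η * (t2 - t1) := by
    intro s hss
    obtain ⟨s1, s2, s3⟩ := hclose s hss
    have dm : p s - (t2 - t1) ∈ Icc (p t - δ0) (p t + δ0) := ⟨by linarith [s2.1], by linarith [s2.2]⟩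
    have cm : p s ∈ Icc (p t - δ0) (p t + δ0) := ⟨by linarith [s2.1], by linarith [s2.2]⟩
    obtain ⟨χ, χ1, χ2, hχ⟩ := exists_cut (kap_strictAnti (memI _ dm) (memI _ cm) (by linarith))
    exact ⟨χ, χ1, χ2, hχ, Binc t1 h1 t2 h2 h12 _ _ χ χ1 χ2 (by linarith) dm cm hχ⟩
  obtain ⟨χ, χ1, χ2, hχ, e1⟩ := cutAt t1 h1
  obtain ⟨ρ, ρ1, ρ2, hρ, e2⟩ := cutAt t2 h2
  have e3 := narrow t1 h1 _ _ _ hχ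
  have e4 := narrow t2 h2 _ _ _ hρ
  have e5 := hMf t2 h2 _ _ _ _ _ hχ
  have e6 := hMf t1 h1 _ _ _ _ _ hρ
  rw [abs_le] at *
  constructor <;> linarith [e1.1, e1.2, e2.1, e2.2, e3.1, e3.2, e4.1, e4.2]


lemma T2.addc {Ψ Ψ1 Ψ2 : ℝ → ℝ} (h : T2 Ψ Ψ1 Ψ2) (K : ℝ) : T2 (fun X => Ψ X + K) Ψ1 Ψ2 :=
  ⟨fun x => (h.d1 x).add_const K, h.d2, h.c⟩

lemma T2.const (K : ℝ) : T2 (fun _ => K) (fun _ => 0) (fun _ => 0) :=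
  ⟨fun x => hasDerivAt_const x K, fun x => hasDerivAt_const x 0, continuous_const⟩

lemma Mp_der0 (ha : 0 < a) (hI : IsInitialDatum fI pI a₀ lamI) (hs : IsSolutionP a fI (Ioo 0 T) f p) {Ψ Ψ1 Ψ2 : ℝ → ℝ} (h : T2 Ψ Ψ1 Ψ2)
    (hpos : ∀ X ∈ Icc (-1:ℝ) 1, 0 ≤ Ψ X) {t : ℝ} (ht : t ∈ Ioo 0 T) :
    HasDerivAt (Aff (fun x s => max (f x s) 0) Ψ) (Aff (fun x s => max (f x s) 0) (LL Ψ1 Ψ2) t + flux f p t * (Ψ (kap (zl a (p t))) - Ψ (kap (p t)))) t := by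
  obtain ⟨C, hC, H⟩ := Mp_core ha hI hs h hpos ht
  rw [hasDerivAt_iff_isLittleO, Asymptotics.isLittleO_iff]
  intro c hc
  obtain ⟨δ, hδ, G⟩ := H (c / C) (by positivity)
  have e : C * (c / C) = c := by field_simp
  rw [e] at G
  filter_upwards [Ioo_mem_nhds (by linarith : t - δ < t) (by linarith : t < t + δ)] with s hss
  have htm : t ∈ Ioo (t - δ) (t + δ) := ⟨by linarith, by linarith⟩
  rw [Real.norm_eq_abs, Real.norm_eq_abs, smul_eq_mul]
  rcases lt_trichotomy s t with hst | rfl | hst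
  · have := G s hss t htm hst
    rw [abs_of_neg (sub_neg.2 hst), ← abs_neg]
    convert! this using 2 <;> ring
  · simp
  · have := G t htm s hss hst
    rw [abs_of_pos (sub_pos.2 hst)]
    convert! this using 2; ring

lemma Mp_int (ha : 0 < a) (hI : IsInitialDatum fI pI a₀ lamI) (hs : IsSolutionP a fI (Ioo 0 T) f p) {t : ℝ} (ht : t ∈ Ioo 0 T) :
    IntegrableOn (fun x => max (f x t) 0) (Ioc (-1) 1) := Integrable.pos_part (sol_f_int ha hI hs ht)

lemma Mm_int (ha : 0 < a) (hI : IsInitialDatum fI pI a₀ lamI) (hs : IsSolutionP a fI (Ioo 0 T) f p) {t : ℝ} (ht : t ∈ Ioo 0 T) :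
    IntegrableOn (fun x => max (-f x t) 0) (Ioc (-1) 1) := Integrable.neg_part (sol_f_int ha hI hs ht)

lemma Mp_der (ha : 0 < a) (hI : IsInitialDatum fI pI a₀ lamI) (hs : IsSolutionP a fI (Ioo 0 T) f p) {Ψ Ψ1 Ψ2 : ℝ → ℝ} (h : T2 Ψ Ψ1 Ψ2) {t : ℝ} (ht : t ∈ Ioo 0 T) :
    HasDerivAt (Aff (fun x s => max (f x s) 0) Ψ) (Aff (fun x s => max (f x s) 0) (LL Ψ1 Ψ2) t + flux f p t * (Ψ (kap (zl a (p t))) - Ψ (kap (p t)))) t := by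
  obtain ⟨K, hK, hK'⟩ := bdd_Icc h.c0
  have h1 := Mp_der0 ha hI hs (h.addc K) (fun X hX => by linarith [(abs_le.1 (hK' X hX)).1]) ht
  have h2 := Mp_der0 ha hI hs (T2.const K) (fun X hX => hK) ht
  refine ((h1.sub h2).congr_of_eventuallyEq ?_).congr_deriv ?_
  · filter_upwards [Ioo_mem_nhds ht.1 ht.2] with s hss
    have hi := Mp_int ha hI hs hss
    show Aff _ _ s = Aff _ _ s - Aff _ _ s
    unfold Aff
    rw [← integral_sub (Aff_int (f := fun x s => max (f x s) 0) (Ψ := fun X => Ψ X + K) hi (h.addc K).c0) (Aff_int (f := fun x s => max (f x s) 0) (Ψ := fun _ => K) hi continuous_const)]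
    congr 1; funext x; ring
  · have : LL (fun _ => 0) (fun _ => 0) = fun _ => 0 := by funext X; simp [LL]
    rw [this]
    simp [Aff]

lemma Mm_eq (ha : 0 < a) (hI : IsInitialDatum fI pI a₀ lamI) (hs : IsSolutionP a fI (Ioo 0 T) f p) {Ψ : ℝ → ℝ} (h : Continuous Ψ) {t : ℝ} (ht : t ∈ Ioo 0 T) :
    Aff (fun x s => max (-f x s) 0) Ψ t = Aff (fun x s => max (f x s) 0) Ψ t - Aff f Ψ t := by
  unfold Aff
  rw [← integral_sub (Aff_int (f := fun x s => max (f x s) 0) (Mp_int ha hI hs ht) h) (Aff_int (sol_f_int ha hI hs ht) h)]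
  congr 1; funext x
  rw [← sub_mul]
  congr 1
  show max (-f x t) 0 = max (f x t) 0 - f x t
  rcases le_total 0 (f x t) with h | h
  · rw [max_eq_left h, max_eq_right (by linarith)]; ring
  · rw [max_eq_right h, max_eq_left (by linarith)]; ring

lemma Mm_der (ha : 0 < a) (hI : IsInitialDatum fI pI a₀ lamI) (hs : IsSolutionP a fI (Ioo 0 T) f p) {Ψ Ψ1 Ψ2 : ℝ → ℝ} (h : T2 Ψ Ψ1 Ψ2) {t : ℝ} (ht : t ∈ Ioo 0 T) :
    HasDerivAt (Aff (fun x s => max (-f x s) 0) Ψ) (Aff (fun x s => max (-f x s) 0) (LL Ψ1 Ψ2) t + flux f p t * (Ψ (kap (zr a (p t))) - Ψ (kap (p t)))) t := by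
  refine (((Mp_der ha hI hs h ht).sub (S1 ha hI hs h ht)).congr_of_eventuallyEq ?_).congr_deriv ?_
  · filter_upwards [Ioo_mem_nhds ht.1 ht.2] with s hss using Mm_eq ha hI hs h.c0 hss
  · rw [Mm_eq ha hI hs (LL_cont h.c1 h.c) ht]; ring

end


structure Half (T : ℝ) (lam : ℝ → ℝ) (N : (ℝ → ℝ) → ℝ → ℝ) (y u : ℝ → ℝ) (S : ℝ → Set ℝ) : Prop where
  sub : ∀ s ∈ Ioo 0 T, S s ⊆ Icc (-1) 1
  mono : ∀ s ∈ Ioo 0 T, ∀ Ψ Φ : ℝ → ℝ, Continuous Ψ → Continuous Φ → (∀ X ∈ S s, Ψ X ≤ Φ X) → N Ψ s ≤ N Φ s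
  lin : ∀ s ∈ Ioo 0 T, ∀ Ψ Φ : ℝ → ℝ, Continuous Ψ → Continuous Φ → ∀ c d : ℝ, N (fun X => c * Ψ X + d * Φ X) s = c * N Ψ s + d * N Φ s
  der : ∀ s ∈ Ioo 0 T, ∀ Ψ Ψ1 Ψ2 : ℝ → ℝ, T2 Ψ Ψ1 Ψ2 → HasDerivAt (N Ψ) (N (LL Ψ1 Ψ2) s + lam s * (Ψ (y s) - Ψ (u s))) s

noncomputable def Ex (θ X : ℝ) : ℝ := Real.exp (-(θ * (1 + X)))

lemma Ex_c (θ : ℝ) : Continuous (Ex θ) := by unfold Ex; fun_prop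
lemma Ex_pos (θ X : ℝ) : 0 < Ex θ X := Real.exp_pos _
lemma Ex_le_one {θ X : ℝ} (hθ : 0 ≤ θ) (hX : -1 ≤ X) : Ex θ X ≤ 1 := Real.exp_le_one_iff.2 (by have : 0 ≤ θ * (1 + X) := mul_nonneg hθ (by linarith); linarith)
lemma Ex_anti {θ X Y : ℝ} (hθ : 0 ≤ θ) (h : X ≤ Y) : Ex θ Y ≤ Ex θ X := Real.exp_le_exp.2 (by nlinarith)
lemma Ex_d (θ X : ℝ) : HasDerivAt (Ex θ) (-θ * Ex θ X) X := by
  have h : HasDerivAt (fun X : ℝ => -(θ * (1 + X))) (-θ) X := by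
    have := (((hasDerivAt_id X).const_add 1).const_mul θ).neg
    exact this.congr_deriv (by simp)
  exact h.exp.congr_deriv (by unfold Ex; ring)

lemma T2_Ex (θ : ℝ) : T2 (Ex θ) (fun X => -θ * Ex θ X) (fun X => θ ^ 2 * Ex θ X) :=
  ⟨Ex_d θ, fun X => ((Ex_d θ X).const_mul (-θ)).congr_deriv (by ring), (Ex_c θ).const_mul _ |> fun h => h⟩

lemma T2_qEx (θ : ℝ) : T2 (fun X => (1 + X) * Ex θ X) (fun X => (1 - θ * (1 + X)) * Ex θ X) (fun X => (-2 * θ + θ ^ 2 * (1 + X)) * Ex θ X) := by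
  have h1 : ∀ X : ℝ, HasDerivAt (fun X : ℝ => 1 + X) 1 X := fun X => (hasDerivAt_id X).const_add 1
  refine ⟨fun X => ((h1 X).mul (Ex_d θ X)).congr_deriv (by ring), fun X => ((((h1 X).const_mul θ).const_sub 1).mul (Ex_d θ X)).congr_deriv (by ring), ?_⟩
  have := Ex_c θ
  fun_prop

lemma T2_q : T2 (fun X => 1 + X) (fun _ => 1) (fun _ => 0) :=
  ⟨fun X => (hasDerivAt_id X).const_add 1, fun X => hasDerivAt_const X 1, continuous_const⟩

lemma LL_Ex (θ X : ℝ) : LL (fun X => -θ * Ex θ X) (fun X => θ ^ 2 * Ex θ X) X = Real.pi ^ 2 / 4 * (θ ^ 2 * ((1 + X) * (1 - X)) + θ * X) * Ex θ X := by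
  unfold LL; ring

lemma pi_sq_lt : Real.pi ^ 2 < 10 := by nlinarith [Real.pi_lt_d2, Real.pi_pos]
lemma pi_sq_gt : 9 < Real.pi ^ 2 := by nlinarith [Real.pi_gt_three]

section
variable {T : ℝ} {lam : ℝ → ℝ} {N : (ℝ → ℝ) → ℝ → ℝ} {y u : ℝ → ℝ} {S : ℝ → Set ℝ}

lemma Half.smul (H : Half T lam N y u S) {s : ℝ} (hs : s ∈ Ioo 0 T) {Ψ : ℝ → ℝ} (h : Continuous Ψ) (c : ℝ) : N (fun X => c * Ψ X) s = c * N Ψ s := by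
  have := H.lin s hs Ψ Ψ h h c 0
  simpa using this

lemma Half.nonneg (H : Half T lam N y u S) {s : ℝ} (hs : s ∈ Ioo 0 T) {Ψ : ℝ → ℝ} (h : Continuous Ψ) (h0 : ∀ X ∈ S s, 0 ≤ Ψ X) : 0 ≤ N Ψ s := by
  have h1 := H.smul hs (continuous_const (y := (0:ℝ))) 0
  have h2 := H.mono s hs (fun X => 0 * (fun _ => (0:ℝ)) X) Ψ (by fun_prop) h (by simpa using h0)
  rw [h1] at h2; simpa using h2

lemma Half.const (H : Half T lam N y u S) {s : ℝ} (hs : s ∈ Ioo 0 T) (c : ℝ) : N (fun _ => c) s = c * N (fun _ => 1) s := by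
  have := H.smul hs (continuous_const (y := (1:ℝ))) c
  simpa using this

lemma Half.add (H : Half T lam N y u S) {s : ℝ} (hs : s ∈ Ioo 0 T) {Ψ Φ : ℝ → ℝ} (h : Continuous Ψ) (h' : Continuous Φ) : N (fun X => Ψ X + Φ X) s = N Ψ s + N Φ s := by
  have := H.lin s hs Ψ Φ h h' 1 1
  simpa using this

lemma Half.mass (H : Half T lam N y u S) : ∃ M, 0 ≤ M ∧ ∀ s ∈ Ioo 0 T, N (fun _ => 1) s = M := by
  rcases le_or_gt T 0 with hT | hT
  · exact ⟨0, le_rfl, fun s hs => absurd (hs.1.trans hs.2) (not_lt.2 hT)⟩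
  have hm : T / 2 ∈ Ioo 0 T := ⟨by linarith, by linarith⟩
  refine ⟨N (fun _ => 1) (T / 2), H.nonneg hm continuous_const (fun _ _ => zero_le_one), fun s hs => ?_⟩
  have hd : ∀ r ∈ Ioo 0 T, HasDerivAt (N (fun _ => 1)) 0 r := fun r hr => by
    refine (H.der r hr _ _ _ (T2.const 1)).congr_deriv ?_
    have : LL (fun _ => 0) (fun _ => 0) = fun _ => 0 := by funext X; simp [LL]
    rw [this, H.const hr 0]; ring
  exact isOpen_Ioo.is_const_of_deriv_eq_zero (convex_Ioo 0 T).isPreconnected (fun r hr => (hd r hr).differentiableAt.differentiableWithinAt) (fun r hr => (hd r hr).deriv) hs hm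

lemma Half.le_mass (H : Half T lam N y u S) {M : ℝ} (hM : ∀ s ∈ Ioo 0 T, N (fun _ => 1) s = M) {s : ℝ} (hs : s ∈ Ioo 0 T) {Ψ : ℝ → ℝ} (h : Continuous Ψ) {c : ℝ} (hc : ∀ X ∈ S s, Ψ X ≤ c) :
    N Ψ s ≤ c * M := by
  rw [← hM s hs, ← H.const hs c]
  exact H.mono s hs _ _ h continuous_const hc

lemma Half.abs_le_mass (H : Half T lam N y u S) {M : ℝ} (hM : ∀ s ∈ Ioo 0 T, N (fun _ => 1) s = M) {s : ℝ} (hs : s ∈ Ioo 0 T) {Ψ : ℝ → ℝ} (h : Continuous Ψ) {c : ℝ} (hc : ∀ X ∈ S s, |Ψ X| ≤ c) :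
    |N Ψ s| ≤ c * M := by
  rw [abs_le]
  refine ⟨?_, H.le_mass hM hs h fun X hX => (abs_le.1 (hc X hX)).2⟩
  have := H.le_mass hM hs (Ψ := fun X => (-1) * Ψ X) (by fun_prop) (c := c) fun X hX => by linarith [(abs_le.1 (hc X hX)).1]
  rw [H.smul hs h] at this
  linarith

lemma deriv_sq_rem {k h : ℝ → ℝ} {s h' C : ℝ} (hd : HasDerivAt h h' s) (h0 : h s = 0) (hk : ∀ᶠ r in 𝓝 s, |k r| ≤ C * h r ^ 2) : HasDerivAt k 0 s := by
  have hks : k s = 0 := by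
    have := hk.self_of_nhds
    rw [h0] at this
    have : |k s| ≤ 0 := by simpa using this
    exact abs_eq_zero.1 (le_antisymm this (abs_nonneg _))
  rw [hasDerivAt_iff_isLittleO]
  have h1 : (fun r => k r) =O[𝓝 s] fun r => h r * h r := by
    refine Asymptotics.IsBigO.of_bound C ?_
    filter_upwards [hk] with r hr
    rw [Real.norm_eq_abs, Real.norm_eq_abs, abs_mul_self, ← sq]; exact hr
  have h2 : (fun r => h r) =O[𝓝 s] fun r => r - s := by
    have := hd.isBigO_sub
    simpa [h0] using this
  have h3 : (fun r => h r) =o[𝓝 s] fun _ => (1:ℝ) := by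
    rw [Asymptotics.isLittleO_one_iff]
    have := hd.continuousAt.tendsto
    rwa [h0] at this
  have h4 := h1.trans_isLittleO (h3.mul_isBigO h2)
  simpa [hks] using h4

lemma Half.der_time (H : Half T lam N y u S) {s : ℝ} (hs : s ∈ Ioo 0 T) {θ : ℝ → ℝ} {θ' : ℝ} (hθ : HasDerivAt θ θ' s) (hθ0 : 0 < θ s) :
    HasDerivAt (fun r => N (Ex (θ r)) r) (N (LL (fun X => -θ s * Ex (θ s) X) (fun X => θ s ^ 2 * Ex (θ s) X)) s + lam s * (Ex (θ s) (y s) - Ex (θ s) (u s)) - θ' * N (fun X => (1 + X) * Ex (θ s) X) s) s := by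
  obtain ⟨M, hM0, hM⟩ := H.mass
  have h1 := H.der s hs _ _ _ (T2_Ex (θ s))
  have h2 := H.der s hs _ _ _ (T2_qEx (θ s))
  have hθs : HasDerivAt (fun r => θ r - θ s) θ' s := hθ.sub_const _
  have h3 := hθs.mul h2
  set k : ℝ → ℝ := fun r => N (Ex (θ r)) r - N (Ex (θ s)) r + (θ r - θ s) * N (fun X => (1 + X) * Ex (θ s) X) r with hk
  have hkd : HasDerivAt k 0 s := by
    refine deriv_sq_rem (C := 4 * M) hθs (sub_self _) ?_
    have hsm : ∀ᶠ r in 𝓝 s, |θ r - θ s| < 1 / 2 := by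
      have := Metric.continuousAt_iff'.1 hθ.continuousAt (1 / 2) (by norm_num)
      simpa [Real.dist_eq] using this
    filter_upwards [hsm, Ioo_mem_nhds hs.1 hs.2] with r hr hrT
    set w := θ r - θ s with hw
    have e : k r = N (fun X => 1 * (1 * Ex (θ r) X + (-1) * Ex (θ s) X) + w * ((1 + X) * Ex (θ s) X)) r := by
      have c1 := Ex_c (θ r)
      have c2 := Ex_c (θ s)
      rw [H.lin r hrT (fun X => 1 * Ex (θ r) X + (-1) * Ex (θ s) X) (fun X => (1 + X) * Ex (θ s) X) (by fun_prop) (by fun_prop), H.lin r hrT _ _ c1 c2, hk]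
      ring
    rw [e]
    have c1 := Ex_c (θ r)
    have c2 := Ex_c (θ s)
    refine (H.abs_le_mass hM hrT (c := 4 * w ^ 2) (by fun_prop) fun X hX => ?_).trans (le_of_eq (by ring))
    have hX' := H.sub r hrT hX
    have hq0 : 0 ≤ 1 + X := by linarith [hX'.1]
    have hq2 : 1 + X ≤ 2 := by linarith [hX'.2]
    have hsplit : Ex (θ r) X = Ex (θ s) X * Real.exp (-(w * (1 + X))) := by
      unfold Ex; rw [← Real.exp_add]; congr 1; rw [hw]; ring
    have hww : |-(w * (1 + X))| ≤ 1 := by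
      rw [abs_neg, abs_mul, abs_of_nonneg hq0]
      nlinarith [abs_nonneg w]
    have hex := Real.abs_exp_sub_one_sub_id_le hww
    have : 1 * (1 * Ex (θ r) X + (-1) * Ex (θ s) X) + w * ((1 + X) * Ex (θ s) X) = Ex (θ s) X * (Real.exp (-(w * (1 + X))) - 1 - -(w * (1 + X))) := by
      rw [hsplit]; ring
    rw [this, abs_mul, abs_of_pos (Ex_pos _ _)]
    have e1 := Ex_le_one hθ0.le hX'.1
    calc Ex (θ s) X * |Real.exp (-(w * (1 + X))) - 1 - -(w * (1 + X))| ≤ 1 * (-(w * (1 + X))) ^ 2 := mul_le_mul e1 hex (abs_nonneg _) zero_le_one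
      _ = w ^ 2 * (1 + X) ^ 2 := by ring
      _ ≤ w ^ 2 * 4 := by
        refine mul_le_mul_of_nonneg_left ?_ (sq_nonneg w)
        nlinarith
      _ = 4 * w ^ 2 := by ring
  have h4 := (h1.sub h3).add hkd
  refine (h4.congr_of_eventuallyEq (Eventually.of_forall fun r => ?_)).congr_deriv ?_
  · simp only [hk, Pi.sub_apply, Pi.add_apply, Pi.mul_apply]; ring
  · simp only [sub_self, zero_mul]; ring

/-- decay bound (3) -/
lemma Half.decay (H : Half T lam N y u S) (hlam : ∀ s ∈ Ioo 0 T, 0 ≤ lam s) (hyu : ∀ s ∈ Ioo 0 T, u s ≤ y s) {t₀ : ℝ} (ht₀ : t₀ ∈ Ioo 0 T) :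
    ∃ C, 0 ≤ C ∧ ∀ s ∈ Ioo t₀ T, ∀ θ > 0, N (Ex θ) s ^ 2 ≤ C / (θ * (s - t₀)) := by
  obtain ⟨M, hM0, hM⟩ := H.mass
  refine ⟨Real.exp (2 * T) * M ^ 2, by positivity, fun s hs θ hθ => ?_⟩
  have hπ := pi_sq_lt
  have hπ' := pi_sq_gt
  set b := 2 / Real.pi ^ 2 with hb
  have hb0 : 0 < b := by positivity
  have hb1 : Real.pi ^ 2 * b = 2 := by rw [hb]; field_simp
  have hb1' : b ≤ 1 := by rw [hb, div_le_one (by positivity)]; linarith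
  set ε := b / θ with hε
  have hε0 : 0 < ε := by positivity
  set σ : ℝ → ℝ := fun r => ε + s - r with hσ
  have hσd : ∀ r, HasDerivAt σ (-1) r := fun r => (hasDerivAt_id r).const_sub (ε + s)
  set F : ℝ → ℝ := fun r => N (Ex (b / σ r)) r with hF
  have hsub : Icc t₀ s ⊆ Ioo 0 T := fun r hr => ⟨ht₀.1.trans_le hr.1, hr.2.trans_lt hs.2⟩
  have hFd : ∀ r ∈ Icc t₀ s, ∃ F', HasDerivAt F F' r ∧ F' ≤ (1 - 1 / (2 * σ r)) * F r ∧ 0 ≤ F r := by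
    intro r hr
    have hrT := hsub hr
    have hσ0 : 0 < σ r := by simp only [hσ]; linarith [hr.2]
    have hθd : HasDerivAt (fun r => b / σ r) (b / σ r ^ 2) r := by
      have := ((hσd r).inv hσ0.ne').const_mul b
      refine (this.congr_deriv ?_)
      field_simp
    refine ⟨_, H.der_time hrT hθd (by positivity), ?_, H.nonneg hrT (Ex_c _) fun X _ => (Ex_pos _ _).le⟩
    have c0 := Ex_c (b / σ r)
    set θr := b / σ r with hθr
    have hθr0 : 0 < θr := by positivity
    have e1 : lam r * (Ex θr (y r) - Ex θr (u r)) ≤ 0 :=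
      mul_nonpos_of_nonneg_of_nonpos (hlam r hrT) (by linarith [Ex_anti (X := u r) (Y := y r) hθr0.le (hyu r hrT)])
    have e2 : N (LL (fun X => -θr * Ex θr X) (fun X => θr ^ 2 * Ex θr X)) r - b / σ r ^ 2 * N (fun X => (1 + X) * Ex θr X) r
        ≤ (1 - 1 / (2 * σ r)) * N (Ex θr) r := by
      have c1 : Continuous (LL (fun X => -θr * Ex θr X) (fun X => θr ^ 2 * Ex θr X)) := LL_cont (by fun_prop) (by fun_prop)
      have l1 := H.lin r hrT _ (fun X => (1 + X) * Ex θr X) c1 (by fun_prop) 1 (-(b / σ r ^ 2))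
      have l2 := H.mono r hrT (fun X => 1 * LL (fun X => -θr * Ex θr X) (fun X => θr ^ 2 * Ex θr X) X + -(b / σ r ^ 2) * ((1 + X) * Ex θr X)) (fun X => (1 - 1 / (2 * σ r)) * Ex θr X) (by fun_prop) (by fun_prop) ?_
      · rw [H.smul hrT c0] at l2; linarith
      · intro X hX
        rw [LL_Ex]
        have : 1 * (Real.pi ^ 2 / 4 * (θr ^ 2 * ((1 + X) * (1 - X)) + θr * X) * Ex θr X) + -(b / σ r ^ 2) * ((1 + X) * Ex θr X)
            = (Real.pi ^ 2 / 4 * (θr ^ 2 * ((1 + X) * (1 - X)) + θr * X) - b / σ r ^ 2 * (1 + X)) * Ex θr X := by ring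
        rw [this]
        refine mul_le_mul_of_nonneg_right ?_ (Ex_pos _ _).le
        have hi : θr = b * (1 / σ r) := by rw [hθr]; ring
        have hj : b / σ r ^ 2 = b * (1 / σ r) ^ 2 := by ring
        have hk : 1 / (2 * σ r) = (1 / σ r) / 2 := by field_simp
        rw [hi, hj, hk]
        set i := 1 / σ r
        set q := 1 + X with hq
        have hX2 : X = q - 1 := by rw [hq]; ring
        rw [hX2]
        have : Real.pi ^ 2 / 4 * ((b * i) ^ 2 * (q * (1 - (q - 1))) + b * i * (q - 1)) - b * i ^ 2 * q = (i * q) / 2 - b / 2 * (i * q) ^ 2 - i / 2 := by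
          linear_combination (b * i ^ 2 * q * (2 - q) / 4 + i * (q - 1) / 4) * hb1
        rw [this]
        have hb2 : 1 / 5 < b := by rw [hb, lt_div_iff₀ (by positivity)]; linarith
        nlinarith [sq_nonneg (i * q - 5 / 2), sq_nonneg (i * q)]
    have : F r = N (Ex θr) r := rfl
    rw [this]; linarith
  choose! F' hF1 hF2 hF3 using hFd
  have hσp : ∀ r ∈ Icc t₀ s, 0 < σ r := fun r hr => by simp only [hσ]; linarith [hr.2]
  set G : ℝ → ℝ := fun r => F r ^ 2 * (σ r)⁻¹ * Real.exp (-(2 * r)) with hG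
  have hGd : ∀ r ∈ Icc t₀ s, HasDerivAt G ((2 * F r * F' r * (σ r)⁻¹ + F r ^ 2 * ((σ r)⁻¹) ^ 2) * Real.exp (-(2 * r)) + F r ^ 2 * (σ r)⁻¹ * (Real.exp (-(2 * r)) * (-2))) r := by
    intro r hr
    have hE : HasDerivAt (fun r : ℝ => Real.exp (-(2 * r))) (Real.exp (-(2 * r)) * (-2)) r := by
      have : HasDerivAt (fun r : ℝ => -(2 * r)) (-2) r := by
        have := ((hasDerivAt_id r).const_mul (2:ℝ)).neg
        exact this.congr_deriv (by simp)
      exact this.exp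
    have h1 := ((hF1 r hr).pow 2).mul ((hσd r).inv (hσp r hr).ne')
    refine (h1.mul hE).congr_deriv ?_
    simp only [Pi.mul_apply, Pi.pow_apply, Pi.inv_apply]
    have : - -1 / σ r ^ 2 = ((σ r)⁻¹) ^ 2 := by rw [neg_neg, one_div, inv_pow]
    rw [this]; simp
  have hanti : AntitoneOn G (Icc t₀ s) := by
    refine antitoneOn_of_hasDerivWithinAt_nonpos (convex_Icc _ _) (fun r hr => (hGd r hr).continuousAt.continuousWithinAt) (fun r hr => (hGd r (interior_subset hr)).hasDerivWithinAt) fun r hr => ?_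
    have hr' := interior_subset hr
    have k1 := hF2 r hr'
    have k2 := hF3 r hr'
    have k3 := hσp r hr'
    have hk : 1 / (2 * σ r) = (σ r)⁻¹ / 2 := by field_simp
    rw [hk] at k1
    have k4 : 0 < (σ r)⁻¹ := inv_pos.2 k3
    set i := (σ r)⁻¹
    have k5 : 2 * F r * F' r * i ≤ 2 * F r * ((1 - i / 2) * F r) * i := by gcongr
    have : (2 * F r * F' r * i + F r ^ 2 * i ^ 2) * Real.exp (-(2 * r)) + F r ^ 2 * i * (Real.exp (-(2 * r)) * (-2)) = (2 * F r * F' r * i + F r ^ 2 * i ^ 2 - 2 * (F r ^ 2 * i)) * Real.exp (-(2 * r)) := by ring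
    rw [this]
    exact mul_nonpos_of_nonpos_of_nonneg (by linarith) (Real.exp_pos _).le
  have hfin := hanti (left_mem_Icc.2 hs.1.le) (right_mem_Icc.2 hs.1.le) hs.1.le
  have hσs : σ s = ε := by simp [hσ]
  have hFs : F s = N (Ex θ) s := by
    simp only [hF, hσs]; congr 2; rw [hε]; field_simp
  have hst : 0 < s - t₀ := by linarith [hs.1]
  have hFt : F t₀ ≤ M := by
    have := H.le_mass hM ht₀ (Ψ := Ex (b / σ t₀)) (Ex_c _) (c := 1) fun X hX => Ex_le_one (div_nonneg hb0.le (hσp t₀ (left_mem_Icc.2 hs.1.le)).le) (H.sub t₀ ht₀ hX).1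
    simpa using this
  have hFt0 := hF3 t₀ (left_mem_Icc.2 hs.1.le)
  simp only [hG, hσs, hFs] at hfin
  have hσt : (σ t₀)⁻¹ ≤ (s - t₀)⁻¹ := inv_anti₀ hst (by simp only [hσ]; linarith)
  have hFt2 : F t₀ ^ 2 ≤ M ^ 2 := pow_le_pow_left₀ hFt0 hFt 2
  have hup : F t₀ ^ 2 * (σ t₀)⁻¹ * Real.exp (-(2 * t₀)) ≤ M ^ 2 * (s - t₀)⁻¹ * 1 := by
    have : Real.exp (-(2 * t₀)) ≤ 1 := Real.exp_le_one_iff.2 (by linarith [ht₀.1])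
    have := inv_nonneg.2 (hσp t₀ (left_mem_Icc.2 hs.1.le)).le
    gcongr
  have hlow : Real.exp (-(2 * T)) ≤ Real.exp (-(2 * s)) := Real.exp_le_exp.2 (by linarith [hs.2])
  have h5 : N (Ex θ) s ^ 2 * ε⁻¹ * Real.exp (-(2 * T)) ≤ M ^ 2 * (s - t₀)⁻¹ := by
    have : N (Ex θ) s ^ 2 * ε⁻¹ * Real.exp (-(2 * T)) ≤ N (Ex θ) s ^ 2 * ε⁻¹ * Real.exp (-(2 * s)) := by gcongr
    linarith
  have h6 : N (Ex θ) s ^ 2 * ε⁻¹ ≤ Real.exp (2 * T) * M ^ 2 * (s - t₀)⁻¹ := by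
    have hee : Real.exp (-(2 * T)) * Real.exp (2 * T) = 1 := by rw [← Real.exp_add]; simp
    have := mul_le_mul_of_nonneg_right h5 (Real.exp_pos (2 * T)).le
    rw [mul_assoc, hee] at this
    linarith
  have h7 : N (Ex θ) s ^ 2 * θ ≤ N (Ex θ) s ^ 2 * ε⁻¹ := by
    refine mul_le_mul_of_nonneg_left ?_ (sq_nonneg _)
    rw [hε, inv_div, le_div_iff₀ hb0]; nlinarith
  rw [le_div_iff₀ (by positivity), ← mul_assoc]
  have h8 := h7.trans h6
  rwa [← div_eq_mul_inv, le_div_iff₀ hst] at h8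

end


lemma inc_of_der {Y Y' : ℝ → ℝ} {s s' c : ℝ} (h : ∀ r ∈ Icc s s', HasDerivAt Y (Y' r) r) (hc : ∀ r ∈ Icc s s', c ≤ Y' r) (hss : s ≤ s') :
    c * (s' - s) ≤ Y s' - Y s := by
  have hm : MonotoneOn (fun r => Y r - c * r) (Icc s s') := by
    have hd : ∀ r ∈ Icc s s', HasDerivAt (fun r => Y r - c * r) (Y' r - c) r := fun r hr =>
      ((h r hr).sub ((hasDerivAt_id r).const_mul c)).congr_deriv (by simp)
    refine monotoneOn_of_hasDerivWithinAt_nonneg (convex_Icc _ _) (fun r hr => (hd r hr).continuousAt.continuousWithinAt) (fun r hr => (hd r (interior_subset hr)).hasDerivWithinAt) fun r hr => ?_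
    linarith [hc r (interior_subset hr)]
  have := hm (left_mem_Icc.2 hss) (right_mem_Icc.2 hss) hss
  simp only at this
  linarith

lemma y_exp_le (y : ℝ) : y * Real.exp (-y) ≤ Real.exp (-(y / 2)) := by
  have h1 : y ≤ Real.exp (y / 2) := by
    rcases le_total 0 y with h | h
    · have := Real.quadratic_le_exp_of_nonneg (x := y / 2) (by linarith)
      nlinarith [sq_nonneg (y - 2)]
    · exact h.trans (Real.exp_pos _).le
  have h2 : Real.exp (-(y / 2)) = Real.exp (y / 2) * Real.exp (-y) := by rw [← Real.exp_add]; congr 1; ring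
  rw [h2]
  exact mul_le_mul_of_nonneg_right h1 (Real.exp_pos _).le

section
variable {T : ℝ} {lam : ℝ → ℝ} {N : (ℝ → ℝ) → ℝ → ℝ} {y u : ℝ → ℝ} {S : ℝ → Set ℝ}

lemma Half.pot_g (H : Half T lam N y u S) (hlam : ∀ s ∈ Ioo 0 T, 0 ≤ lam s) (hyu : ∀ s ∈ Ioo 0 T, u s ≤ y s) :
    ∃ g g' : ℝ → ℝ, ∃ B, ∀ s ∈ Ioo 0 T, HasDerivAt g (g' s) s ∧ lam s * (y s - u s) ≤ g' s ∧ 0 ≤ g' s ∧ 0 ≤ g s ∧ g s ≤ B := by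
  obtain ⟨M, hM0, hM⟩ := H.mass
  refine ⟨fun s => N (fun X => 1 + X) s + Real.pi ^ 2 / 4 * M * s, fun s => N (LL (fun _ => 1) (fun _ => 0)) s + lam s * ((1 + y s) - (1 + u s)) + Real.pi ^ 2 / 4 * M, 2 * M + Real.pi ^ 2 / 4 * M * T, fun s hs => ?_⟩
  have h1 : HasDerivAt (fun s => Real.pi ^ 2 / 4 * M * s) (Real.pi ^ 2 / 4 * M) s :=
    ((hasDerivAt_id s).const_mul _).congr_deriv (by simp)
  have h2 : -(Real.pi ^ 2 / 4) * M ≤ N (LL (fun _ => 1) (fun _ => 0)) s := by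
    have := H.mono s hs (fun _ => -(Real.pi ^ 2 / 4)) (LL (fun _ => 1) (fun _ => 0)) continuous_const (LL_cont continuous_const continuous_const) fun X hX => by
      have := (H.sub s hs hX).2
      unfold LL
      nlinarith [pi_sq_gt]
    rwa [H.const hs, hM s hs] at this
  have h3 : 0 ≤ lam s * (y s - u s) := mul_nonneg (hlam s hs) (by linarith [hyu s hs])
  have h4 := H.nonneg hs (Ψ := fun X => 1 + X) (by fun_prop) fun X hX => by linarith [(H.sub s hs hX).1]
  have h5 := H.le_mass hM hs (Ψ := fun X => 1 + X) (by fun_prop) (c := 2) fun X hX => by linarith [(H.sub s hs hX).2]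
  have h6 : 0 ≤ Real.pi ^ 2 / 4 * M := by positivity
  have e : lam s * ((1 + y s) - (1 + u s)) = lam s * (y s - u s) := by ring
  refine ⟨(H.der s hs _ _ _ T2_q).add h1, by linarith, by linarith, ?_, ?_⟩
  · have := mul_nonneg h6 hs.1.le; simp only; linarith
  · have := mul_le_mul_of_nonneg_left hs.2.le h6; simp only; linarith

lemma mono_inc_small {g g' : ℝ → ℝ} {B : ℝ} (hT : 0 < T) (h : ∀ s ∈ Ioo 0 T, HasDerivAt g (g' s) s ∧ 0 ≤ g' s ∧ g s ≤ B) {ρ : ℝ} (hρ : 0 < ρ) :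
    ∃ τ ∈ Ioo 0 T, ∀ s ∈ Ico τ T, ∀ s' ∈ Ico τ T, g s' - g s ≤ ρ := by
  have hne : (g '' Ioo 0 T).Nonempty := ⟨_, mem_image_of_mem g (⟨by linarith, by linarith⟩ : T / 2 ∈ Ioo 0 T)⟩
  have hbd : BddAbove (g '' Ioo 0 T) := ⟨B, by rintro _ ⟨s, hs, rfl⟩; exact (h s hs).2.2⟩
  obtain ⟨_, ⟨τ, hτ, rfl⟩, hlt⟩ := exists_lt_of_lt_csSup hne (by linarith : sSup (g '' Ioo 0 T) - ρ < sSup (g '' Ioo 0 T))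
  refine ⟨τ, hτ, fun s hs s' hs' => ?_⟩
  have h1 := le_csSup hbd (mem_image_of_mem g (⟨hτ.1.trans_le hs'.1, hs'.2⟩ : s' ∈ Ioo 0 T))
  have h2 := inc_of_der (c := 0) (fun r (hr : r ∈ Icc τ s) => (h r ⟨hτ.1.trans_le hr.1, hr.2.trans_lt hs.2⟩).1) (fun r hr => (h r ⟨hτ.1.trans_le hr.1, hr.2.trans_lt hs.2⟩).2.1) hs.1
  linarith

lemma Half.pot_E (H : Half T lam N y u S) (hT : 0 < T) (hlam : ∀ s ∈ Ioo 0 T, 0 ≤ lam s) (hyu : ∀ s ∈ Ioo 0 T, u s ≤ y s) :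
    ∃ C > 0, ∀ ω ≥ 1, ∃ A A' : ℝ → ℝ, (∀ s ∈ Ioo (T / 2) T, HasDerivAt A (A' s) s ∧ lam s * (Ex (ω ^ 2) (u s) - Ex (ω ^ 2) (y s)) ≤ A' s) ∧
      ∀ s ∈ Ioo (T / 2) T, ∀ s' ∈ Ioo (T / 2) T, A s' - A s ≤ C / ω + C * ω * (s' - s) := by
  have ht0 : T / 4 ∈ Ioo 0 T := ⟨by linarith, by linarith⟩
  obtain ⟨C0, hC0, hdec⟩ := H.decay hlam hyu ht0
  set D := C0 * (4 / T) + 1 with hD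
  have hD1 : 1 ≤ D := by have : 0 ≤ C0 * (4 / T) := by positivity
                         linarith
  have hsT : ∀ s ∈ Ioo (T / 2) T, s ∈ Ioo 0 T := fun s hs => ⟨by linarith [hs.1], hs.2⟩
  have key : ∀ s ∈ Ioo (T / 2) T, ∀ θ > 0, N (Ex θ) s ^ 2 ≤ D / θ := fun s hs θ hθ => by
    refine (hdec s ⟨by linarith [hs.1], hs.2⟩ θ hθ).trans ?_
    have h1 : T / 4 ≤ s - T / 4 := by linarith [hs.1]
    calc C0 / (θ * (s - T / 4)) ≤ C0 / (θ * (T / 4)) := by gcongr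
      _ = C0 * (4 / T) / θ := by field_simp
      _ ≤ D / θ := by gcongr; linarith
  refine ⟨16 * D, by positivity, fun ω hω => ⟨fun s => -N (Ex (ω ^ 2)) s + 16 * D * ω * s, fun s => -(N (LL (fun X => -ω ^ 2 * Ex (ω ^ 2) X) (fun X => (ω ^ 2) ^ 2 * Ex (ω ^ 2) X)) s + lam s * (Ex (ω ^ 2) (y s) - Ex (ω ^ 2) (u s))) + 16 * D * ω, fun s hs => ⟨?_, ?_⟩, fun s hs s' hs' => ?_⟩⟩
  · exact (H.der s (hsT s hs) _ _ _ (T2_Ex (ω ^ 2))).neg.add (((hasDerivAt_id s).const_mul _).congr_deriv (by simp))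
  · have hs' := hsT s hs
    have hω0 : 0 < ω := by linarith
    have hω2 : 1 ≤ ω ^ 2 := one_le_pow₀ hω
    have c0 := Ex_c (ω ^ 2)
    have c1 := Ex_c (ω ^ 2 / 2)
    have b1 : N (LL (fun X => -ω ^ 2 * Ex (ω ^ 2) X) (fun X => (ω ^ 2) ^ 2 * Ex (ω ^ 2) X)) s ≤ 8 * ω ^ 2 * N (Ex (ω ^ 2 / 2)) s := by
      rw [← H.smul hs' c1]
      refine H.mono s hs' _ _ (LL_cont (by fun_prop) (by fun_prop)) (by fun_prop) fun X hX => ?_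
      have hX' := H.sub s hs' hX
      rw [LL_Ex]
      set θ := ω ^ 2
      have hq : 0 ≤ 1 + X := by linarith [hX'.1]
      have e1 : θ ^ 2 * ((1 + X) * (1 - X)) + θ * X ≤ 3 * θ * (θ * (1 + X)) := by
        have : θ ^ 2 * ((1 + X) * (1 - X)) ≤ 2 * θ * (θ * (1 + X)) := by
          have : 0 ≤ θ ^ 2 * (1 + X) * (1 + X) := by positivity
          nlinarith
        have : θ * X ≤ θ * (θ * (1 + X)) := by
          refine mul_le_mul_of_nonneg_left ?_ (by linarith)
          nlinarith
        linarith
      have e2 : θ * (1 + X) * Ex θ X ≤ Ex (θ / 2) X := by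
        have := y_exp_le (θ * (1 + X))
        unfold Ex
        have e : θ / 2 * (1 + X) = θ * (1 + X) / 2 := by ring
        rwa [e]
      have hE := Ex_pos θ X
      have hE2 := Ex_pos (θ / 2) X
      calc Real.pi ^ 2 / 4 * (θ ^ 2 * ((1 + X) * (1 - X)) + θ * X) * Ex θ X ≤ Real.pi ^ 2 / 4 * (3 * θ * (θ * (1 + X))) * Ex θ X := by gcongr
        _ = Real.pi ^ 2 / 4 * 3 * θ * (θ * (1 + X) * Ex θ X) := by ring
        _ ≤ Real.pi ^ 2 / 4 * 3 * θ * Ex (θ / 2) X := by gcongr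
        _ ≤ 8 * θ * Ex (θ / 2) X := by
          have := pi_sq_lt
          gcongr; linarith
    have b2 : N (Ex (ω ^ 2 / 2)) s ≤ 2 * D / ω := by
      refine abs_le_of_sq_le_sq' ?_ (by positivity) |>.2
      refine (key s hs _ (by positivity)).trans ?_
      rw [div_pow, div_div_eq_mul_div]
      gcongr
      nlinarith
    have b3 : 8 * ω ^ 2 * N (Ex (ω ^ 2 / 2)) s ≤ 8 * ω ^ 2 * (2 * D / ω) := by gcongr
    have b4 : 8 * ω ^ 2 * (2 * D / ω) = 16 * D * ω := by field_simp; ring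
    have b5 : lam s * (Ex (ω ^ 2) (u s) - Ex (ω ^ 2) (y s)) = -(lam s * (Ex (ω ^ 2) (y s) - Ex (ω ^ 2) (u s))) := by ring
    simp only
    linarith
  · have hω0 : 0 < ω := by linarith
    have b1 := H.nonneg (hsT s' hs') (Ex_c (ω ^ 2)) fun X _ => (Ex_pos _ _).le
    have b2 : N (Ex (ω ^ 2)) s ≤ 16 * D / ω := by
      refine abs_le_of_sq_le_sq' ?_ (by positivity) |>.2
      refine (key s hs _ (by positivity)).trans ?_
      rw [div_pow]
      gcongr
      nlinarith
    simp only
    linarith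

noncomputable def Om (Ω : ℝ) (j : ℕ) : ℝ := Ω * (8 / 7) ^ j

lemma Om_succ (Ω : ℝ) (j : ℕ) : Om Ω (j + 1) = Om Ω j * (8 / 7) := by unfold Om; rw [pow_succ]; ring
lemma Om_ge {Ω : ℝ} (hΩ : 1 ≤ Ω) (j : ℕ) : Ω ≤ Om Ω j := by
  unfold Om; exact le_mul_of_one_le_right (by linarith) (one_le_pow₀ (by norm_num))

lemma Half.pot_sum (H : Half T lam N y u S) (hT : 0 < T) (hlam : ∀ s ∈ Ioo 0 T, 0 ≤ lam s) (hyu : ∀ s ∈ Ioo 0 T, u s ≤ y s) :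
    ∃ C > 0, ∀ Ω ≥ 1, ∀ n : ℕ, ∃ A A' : ℝ → ℝ, (∀ s ∈ Ioo (T / 2) T, HasDerivAt A (A' s) s ∧
        lam s * (∑ j ∈ Finset.range n, (Ex (Om Ω j ^ 2) (u s) - Ex (Om Ω j ^ 2) (y s))) ≤ A' s) ∧
      ∀ s ∈ Ioo (T / 2) T, ∀ s' ∈ Ioo (T / 2) T, A s' - A s ≤ C * (8 / Ω - 8 / Om Ω n) + 7 * C * (Om Ω n - Ω) * (s' - s) := by
  obtain ⟨C, hC, hE⟩ := H.pot_E hT hlam hyu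
  refine ⟨C, hC, fun Ω hΩ n => ?_⟩
  induction n with
  | zero => exact ⟨fun _ => 0, fun _ => 0, fun s hs => ⟨hasDerivAt_const s 0, by simp⟩, fun s hs s' hs' => by simp [Om]⟩
  | succ n ih =>
    obtain ⟨A, A', h1, h2⟩ := ih
    have hω := Om_ge hΩ n
    obtain ⟨A2, A2', h3, h4⟩ := hE (Om Ω n) (by linarith)
    have hω0 : 0 < Om Ω n := by linarith
    refine ⟨fun s => A s + A2 s, fun s => A' s + A2' s, fun s hs => ⟨(h1 s hs).1.add (h3 s hs).1, ?_⟩, fun s hs s' hs' => ?_⟩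
    · rw [Finset.sum_range_succ, mul_add]
      exact add_le_add (h1 s hs).2 (h3 s hs).2
    · have e1 := h2 s hs s' hs'
      have e2 := h4 s hs s' hs'
      have e3 : 8 / Om Ω (n + 1) = 7 / Om Ω n := by rw [Om_succ]; field_simp
      have e4 : 8 / Om Ω n = 7 / Om Ω n + 1 / Om Ω n := by rw [← add_div]; norm_num
      have e5 : C / Om Ω n = C * (1 / Om Ω n) := by ring
      rw [e3, Om_succ]
      rw [e4] at e1
      rw [e5] at e2
      simp only
      linarith

lemma telescope {Ω U V : ℝ} (hΩ : 1 ≤ Ω) (hU : -1 ≤ U) (hV : 4 / 3 * (1 + U) ≤ 1 + V) (n : ℕ) :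
    1 - Ex (Om Ω n ^ 2) U ≤ Ω ^ 2 * (1 + U) + ∑ j ∈ Finset.range n, (Ex (Om Ω j ^ 2) U - Ex (Om Ω j ^ 2) V) := by
  induction n with
  | zero =>
    simp only [Finset.range_zero, Finset.sum_empty, add_zero, Om, pow_zero, mul_one]
    have := Real.add_one_le_exp (-(Ω ^ 2 * (1 + U)))
    unfold Ex; linarith
  | succ n ih =>
    rw [Finset.sum_range_succ]
    have : Ex (Om Ω n ^ 2) V ≤ Ex (Om Ω (n + 1) ^ 2) U := by
      refine Real.exp_le_exp.2 (neg_le_neg ?_)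
      rw [Om_succ]
      have h0 : 0 ≤ Om Ω n ^ 2 := sq_nonneg _
      have : (Om Ω n * (8 / 7)) ^ 2 * (1 + U) = Om Ω n ^ 2 * (64 / 49 * (1 + U)) := by ring
      rw [this]
      exact mul_le_mul_of_nonneg_left (by linarith) h0
    linarith

end

lemma J_bound {Ω c z u v : ℝ} (hΩ : 1 ≤ Ω) (hc : 0 < c) (hz : -1 ≤ z) (hzu : z < u) (huv : u < v) (h3 : u - z ≤ 3 * (v - u)) (hcase : z = -1 ∨ c ≤ u - z ∨ c ≤ z + 1) (n : ℕ) :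
    Ex (Om Ω n ^ 2) z - Ex (Om Ω n ^ 2) u ≤ (3 * Ω ^ 2 + 3 / c) * (v - u) + ∑ j ∈ Finset.range n, (Ex (Om Ω j ^ 2) u - Ex (Om Ω j ^ 2) v) := by
  have hH : 0 ≤ ∑ j ∈ Finset.range n, (Ex (Om Ω j ^ 2) u - Ex (Om Ω j ^ 2) v) :=
    Finset.sum_nonneg fun j _ => by linarith [Ex_anti (sq_nonneg (Om Ω j)) huv.le]
  have hvu : 0 < v - u := by linarith
  have hsplit : (3 * Ω ^ 2 + 3 / c) * (v - u) = 3 * Ω ^ 2 * (v - u) + 3 / c * (v - u) := by ring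
  have p1 : 0 ≤ 3 * Ω ^ 2 * (v - u) := by positivity
  have p2 : 0 ≤ 3 / c * (v - u) := by positivity
  have hcu : (u - z) / c ≤ 3 / c * (v - u) := by
    rw [div_mul_eq_mul_div]; gcongr
  set θ := Om Ω n ^ 2 with hθ
  have hθ0 : 0 ≤ θ := sq_nonneg _
  rcases hcase with h | h | h
  · have := telescope (U := u) (V := v) hΩ (by linarith) (by linarith) n
    rw [h]
    have e : Ex θ (-1) = 1 := by simp [Ex]
    have : Ω ^ 2 * (1 + u) ≤ 3 * Ω ^ 2 * (v - u) := by nlinarith [sq_nonneg Ω]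
    linarith
  · have h1 := Ex_le_one hθ0 hz
    have h2 := Ex_pos θ u
    have : 1 ≤ (u - z) / c := by rwa [one_le_div hc]
    linarith
  · have e : Ex θ u = Ex θ z * Real.exp (-(θ * (u - z))) := by unfold Ex; rw [← Real.exp_add]; congr 1; ring
    have h1 := Real.add_one_le_exp (-(θ * (u - z)))
    have h2 := Ex_pos θ z
    have h3 : Ex θ z - Ex θ u ≤ Ex θ z * (θ * (u - z)) := by rw [e]; nlinarith
    have h4 : θ * c * Ex θ z ≤ 1 := by
      have a1 := y_exp_le (θ * (1 + z))
      have a2 : Real.exp (-(θ * (1 + z) / 2)) ≤ 1 := Real.exp_le_one_iff.2 (by have := mul_nonneg hθ0 (by linarith : 0 ≤ 1 + z); linarith)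
      have a3 : θ * c * Ex θ z ≤ θ * (1 + z) * Ex θ z := by gcongr; linarith
      unfold Ex at *; linarith
    have h5 : Ex θ z * (θ * (u - z)) ≤ (u - z) / c := by
      rw [le_div_iff₀ hc]
      nlinarith
    linarith

set_option maxHeartbeats 1600000 in
theorem nohit {T c : ℝ} {lam : ℝ → ℝ} {Np Nm : (ℝ → ℝ) → ℝ → ℝ} {v u z : ℝ → ℝ} {Sp Sm : ℝ → Set ℝ} (hT : 0 < T) (hc : 0 < c)
    (hlam : ∀ s ∈ Ioo 0 T, 0 ≤ lam s) (Hp : Half T lam Np v u Sp) (Hm : Half T lam Nm z u Sm)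
    (hSm : ∀ s ∈ Ioo 0 T, ∀ X ∈ Sm s, X ≤ u s) (hz : ∀ s ∈ Ioo 0 T, -1 ≤ z s) (hzu : ∀ s ∈ Ioo 0 T, z s < u s) (huv : ∀ s ∈ Ioo 0 T, u s < v s)
    (h3 : ∀ s ∈ Ioo 0 T, u s - z s ≤ 3 * (v s - u s)) (hcase : ∀ s ∈ Ioo 0 T, z s = -1 ∨ c ≤ u s - z s ∨ c ≤ z s + 1)
    (hm : 0 < Nm (fun _ => 1) (T / 2)) : ∃ c' > 0, ∃ t1 < T, ∀ s ∈ Ioo t1 T, s ∈ Ioo 0 T → c' ≤ u s + 1 := by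
  by_contra hcon
  push Not at hcon
  obtain ⟨m, hm0, hmass⟩ := Hm.mass
  have hmp : 0 < m := by rwa [hmass (T / 2) ⟨by linarith, by linarith⟩] at hm
  obtain ⟨C, hC, hpot⟩ := Hp.pot_sum hT hlam (fun s hs => (huv s hs).le)
  obtain ⟨g, g', B, hg⟩ := Hp.pot_g hlam (fun s hs => (huv s hs).le)
  set Ω := 1 + 8 * C * 6000 / m with hΩd
  have hΩ : 1 ≤ Ω := by have : 0 ≤ 8 * C * 6000 / m := by positivity
                        linarith
  have hΩ8 : C * (8 / Ω) ≤ m / 6000 := by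
    rw [mul_div_assoc', div_le_iff₀ (by linarith), hΩd]
    have : m / 6000 * (1 + 8 * C * 6000 / m) = m / 6000 + 8 * C := by field_simp
    rw [this]; linarith
  set K := 3 * Ω ^ 2 + 3 / c with hK
  have hK0 : 0 < K := by positivity
  obtain ⟨τ, hτ, hgs⟩ := mono_inc_small hT (fun s hs => ⟨(hg s hs).1, (hg s hs).2.2.1, (hg s hs).2.2.2.2⟩) (ρ := m / 6000 / K) (by positivity)
  -- choose n
  have hlim : Tendsto (fun n : ℕ => Om Ω n) atTop atTop := by
    unfold Om
    exact (tendsto_pow_atTop_atTop_of_one_lt (by norm_num)).const_mul_atTop (by linarith)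
  obtain ⟨n, hn1, hn2, hn3, hn4⟩ := ((hlim.eventually_ge_atTop 2).and ((hlim.eventually_ge_atTop (7 * C * 6000 / m)).and ((hlim.eventually_gt_atTop (1 / (T - τ))).and (hlim.eventually_gt_atTop (2 / T))))).exists
  set ω := Om Ω n with hω
  have hω0 : 0 < ω := by linarith
  set θ := ω ^ 2 with hθ
  have hθ4 : 4 ≤ θ := by rw [hθ]; nlinarith
  have hθω : ω ≤ θ := by rw [hθ]; nlinarith
  set t := T - 1 / (120 * θ) with ht
  have hTt : T - t = 1 / (120 * θ) := by rw [ht]; ring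
  have hκ : θ * (T - t) = 1 / 120 := by rw [hTt]; field_simp
  have hTt0 : 0 < T - t := by rw [hTt]; positivity
  have hTtω : T - t < 1 / ω := by
    rw [hTt]; apply one_div_lt_one_div_of_lt hω0; linarith
  have htτ : τ < t := by
    have h1 : 1 / ω < T - τ := by
      rw [one_div_lt hω0 (by linarith [hτ.2])]; exact hn3
    linarith
  have htT2 : T / 2 < t := by
    have h1 : 1 / ω < T / 2 := by
      rw [one_div_lt hω0 (by linarith)]; rw [one_div_div]; exact hn4
    linarith
  obtain ⟨A, A', hA1, hA2⟩ := hpot Ω hΩ n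
  have hmem : ∀ s ∈ Ico t T, s ∈ Ioo 0 T ∧ s ∈ Ioo (T / 2) T ∧ s ∈ Ico τ T := fun s hs => ⟨⟨by linarith [hs.1], hs.2⟩, ⟨by linarith [hs.1], hs.2⟩, ⟨by linarith [hs.1], hs.2⟩⟩
  set P : ℝ → ℝ := fun s => K * g s + A s with hP
  have hPinc : ∀ s ∈ Ico t T, ∀ s' ∈ Ico t T, P s' - P s ≤ m / 2000 := by
    intro s hs s' hs'
    obtain ⟨a1, a2, a3⟩ := hmem s hs
    obtain ⟨b1, b2, b3⟩ := hmem s' hs'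
    have e1 := hA2 s a2 s' b2
    have e2 := mul_le_mul_of_nonneg_left (hgs s a3 s' b3) hK0.le
    have e3 : K * (m / 6000 / K) = m / 6000 := by field_simp
    have e4 : 0 ≤ C * (8 / ω) := by positivity
    have e5 : 7 * C * (ω - Ω) * (s' - s) ≤ m / 6000 := by
      have hωΩ : 0 ≤ ω - Ω := by have := Om_ge hΩ n; linarith
      have f1 : s' - s ≤ T - t := by linarith [hs.1, hs'.2]
      have f2 : 7 * C * (ω - Ω) * (s' - s) ≤ 7 * C * (ω - Ω) * (T - t) := by gcongr
      have f3 : 7 * C * (ω - Ω) * (T - t) ≤ 7 * C * ω * (T - t) := by gcongr; linarith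
      have f4 : ω * (7 * C * ω * (T - t)) ≤ 7 * C := by
        have : ω * (7 * C * ω * (T - t)) = 7 * C * (θ * (T - t)) := by rw [hθ]; ring
        rw [this, hκ]; linarith
      have f5 : 7 * C ≤ ω * (m / 6000) := by
        rw [div_le_iff₀ hmp] at hn2; linarith
      have f6 := le_of_mul_le_mul_left (f4.trans f5) hω0
      linarith
    simp only [hP]
    linarith
  set X : ℝ → ℝ := fun s => m - Nm (Ex θ) s with hX
  have hXd : ∀ s ∈ Ico t T, HasDerivAt X (-(Nm (LL (fun X => -θ * Ex θ X) (fun X => θ ^ 2 * Ex θ X)) s + lam s * (Ex θ (z s) - Ex θ (u s)))) s := fun s hs =>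
    (Hm.der s (hmem s hs).1 _ _ _ (T2_Ex θ)).const_sub m
  have c0 := Ex_c θ
  have hX0 : ∀ s ∈ Ico t T, 0 ≤ X s := fun s hs => by
    have := Hm.le_mass hmass (hmem s hs).1 c0 (c := 1) fun Y hY => Ex_le_one (by linarith) (Hm.sub s (hmem s hs).1 hY).1
    simp only [hX]; linarith
  have hXm : ∀ s ∈ Ico t T, X s ≤ m := fun s hs => by
    have := Hm.nonneg (hmem s hs).1 c0 fun Y _ => (Ex_pos θ Y).le
    simp only [hX]; linarith
  have hLL : ∀ s ∈ Ico t T, Nm (LL (fun X => -θ * Ex θ X) (fun X => θ ^ 2 * Ex θ X)) s ≤ Real.pi ^ 2 / 4 * (θ * (3 * X s - m) + m) := by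
    intro s hs
    have hs0 := (hmem s hs).1
    have l1 := Hm.lin s hs0 (fun _ => 1) (Ex θ) continuous_const c0 (Real.pi ^ 2 / 4 * (2 * θ + 1)) (-(Real.pi ^ 2 / 4 * (3 * θ)))
    rw [hmass s hs0] at l1
    have l2 := Hm.mono s hs0 (LL (fun X => -θ * Ex θ X) (fun X => θ ^ 2 * Ex θ X)) (fun Y => Real.pi ^ 2 / 4 * (2 * θ + 1) * 1 + -(Real.pi ^ 2 / 4 * (3 * θ)) * Ex θ Y) (LL_cont (by fun_prop) (by fun_prop)) (by fun_prop) fun Y hY => by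
      have hY' := Hm.sub s hs0 hY
      rw [LL_Ex]
      have hE := Ex_pos θ Y
      have hyE : θ * (1 + Y) * Ex θ Y ≤ 1 - Ex θ Y := by
        have := Real.add_one_le_exp (θ * (1 + Y))
        have hee : Real.exp (θ * (1 + Y)) * Ex θ Y = 1 := by unfold Ex; rw [← Real.exp_add]; simp
        nlinarith
      have hq : 0 ≤ 1 + Y := by linarith [hY'.1]
      have i1 : (θ ^ 2 * ((1 + Y) * (1 - Y)) + θ * Y) * Ex θ Y ≤ 2 * θ * (θ * (1 + Y) * Ex θ Y) + θ * (1 + Y) * Ex θ Y - θ * Ex θ Y := by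
        have : 0 ≤ θ ^ 2 * (1 + Y) * (1 + Y) * Ex θ Y := by positivity
        nlinarith
      have i2 : 2 * θ * (θ * (1 + Y) * Ex θ Y) ≤ 2 * θ * (1 - Ex θ Y) := by gcongr
      have i3 : (θ ^ 2 * ((1 + Y) * (1 - Y)) + θ * Y) * Ex θ Y ≤ (2 * θ + 1) - 3 * θ * Ex θ Y := by linarith
      have := mul_le_mul_of_nonneg_left i3 (by positivity : 0 ≤ Real.pi ^ 2 / 4)
      linarith
    rw [l1] at l2
    simp only [hX]
    refine l2.trans (le_of_eq ?_)
    ring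
  -- Y = X + P
  set Y : ℝ → ℝ := fun s => X s + P s with hY
  have hYd : ∀ s ∈ Ico t T, ∃ Y', HasDerivAt Y Y' s ∧ Real.pi ^ 2 / 4 * (θ * (m - 3 * X s) - m) ≤ Y' := by
    intro s hs
    obtain ⟨a1, a2, a3⟩ := hmem s hs
    refine ⟨_, (hXd s hs).add (((hg s a1).1.const_mul K).add (hA1 s a2).1), ?_⟩
    have e1 := hLL s hs
    have e2 := mul_le_mul_of_nonneg_left (J_bound (n := n) hΩ hc (hz s a1) (hzu s a1) (huv s a1) (h3 s a1) (hcase s a1)) (hlam s a1)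
    have e3 := (hA1 s a2).2
    have e4 := mul_le_mul_of_nonneg_left (hg s a1).2.1 hK0.le
    rw [mul_add] at e2
    have e5 : lam s * ((3 * Ω ^ 2 + 3 / c) * (v s - u s)) = K * (lam s * (v s - u s)) := by rw [hK]; ring
    rw [e5] at e2
    have e6 : lam s * (Ex θ (z s) - Ex θ (u s)) ≤ K * g' s + A' s := by
      refine e2.trans ?_
      linarith
    linarith
  choose! Y' hY1 hY2 using hYd
  have hπ := pi_sq_lt
  have hπ' := pi_sq_gt
  have small : ∀ r ∈ Ico t T, ∃ s ∈ Ioo r T, X s ≤ m / 2000 := by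
    intro r hr
    obtain ⟨s, hs, hs0, hus⟩ := hcon (1 / (2000 * θ)) (by positivity) r hr.2
    refine ⟨s, hs, ?_⟩
    have hst : s ∈ Ico t T := ⟨hr.1.trans hs.1.le, hs.2⟩
    have l1 := Hm.lin s hs0 (fun _ => 1) (Ex θ) continuous_const c0 1 (-1)
    rw [hmass s hs0] at l1
    have l2 := Hm.le_mass hmass hs0 (Ψ := fun Y => 1 * 1 + (-1) * Ex θ Y) (by fun_prop) (c := 1 / 2000) fun Y hY => by
      have h1 := Real.add_one_le_exp (-(θ * (1 + Y)))
      have h2 : θ * (1 + Y) ≤ θ * (1 / (2000 * θ)) := by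
        refine mul_le_mul_of_nonneg_left ?_ (by linarith)
        linarith [hSm s hs0 Y hY]
      have h3 : θ * (1 / (2000 * θ)) = 1 / 2000 := by field_simp
      unfold Ex; linarith
    rw [l1] at l2
    simp only [hX]; linarith
  have htm : t ∈ Ico t T := ⟨le_rfl, by linarith⟩
  have hθm : 0 < θ * m := by positivity
  by_cases hB : ∀ s ∈ Ico t T, X s ≤ m / 6
  · obtain ⟨s, hs, hXs⟩ := small ((t + T) / 2) ⟨by linarith, by linarith⟩
    have hst : s ∈ Ico t T := ⟨by linarith [hs.1], hs.2⟩
    have hin : ∀ r ∈ Icc t s, r ∈ Ico t T := fun r hr => ⟨hr.1, hr.2.trans_lt hs.2⟩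
    have e1 := inc_of_der (c := θ * m / 2) (fun r hr => hY1 r (hin r hr)) (fun r hr => by
      refine le_trans ?_ (hY2 r (hin r hr))
      have b1 := hB r (hin r hr)
      have b2 : θ * (m / 2) - m ≤ θ * (m - 3 * X r) - m := by
        have : θ * (m / 2) ≤ θ * (m - 3 * X r) := mul_le_mul_of_nonneg_left (by linarith) (by linarith)
        linarith
      have b3 : θ * m / 4 ≤ θ * (m / 2) - m := by nlinarith
      nlinarith) hst.1
    have e2 := hPinc t htm s hst
    have e3 := hX0 t htm
    have e4 : θ * m / 2 * ((T - t) / 2) ≤ θ * m / 2 * (s - t) := by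
      refine mul_le_mul_of_nonneg_left ?_ (by linarith)
      linarith [hs.1]
    have e5 : θ * m / 2 * ((T - t) / 2) = m / 480 := by
      have : θ * m / 2 * ((T - t) / 2) = m / 4 * (θ * (T - t)) := by ring
      rw [this, hκ]; ring
    simp only [hY] at e1
    linarith
  · push Not at hB
    obtain ⟨s0, hs0, hXs0⟩ := hB
    obtain ⟨s, hs, hXs⟩ := small s0 hs0
    have hst : s ∈ Ico t T := ⟨hs0.1.trans hs.1.le, hs.2⟩
    have hin : ∀ r ∈ Icc s0 s, r ∈ Ico t T := fun r hr => ⟨hs0.1.trans hr.1, hr.2.trans_lt hs.2⟩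
    have e1 := inc_of_der (c := -(6 * (θ * m))) (fun r hr => hY1 r (hin r hr)) (fun r hr => by
      refine le_trans ?_ (hY2 r (hin r hr))
      have b1 := hXm r (hin r hr)
      have b2 : -(9 / 4 * (θ * m)) ≤ θ * (m - 3 * X r) - m := by
        have : θ * (-2 * m) ≤ θ * (m - 3 * X r) := mul_le_mul_of_nonneg_left (by linarith) (by linarith)
        nlinarith
      nlinarith) hs.1.le
    have e2 := hPinc s0 hs0 s hst
    have e4 : 6 * (θ * m) * (s - s0) ≤ 6 * (θ * m) * (T - t) := by
      refine mul_le_mul_of_nonneg_left ?_ (by linarith)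
      linarith [hs0.1, hs.2]
    have e5 : 6 * (θ * m) * (T - t) = m / 20 := by
      have : 6 * (θ * m) * (T - t) = 6 * m * (θ * (T - t)) := by ring
      rw [this, hκ]; ring
    simp only [hY] at e1
    linarith


lemma geo_trig {α β : ℝ} (h0 : 0 ≤ β) (h1 : β ≤ α) (h2 : α ≤ Real.pi) : 2 * (Real.cos α * (1 - Real.cos β)) ≤ Real.sin α * Real.sin β := by
  have e1 : Real.sin α = 2 * Real.sin (α / 2) * Real.cos (α / 2) := by rw [← Real.sin_two_mul]; congr 1; ring
  have e2 : Real.sin β = 2 * Real.sin (β / 2) * Real.cos (β / 2) := by rw [← Real.sin_two_mul]; congr 1; ring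
  have e3 : Real.cos β = 1 - 2 * Real.sin (β / 2) ^ 2 := by
    have h := Real.cos_two_mul (β / 2)
    rw [show 2 * (β / 2) = β by ring] at h
    linarith [Real.sin_sq_add_cos_sq (β / 2)]
  have e4 : Real.cos α = 2 * Real.cos (α / 2) ^ 2 - 1 := by rw [← Real.cos_two_mul]; congr 1; ring
  have s1 : 0 ≤ Real.sin (β / 2) := Real.sin_nonneg_of_nonneg_of_le_pi (by linarith) (by linarith)
  have s2 : 0 ≤ Real.cos (α / 2) := Real.cos_nonneg_of_neg_pi_div_two_le_of_le (by linarith) (by linarith)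
  have s3 : 0 ≤ Real.sin (α / 2 - β / 2) := Real.sin_nonneg_of_nonneg_of_le_pi (by linarith) (by linarith)
  rw [Real.sin_sub] at s3
  have s4 : Real.cos α ≤ Real.cos (α / 2) ^ 2 := by rw [e4]; linarith [Real.cos_sq_le_one (α / 2)]
  have s5 : Real.cos α * Real.sin (β / 2) ^ 2 ≤ Real.cos (α / 2) ^ 2 * Real.sin (β / 2) ^ 2 := mul_le_mul_of_nonneg_right s4 (sq_nonneg _)
  have s6 := mul_nonneg (mul_nonneg s1 s2) s3
  rw [e3, e1, e2]
  nlinarith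

lemma kap_neg (x : ℝ) : kap (-x) = -kap x := by
  unfold kap
  rw [← Real.cos_pi_sub]; congr 1; ring

lemma ab_neg (a P : ℝ) : ab a (-P) = ab a P := by unfold ab; rw [min_comm (1 - -P)]; congr 2; ring
lemma zr_neg (a P : ℝ) : zr a (-P) = -zl a P := by unfold zr zl; rw [ab_neg]; ring
lemma zl_neg (a P : ℝ) : zl a (-P) = -zr a P := by unfold zr zl; rw [ab_neg]; ring

lemma geo3 {a P : ℝ} (ha : 0 < a) (hP : P ∈ Ioo (-1:ℝ) 1) : kap P - kap (zr a P) ≤ 3 * (kap (zl a P) - kap P) := by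
  have h1 := ab_le_l a P
  have h0 := ab_pos ha hP
  have hpi := Real.pi_pos
  have := geo_trig (α := Real.pi * (P + 1) / 2) (β := Real.pi * ab a P / 2) (by positivity) (by nlinarith) (by nlinarith [hP.2])
  unfold kap zr zl
  rw [show Real.pi * (P + ab a P + 1) / 2 = Real.pi * (P + 1) / 2 + Real.pi * ab a P / 2 by ring,
    show Real.pi * (P - ab a P + 1) / 2 = Real.pi * (P + 1) / 2 - Real.pi * ab a P / 2 by ring, Real.cos_add, Real.cos_sub]
  linarith

lemma geo_case {a : ℝ} (ha : a ∈ Ioo (0:ℝ) 1) : ∃ c > 0, ∀ P ∈ Ioo (-1:ℝ) 1, kap (zr a P) = -1 ∨ c ≤ kap P - kap (zr a P) ∨ c ≤ kap (zr a P) + 1 := by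
  have hc : Continuous fun P => kap P - kap (P + a) := by have := kap_continuous; fun_prop
  obtain ⟨P0, hP0, hmin⟩ := isCompact_Icc.exists_isMinOn (s := Icc (-1:ℝ) (1 - a)) ⟨-1, by constructor <;> linarith [ha.2]⟩ hc.continuousOn
  have h1 : 0 < kap P0 - kap (P0 + a) := by
    have := kap_strictAnti (a := P0) ⟨hP0.1, by linarith [hP0.2, ha.1]⟩ (b := P0 + a) ⟨by linarith [hP0.1, ha.1], by linarith [hP0.2]⟩ (by linarith [ha.1])
    linarith
  have h2 : 0 < kap (2 * a - 1) + 1 := by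
    have := kap_strictAnti (a := 2 * a - 1) ⟨by linarith [ha.1], by linarith [ha.2]⟩ (b := 1) ⟨by norm_num, le_rfl⟩ (by linarith [ha.2])
    rw [kap_one] at this; linarith
  refine ⟨min (kap P0 - kap (P0 + a)) (kap (2 * a - 1) + 1), lt_min h1 h2, fun P hP => ?_⟩
  have hr := ab_le_r a P
  rcases min_choice a (min (1 - P) (1 + P)) with h | h
  · right; left
    have hab : ab a P = a := h
    refine (min_le_left _ _).trans ?_
    have := hmin (a := P) ⟨hP.1.le, by rw [hab] at hr; linarith⟩
    simp only [mem_ofPred_eq] at this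
    unfold zr; rw [hab]; exact this
  · rcases min_choice (1 - P) (1 + P) with h' | h'
    · left
      have hab : ab a P = 1 - P := h.trans h'
      unfold zr; rw [hab]; ring_nf; exact kap_one
    · right; right
      have hab : ab a P = 1 + P := h.trans h'
      refine (min_le_right _ _).trans ?_
      have hl := ab_le_a a P
      unfold zr
      rw [hab] at hl hr ⊢
      have := kap_strictAnti.antitoneOn (a := P + (1 + P)) ⟨by linarith [hP.1], by linarith⟩ (b := 2 * a - 1) ⟨by linarith [ha.1], by linarith [ha.2]⟩ (by linarith)
      linarith

lemma geo_gap {a c : ℝ} (ha : 0 < a) (hc : 0 < c) : ∃ d > 0, ∀ P ∈ Ioo (-1:ℝ) 1, c ≤ kap P + 1 → c ≤ 1 - kap P → d ≤ kap (zl a P) - kap P := by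
  have kc := kap_continuous
  set K : Set ℝ := Icc (-1) 1 ∩ {P | c ≤ kap P + 1 ∧ c ≤ 1 - kap P} with hK
  have hKc : IsCompact K := isCompact_Icc.inter_right ((isClosed_le continuous_const (kc.add continuous_const)).inter (isClosed_le continuous_const (continuous_const.sub kc)))
  rcases K.eq_empty_or_nonempty with he | hne
  · refine ⟨1, one_pos, fun P hP h1 h2 => ?_⟩
    have : P ∈ K := ⟨Ioo_subset_Icc_self hP, h1, h2⟩
    rw [he] at this; exact this.elim
  · obtain ⟨P0, hP0, hmin⟩ := hKc.exists_isMinOn hne (f := fun P => kap (zl a P) - kap P) ((kc.comp (zl_continuous a)).sub kc).continuousOn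
    have hP0' : P0 ∈ Ioo (-1:ℝ) 1 := by
      obtain ⟨⟨h1, h2⟩, h3, h4⟩ := hP0
      refine ⟨lt_of_le_of_ne h1 fun h => ?_, lt_of_le_of_ne h2 fun h => ?_⟩
      · rw [← h, kap_neg_one] at h4; linarith
      · rw [h, kap_one] at h3; linarith
    refine ⟨kap (zl a P0) - kap P0, ?_, fun P hP h1 h2 => hmin (a := P) ⟨Ioo_subset_Icc_self hP, h1, h2⟩⟩
    have := kap_strictAnti (zl_mem ha (Ioo_subset_Icc_self hP0')) (Ioo_subset_Icc_self hP0') (zl_lt ha hP0')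
    simp only [gt_iff_lt, sub_pos]; exact this

lemma Aff_mono {g : ℝ → ℝ → ℝ} {s : ℝ} {S : Set ℝ} (hg : IntegrableOn (fun x => g x s) (Ioc (-1) 1)) (h0 : ∀ x, 0 ≤ g x s)
    (hz : ∀ x ∈ Ioc (-1:ℝ) 1, kap x ∉ S → g x s = 0) {Ψ Φ : ℝ → ℝ} (h1 : Continuous Ψ) (h2 : Continuous Φ) (h : ∀ X ∈ S, Ψ X ≤ Φ X) : Aff g Ψ s ≤ Aff g Φ s := by
  unfold Aff
  refine setIntegral_mono_on (Aff_int (f := g) hg h1) (Aff_int (f := g) hg h2) measurableSet_Ioc fun x hx => ?_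
  by_cases hk : kap x ∈ S
  · exact mul_le_mul_of_nonneg_left (h _ hk) (h0 x)
  · rw [hz x hx hk]; simp

lemma Aff_lin {g : ℝ → ℝ → ℝ} {s : ℝ} (hg : IntegrableOn (fun x => g x s) (Ioc (-1) 1))
    {Ψ Φ : ℝ → ℝ} (h1 : Continuous Ψ) (h2 : Continuous Φ) (c d : ℝ) : Aff g (fun X => c * Ψ X + d * Φ X) s = c * Aff g Ψ s + d * Aff g Φ s := by
  unfold Aff
  rw [← integral_const_mul, ← integral_const_mul, ← integral_add (Integrable.const_mul (Aff_int (f := g) hg h1) c) (Integrable.const_mul (Aff_int (f := g) hg h2) d)]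
  congr 1; funext x; ring

lemma Half.refl {T : ℝ} {lam : ℝ → ℝ} {N : (ℝ → ℝ) → ℝ → ℝ} {y u : ℝ → ℝ} {S : ℝ → Set ℝ} (H : Half T lam N y u S) :
    Half T lam (fun Ψ => N (fun X => Ψ (-X))) (fun s => -y s) (fun s => -u s) (fun s => {X | -X ∈ S s}) where
  sub := fun s hs X hX => by have := H.sub s hs hX; constructor <;> linarith [this.1, this.2]
  mono := fun s hs Ψ Φ h1 h2 h => H.mono s hs _ _ (h1.comp continuous_neg) (h2.comp continuous_neg) fun X hX => h (-X) (by simpa using hX)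
  lin := fun s hs Ψ Φ h1 h2 c d => H.lin s hs _ _ (h1.comp continuous_neg) (h2.comp continuous_neg) c d
  der := fun s hs Ψ Ψ1 Ψ2 h => by
    have hn : ∀ X : ℝ, HasDerivAt (fun X : ℝ => -X) (-1) X := fun X => hasDerivAt_neg X
    have h' : T2 (fun X => Ψ (-X)) (fun X => -Ψ1 (-X)) (fun X => Ψ2 (-X)) :=
      ⟨fun X => ((h.d1 (-X)).comp X (hn X)).congr_deriv (by ring), fun X => (((h.d2 (-X)).comp X (hn X)).neg).congr_deriv (by ring), h.c.comp continuous_neg⟩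
    refine (H.der s hs _ _ _ h').congr_deriv ?_
    congr 2
    funext X
    unfold LL; ring

section
variable {T a : ℝ} {fI : ℝ → ℝ} {f : ℝ → ℝ → ℝ} {p : ℝ → ℝ} {pI a₀ lamI : ℝ}

lemma halfP (ha : 0 < a) (hI : IsInitialDatum fI pI a₀ lamI) (hs : IsSolutionP a fI (Ioo 0 T) f p) :
    Half T (flux f p) (Aff (fun x s => max (f x s) 0)) (fun s => kap (zl a (p s))) (fun s => kap (p s)) (fun s => Icc (kap (p s)) 1) where
  sub := fun s _ X hX => ⟨(kap_mem _).1.trans hX.1, hX.2⟩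
  mono := fun s ht Ψ Φ h1 h2 h => Aff_mono (g := fun x s => max (f x s) 0) (Mp_int ha hI hs ht) (fun x => le_max_right _ _) (fun x hx hk => by
    refine max_eq_right ?_
    by_contra! hf
    refine hk ⟨?_, (kap_mem x).2⟩
    by_contra! hlt
    rcases lt_trichotomy x (p s) with h' | h' | h'
    · linarith [kap_strictAnti ⟨hx.1.le, hx.2⟩ (sol_p_mem hs ht) h']
    · rw [h'] at hlt; exact lt_irrefl _ hlt
    · linarith [hs.neg_right s ht x ⟨h', hx.2⟩]) h1 h2 h
  lin := fun s ht Ψ Φ h1 h2 c d => Aff_lin (g := fun x s => max (f x s) 0) (Mp_int ha hI hs ht) h1 h2 c d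
  der := fun s ht Ψ Ψ1 Ψ2 h => Mp_der ha hI hs h ht

lemma halfM (ha : 0 < a) (hI : IsInitialDatum fI pI a₀ lamI) (hs : IsSolutionP a fI (Ioo 0 T) f p) :
    Half T (flux f p) (Aff (fun x s => max (-f x s) 0)) (fun s => kap (zr a (p s))) (fun s => kap (p s)) (fun s => Icc (-1) (kap (p s))) where
  sub := fun s _ X hX => ⟨hX.1, hX.2.trans (kap_mem _).2⟩
  mono := fun s ht Ψ Φ h1 h2 h => Aff_mono (g := fun x s => max (-f x s) 0) (Mm_int ha hI hs ht) (fun x => le_max_right _ _) (fun x hx hk => by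
    refine max_eq_right ?_
    by_contra! hf
    refine hk ⟨(kap_mem x).1, ?_⟩
    by_contra! hlt
    rcases lt_trichotomy x (p s) with h' | h' | h'
    · linarith [hs.pos_left s ht x ⟨hx.1.le, h'⟩]
    · rw [h'] at hlt; exact lt_irrefl _ hlt
    · linarith [kap_strictAnti (sol_p_mem hs ht) ⟨hx.1.le, hx.2⟩ h']) h1 h2 h
  lin := fun s ht Ψ Φ h1 h2 c d => Aff_lin (g := fun x s => max (-f x s) 0) (Mm_int ha hI hs ht) h1 h2 c d
  der := fun s ht Ψ Ψ1 Ψ2 h => Mm_der ha hI hs h ht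

lemma pos_mass {g : ℝ → ℝ} {A B : ℝ} (hg : IntegrableOn g (Ioc (-1) 1)) (h0 : ∀ x, 0 ≤ g x) (hA : -1 ≤ A) (hAB : A < B) (hB : B ≤ 1)
    (hp : ∀ x ∈ Ioo A B, 0 < g x) : 0 < ∫ x in Ioc (-1:ℝ) 1, g x * 1 := by
  simp only [mul_one]
  rw [setIntegral_pos_iff_support_of_nonneg_ae (Eventually.of_forall h0) hg]
  have : Ioo A B ⊆ Function.support g ∩ Ioc (-1) 1 := fun x hx => ⟨(hp x hx).ne', by linarith [hx.1], by linarith [hx.2]⟩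
  refine lt_of_lt_of_le ?_ (measure_mono this)
  simp [hAB]

lemma p_bounds (ha : a ∈ Ioo (0:ℝ) 1) (hT : 0 < T) (hI : IsInitialDatum fI pI a₀ lamI) (hs : IsSolutionP a fI (Ioo 0 T) f p) :
    ∃ c > 0, ∃ t1 < T, ∀ s ∈ Ioo t1 T, s ∈ Ioo 0 T → c ≤ kap (p s) + 1 ∧ c ≤ 1 - kap (p s) := by
  have hh : T / 2 ∈ Ioo 0 T := ⟨by linarith, by linarith⟩
  obtain ⟨c, hc, hcase⟩ := geo_case ha
  have hP := fun s (h : s ∈ Ioo 0 T) => hs.p_mem s h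
  have hzu : ∀ s ∈ Ioo 0 T, kap (zr a (p s)) < kap (p s) := fun s h => kap_strictAnti (sol_p_mem hs h) (zr_mem ha.1 (sol_p_mem hs h)) (lt_zr ha.1 (hP s h))
  have huv : ∀ s ∈ Ioo 0 T, kap (p s) < kap (zl a (p s)) := fun s h => kap_strictAnti (zl_mem ha.1 (sol_p_mem hs h)) (sol_p_mem hs h) (zl_lt ha.1 (hP s h))
  have hPn : ∀ s ∈ Ioo 0 T, -p s ∈ Ioo (-1:ℝ) 1 := fun s h => ⟨by linarith [(hP s h).2], by linarith [(hP s h).1]⟩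
  obtain ⟨c1, hc1, t1, ht1, h1⟩ := nohit hT hc (fun s h => sol_flux_nonneg hs h) (halfP ha.1 hI hs) (halfM ha.1 hI hs) (fun s _ X hX => hX.2)
    (fun s _ => (kap_mem _).1) hzu huv (fun s h => geo3 ha.1 (hP s h)) (fun s h => hcase _ (hP s h))
    (pos_mass (Mm_int ha.1 hI hs hh) (fun x => le_max_right _ _) (hP _ hh).1.le (hP _ hh).2 le_rfl fun x hx => lt_max_of_lt_left (by linarith [hs.neg_right _ hh x ⟨hx.1, hx.2.le⟩]))
  obtain ⟨c2, hc2, t2, ht2, h2⟩ := nohit hT hc (fun s h => sol_flux_nonneg hs h) (halfM ha.1 hI hs).refl (halfP ha.1 hI hs).refl (fun s _ X hX => by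
      have := hX.1; linarith)
    (fun s _ => by have := (kap_mem (zl a (p s))).2; linarith) (fun s h => by linarith [huv s h]) (fun s h => by linarith [hzu s h])
    (fun s h => by have := geo3 ha.1 (hPn s h); rw [zr_neg, zl_neg, kap_neg, kap_neg, kap_neg] at this; linarith)
    (fun s h => by have := hcase _ (hPn s h); rwa [zr_neg, kap_neg, kap_neg] at this)
    (pos_mass (Mp_int ha.1 hI hs hh) (fun x => le_max_right _ _) le_rfl (hP _ hh).1 (hP _ hh).2.le fun x hx => lt_max_of_lt_left (by linarith [hs.pos_left _ hh x ⟨hx.1.le, hx.2⟩]))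
  refine ⟨min c1 c2, lt_min hc1 hc2, max t1 t2, max_lt ht1 ht2, fun s hss hst => ⟨(min_le_left _ _).trans (h1 s ⟨(le_max_left _ _).trans_lt hss.1, hss.2⟩ hst), (min_le_right _ _).trans ?_⟩⟩
  have := h2 s ⟨(le_max_right _ _).trans_lt hss.1, hss.2⟩ hst
  linarith

theorem main_int (ha : a ∈ Ioo (0:ℝ) 1) (hI : IsInitialDatum fI pI a₀ lamI) (hs : IsSolutionP a fI (Ioo 0 T) f p) : IntegrableOn (flux f p) (Ioo 0 T) := by
  rcases le_or_gt T 0 with hT | hT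
  · rw [Ioo_eq_empty (by linarith)]; exact integrableOn_empty
  obtain ⟨c, hc, t1, ht1, hb⟩ := p_bounds ha hT hI hs
  obtain ⟨d, hd, hgap⟩ := geo_gap ha.1 hc
  obtain ⟨g, g', B, hg⟩ := (halfP ha.1 hI hs).pot_g (fun s h => sol_flux_nonneg hs h) (fun s h =>
    (kap_strictAnti (zl_mem ha.1 (sol_p_mem hs h)) (sol_p_mem hs h) (zl_lt ha.1 (hs.p_mem s h))).le)
  set τ := max t1 (T / 2) with hτ
  have hτ0 : 0 < τ := lt_of_lt_of_le (by linarith) (le_max_right _ _)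
  have hτT : τ < T := max_lt ht1 (by linarith)
  have hBn : 0 ≤ B := by have := hg τ ⟨hτ0, hτT⟩; linarith [this.2.2.2.1, this.2.2.2.2]
  have hsub : ∀ t < T, IntegrableOn (flux f p) (Icc τ t) := fun t ht => by
    refine (flux_int0 ha.1 hT hI hs (t := (t + T) / 2) (by linarith)).mono_set fun x hx => ⟨by linarith [hx.1], by linarith [hx.2]⟩
  have hbd : ∀ t < T, (∫ x in Ioc τ t, ‖flux f p x‖) ≤ B / d := fun t ht => by
    rcases le_or_gt t τ with h | h
    · rw [Ioc_eq_empty (by linarith)]; simp; positivity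
    have hin : ∀ x ∈ Icc τ t, x ∈ Ioo 0 T := fun x hx => ⟨by linarith [hx.1], by linarith [hx.2]⟩
    have e1 : (∫ x in Ioc τ t, ‖flux f p x‖) = ∫ x in τ..t, flux f p x := by
      rw [intervalIntegral.integral_of_le h.le]
      exact setIntegral_congr_fun measurableSet_Ioc fun x hx => by simp only [Real.norm_eq_abs]; exact abs_of_nonneg (sol_flux_nonneg hs (hin x ⟨hx.1.le, hx.2⟩))
    rw [e1]
    have e2 := intervalIntegral.integral_le_sub_of_hasDeriv_right_of_le (g := fun s => g s / d) (g' := fun s => g' s / d) (φ := flux f p) h.le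
      (fun x hx => ((hg x (hin x hx)).1.div_const d).continuousAt.continuousWithinAt) (fun x hx => ((hg x (hin x (Ioo_subset_Icc_self hx))).1.div_const d).hasDerivWithinAt)
      (hsub t ht) (fun x hx => by
        have hx' := hin x (Ioo_subset_Icc_self hx)
        have hb' := hb x ⟨(le_max_left _ _).trans_lt hx.1, hx'.2⟩ hx'
        have hg' := hgap _ (hs.p_mem x hx') hb'.1 hb'.2
        rw [le_div_iff₀ hd]
        exact (mul_le_mul_of_nonneg_left hg' (sol_flux_nonneg hs hx')).trans (hg x hx').2.1)
    refine e2.trans ?_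
    have q1 := (hg t (hin t ⟨h.le, le_rfl⟩)).2.2.2.2
    have q2 := (hg τ ⟨hτ0, hτT⟩).2.2.2.1
    rw [← sub_div]
    gcongr
    linarith
  have hbn : ∀ n : ℕ, T - 1 / ((n:ℝ) + 1) < T := fun n => sub_lt_self _ (by positivity)
  have hfin : IntegrableOn (flux f p) (Ioc τ T) := by
    refine integrableOn_Ioc_of_intervalIntegral_norm_bounded_right (l := atTop) (b := fun n : ℕ => T - 1 / ((n:ℝ) + 1)) (I := B / d)
      (fun n => (hsub _ (hbn n)).mono_set Ioc_subset_Icc_self) ?_ (Eventually.of_forall fun n => hbd _ (hbn n))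
    simpa using (tendsto_const_nhds (x := T)).sub (tendsto_one_div_add_atTop_nhds_zero_nat (𝕜 := ℝ))
  refine ((flux_int0 ha.1 hT hI hs (t := (τ + T) / 2) (by linarith)).union hfin).mono_set fun x hx => ?_
  rcases lt_or_ge x ((τ + T) / 2) with h | h
  · exact Or.inl ⟨hx.1, h⟩
  · exact Or.inr ⟨by linarith, hx.2.le⟩

end

/-- `L¹` bound on the flux (Proposition 3.1): as long as a solution of (P) exists
on `(0,T)`, the flux `λ(t) = −∂ₓ f(p(t), t)` satisfies `∫₀ᵀ λ(t) dt < ∞`. -/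
theorem statement11 (T a a₀ lamI : ℝ) (fI : ℝ → ℝ) (pI : ℝ)
    (f : ℝ → ℝ → ℝ) (p : ℝ → ℝ)
    (ha : a ∈ Set.Ioo (0:ℝ) 1) (ha₀ : 0 < a₀) (ha₀' : a₀ < a / 4)
    (hI : IsInitialDatum fI pI a₀ lamI)
    (hsol : IsSolutionP a fI (Set.Ioo 0 T) f p) :
    MeasureTheory.IntegrableOn (flux f p) (Set.Ioo 0 T) := by
  exact main_int ha hI hsol
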